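/- Let (Ω,σ) be a bounded one-sided NTA pair of mixed dimension in ℝ^n with n ≥ 3, let a > 0 satisfy a·σ(∂Ω) ≥ diam(Ω)^{n−2}, and let G_R be a Robin Green function for the Laplacian on (Ω,σ) with parameter a. Then there exists a constant C > 0, depending only on the geometric constants, such that G_R(X,Y) ≤ C|X−Y|^{2−n} for all X, Y ∈ Ω with X ≠ Y. -/

import Mathlib

open MeasureTheory Metric Set
open scoped RealInnerProductSpace ENNReal NNReal Topology

noncomputable section

/-- The (second-order) Laplacian-based notion of harmonicity: `u` is `C²` near each point of `S`
and its Laplacian (the sum of pure second derivatives) vanishes on `S`. -/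
def IsHarmonicOn {n : ℕ} (u : EuclideanSpace ℝ (Fin n) → ℝ)
    (S : Set (EuclideanSpace ℝ (Fin n))) : Prop :=
  ∀ x ∈ S, ContDiffAt ℝ 2 u x ∧
    ∑ i : Fin n, iteratedFDeriv ℝ 2 u x ![EuclideanSpace.single i (1 : ℝ),
      EuclideanSpace.single i (1 : ℝ)] = 0

/-- One-sided NTA conditions (C1) interior corkscrew and (C2) Harnack chains, with constant `M`. -/
structure IsOneSidedNTA {n : ℕ} (M : ℝ) (Ω : Set (EuclideanSpace ℝ (Fin n))) : Prop where
  isOpen : IsOpen Ω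
  M_gt_one : 1 < M
  corkscrew : ∀ Q ∈ frontier Ω, ∀ r : ℝ, 0 < r → r < Metric.diam Ω / 10 →
    ∃ A ∈ Ω ∩ ball Q r, r / M ≤ infDist A (frontier Ω)
  harnack : ∀ r ε : ℝ, ∀ k : ℕ, 0 < r → r < Metric.diam Ω / 10 → 0 < ε → 1 ≤ k →
    ∀ x ∈ Ω, ∀ y ∈ Ω, dist x y = r → ε ≤ infDist x (frontier Ω) →
      ε ≤ infDist y (frontier Ω) → r ≤ 2 ^ k * ε →
      ∃ (c : ℕ → EuclideanSpace ℝ (Fin n)) (ρ : ℕ → ℝ),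
        c 1 = x ∧ c ⌈M * (k : ℝ)⌉₊ = y ∧
        ∀ i : ℕ, 1 ≤ i → i ≤ ⌈M * (k : ℝ)⌉₊ →
          0 < ρ i ∧ ρ i ≤ infDist (c i) (frontier Ω) / 10 ∧ ball (c i) (ρ i) ⊆ Ω ∧
          (i < ⌈M * (k : ℝ)⌉₊ → c (i + 1) ∈ ball (c i) (ρ i))

/-- A bounded one-sided NTA pair of mixed dimension, with geometric constants `M, Cσ, d, cd`. -/
structure IsMixedPair {n : ℕ} (M Cσ d cd : ℝ) (Ω : Set (EuclideanSpace ℝ (Fin n)))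
    (σ : Measure (EuclideanSpace ℝ (Fin n))) : Prop where
  nta : IsOneSidedNTA M Ω
  bounded : Bornology.IsBounded Ω
  nonempty : Ω.Nonempty
  supp_pos : ∀ Q ∈ frontier Ω, ∀ r : ℝ, 0 < r → 0 < σ (ball Q r)
  null_outside : σ (frontier Ω)ᶜ = 0
  finite : σ (frontier Ω) ≠ ⊤
  Cσ_pos : 0 < Cσ
  doubling : ∀ Q ∈ frontier Ω, ∀ r : ℝ, 0 < r → r < Metric.diam Ω →
    (σ (ball Q (2 * r))).toReal ≤ Cσ * (σ (ball Q r)).toReal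
  d_gt : (n : ℝ) - 2 < d
  cd_pos : 0 < cd
  lower_dim : ∀ Q ∈ frontier Ω, ∀ r s : ℝ, 0 < s → s < r → r < Metric.diam Ω →
    cd * (r / s) ^ d * (σ (ball Q s)).toReal ≤ (σ (ball Q r)).toReal

/-- A Robin Green function for the Laplacian on `(Ω, σ)` with parameter `a`. -/
structure IsRobinGreen {n : ℕ} (Ω : Set (EuclideanSpace ℝ (Fin n)))
    (σ : Measure (EuclideanSpace ℝ (Fin n))) (a : ℝ)
    (G : EuclideanSpace ℝ (Fin n) → EuclideanSpace ℝ (Fin n) → ℝ) : Prop where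
  symm : ∀ X ∈ Ω, ∀ Y ∈ Ω, X ≠ Y → G X Y = G Y X
  nonneg : ∀ Y ∈ Ω, ∀ X ∈ closure Ω \ {Y}, 0 ≤ G X Y
  contOn : ∀ Y ∈ Ω, ContinuousOn (fun X => G X Y) (closure Ω \ {Y})
  harmonic : ∀ Y ∈ Ω, IsHarmonicOn (fun X => G X Y) (Ω \ {Y})
  grad_L2 : ∀ Y ∈ Ω, ∀ r : ℝ, 0 < r →
    IntegrableOn (fun X => ‖gradient (fun Z => G Z Y) X‖ ^ 2) (Ω \ ball Y r) volume
  grad_L1 : ∀ Y ∈ Ω, IntegrableOn (fun X => ‖gradient (fun Z => G Z Y) X‖) Ω volume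
  weak : ∀ Y ∈ Ω, ∀ φ : EuclideanSpace ℝ (Fin n) → ℝ,
    ContDiff ℝ (⊤ : ℕ∞) φ → HasCompactSupport φ →
    (∫ X in Ω, ⟪gradient (fun Z => G Z Y) X, gradient φ X⟫) +
      a * ∫ P in frontier Ω, G P Y * φ P ∂σ = φ Y

/-- A Dirichlet Green function for the Laplacian on `Ω`. -/
structure IsDirichletGreen {n : ℕ} (Ω : Set (EuclideanSpace ℝ (Fin n)))
    (G : EuclideanSpace ℝ (Fin n) → EuclideanSpace ℝ (Fin n) → ℝ) : Prop where
  nonneg : ∀ Y ∈ Ω, ∀ X ∈ closure Ω \ {Y}, 0 ≤ G X Y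
  contOn : ∀ Y ∈ Ω, ContinuousOn (fun X => G X Y) (closure Ω \ {Y})
  boundary_zero : ∀ Y ∈ Ω, ∀ Q ∈ frontier Ω, G Q Y = 0
  harmonic : ∀ Y ∈ Ω, IsHarmonicOn (fun X => G X Y) (Ω \ {Y})
  grad_L2 : ∀ Y ∈ Ω, ∀ r : ℝ, 0 < r →
    IntegrableOn (fun X => ‖gradient (fun Z => G Z Y) X‖ ^ 2) (Ω \ ball Y r) volume
  grad_L1 : ∀ Y ∈ Ω, IntegrableOn (fun X => ‖gradient (fun Z => G Z Y) X‖) Ω volume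
  weak : ∀ Y ∈ Ω, ∀ φ : EuclideanSpace ℝ (Fin n) → ℝ,
    ContDiff ℝ (⊤ : ℕ∞) φ → HasCompactSupport φ → tsupport φ ⊆ Ω →
    (∫ X in Ω, ⟪gradient (fun Z => G Z Y) X, gradient φ X⟫) = φ Y

/-- A solution with pole at `Y` and vanishing Robin condition (parameter `a`). -/
structure IsRobinPoleSolution {n : ℕ} (Ω : Set (EuclideanSpace ℝ (Fin n)))
    (σ : Measure (EuclideanSpace ℝ (Fin n))) (a : ℝ) (Y : EuclideanSpace ℝ (Fin n))
    (u : EuclideanSpace ℝ (Fin n) → ℝ) : Prop where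
  contOn : ContinuousOn u (closure Ω \ {Y})
  harmonic : IsHarmonicOn u (Ω \ {Y})
  grad_L2 : ∀ r : ℝ, 0 < r → IntegrableOn (fun X => ‖gradient u X‖ ^ 2) (Ω \ ball Y r) volume
  weak : ∀ φ : EuclideanSpace ℝ (Fin n) → ℝ,
    ContDiff ℝ (⊤ : ℕ∞) φ → HasCompactSupport φ → Y ∉ tsupport φ →
    (∫ X in Ω, ⟪gradient u X, gradient φ X⟫) + a * ∫ P in frontier Ω, u P * φ P ∂σ = 0

/-- A nonnegative weak solution of the homogeneous Robin problem in `B(Q, ρ)` (parameter `a`). -/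
structure IsRobinLocalSolution {n : ℕ} (Ω : Set (EuclideanSpace ℝ (Fin n)))
    (σ : Measure (EuclideanSpace ℝ (Fin n))) (a : ℝ) (Q : EuclideanSpace ℝ (Fin n)) (ρ : ℝ)
    (u : EuclideanSpace ℝ (Fin n) → ℝ) : Prop where
  nonneg : ∀ X ∈ closure Ω ∩ ball Q ρ, 0 ≤ u X
  contOn : ContinuousOn u (closure Ω ∩ ball Q ρ)
  harmonic : IsHarmonicOn u (Ω ∩ ball Q ρ)
  grad_L2 : ∀ ρ' : ℝ, ρ' < ρ →
    IntegrableOn (fun X => ‖gradient u X‖ ^ 2) (Ω ∩ ball Q ρ') volume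
  weak : ∀ φ : EuclideanSpace ℝ (Fin n) → ℝ,
    ContDiff ℝ (⊤ : ℕ∞) φ → HasCompactSupport φ → tsupport φ ⊆ ball Q ρ →
    (∫ X in Ω, ⟪gradient u X, gradient φ X⟫) + a * ∫ P in frontier Ω, u P * φ P ∂σ = 0

/-- A flux solution: `u = 1` on `cl B(0,1)`, harmonic outside, homogeneous Robin condition. -/
structure IsFluxSolution {n : ℕ} (Ω : Set (EuclideanSpace ℝ (Fin n)))
    (σ : Measure (EuclideanSpace ℝ (Fin n))) (a : ℝ)
    (u : EuclideanSpace ℝ (Fin n) → ℝ) : Prop where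
  contOn : ContinuousOn u (closure Ω)
  one_on_ball : ∀ X ∈ closedBall (0 : EuclideanSpace ℝ (Fin n)) 1, u X = 1
  harmonic : IsHarmonicOn u (Ω \ closedBall (0 : EuclideanSpace ℝ (Fin n)) 1)
  grad_L2 : IntegrableOn (fun X => ‖gradient u X‖ ^ 2)
    (Ω \ closedBall (0 : EuclideanSpace ℝ (Fin n)) 1) volume
  weak : ∀ φ : EuclideanSpace ℝ (Fin n) → ℝ,
    ContDiff ℝ (⊤ : ℕ∞) φ → HasCompactSupport φ →
    tsupport φ ⊆ (closedBall (0 : EuclideanSpace ℝ (Fin n)) 1)ᶜ →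
    (∫ X in Ω, ⟪gradient u X, gradient φ X⟫) + a * ∫ P in frontier Ω, u P * φ P ∂σ = 0

/-- A Dirichlet harmonic measure for `Ω`: a family of probability measures on `∂Ω` solving the
Dirichlet problem for continuous boundary data. -/
structure IsDirichletHM {n : ℕ} (Ω : Set (EuclideanSpace ℝ (Fin n)))
    (ω : EuclideanSpace ℝ (Fin n) → Measure (EuclideanSpace ℝ (Fin n))) : Prop where
  prob : ∀ X ∈ Ω, IsProbabilityMeasure (ω X)
  supported : ∀ X ∈ Ω, (ω X) (frontier Ω)ᶜ = 0
  solves : ∀ f : EuclideanSpace ℝ (Fin n) → ℝ, ContinuousOn f (frontier Ω) →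
    ∃ h : EuclideanSpace ℝ (Fin n) → ℝ,
      ContinuousOn h (closure Ω) ∧ IsHarmonicOn h Ω ∧
      (∀ X ∈ Ω, h X = ∫ y, f y ∂(ω X)) ∧ (∀ Q ∈ frontier Ω, h Q = f Q)

end

namespace RG

abbrev Eu (n : ℕ) := EuclideanSpace ℝ (Fin n)

noncomputable def av {n : ℕ} (v : Eu n → ℝ) (x : Eu n) (ρ : ℝ) : ℝ :=
  (volume (ball (0 : Eu n) 1)).toReal⁻¹ * ∫ z in ball (0 : Eu n) 1, v (x + ρ • z)

noncomputable def gr2 {n : ℕ} (Ω : Set (Eu n)) (v : Eu n → ℝ) : Eu n → ℝ≥0∞ :=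
  Ω.indicator (fun z => ‖fderiv ℝ v z‖ₑ ^ 2)

lemma gr2_meas {n : ℕ} {Ω : Set (Eu n)} (hΩ : IsOpen Ω) (v : Eu n → ℝ) : Measurable (gr2 Ω v) :=
  ((measurable_fderiv ℝ v).enorm.pow_const 2).indicator hΩ.measurableSet

noncomputable def ωn (n : ℕ) : ℝ := (volume (ball (0 : Eu n) 1)).toReal

lemma ωn_pos (n : ℕ) : 0 < ωn n :=
  ENNReal.toReal_pos (measure_ball_pos volume _ one_pos).ne' measure_ball_lt_top.ne

lemma vol_ball {n : ℕ} (x : Eu n) {r : ℝ} (hr : 0 < r) :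
    volume (ball x r) = ENNReal.ofReal (ωn n * r ^ n) := by
  rw [Measure.addHaar_ball_of_pos volume x hr, mul_comm, finrank_euclideanSpace_fin,
    ENNReal.ofReal_mul (ωn_pos n).le, ωn, ENNReal.ofReal_toReal measure_ball_lt_top.ne]

lemma lint_scale {n : ℕ} (g : Eu n → ℝ≥0∞) (hg : Measurable g) (x : Eu n) {ρ : ℝ} (hρ : 0 < ρ) :
    ∫⁻ z in ball (0 : Eu n) 1, g (x + ρ • z) = ENNReal.ofReal (ρ ^ n)⁻¹ * ∫⁻ z in ball x ρ, g z := by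
  have h1 : ∀ f : Eu n → ℝ≥0∞, Measurable f → ∫⁻ z, f (x + ρ • z) = ENNReal.ofReal (ρ ^ n)⁻¹ * ∫⁻ z, f z := by
    intro f hf
    have h2 := Measure.map_addHaar_smul (volume : Measure (Eu n)) hρ.ne'
    have h3 : ∫⁻ z, f (x + ρ • z) = ∫⁻ z, f (x + z) ∂(Measure.map (ρ • ·) volume) := by
      rw [lintegral_map (by fun_prop) (by fun_prop)]
    rw [h3, h2, lintegral_smul_measure, lintegral_add_left_eq_self]
    simp [abs_of_pos hρ]
  rw [← lintegral_indicator measurableSet_ball, ← lintegral_indicator measurableSet_ball,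
    ← h1 _ (hg.indicator measurableSet_ball)]
  congr 1; ext z
  have : (x + ρ • z ∈ ball x ρ) ↔ z ∈ ball (0 : Eu n) 1 := by
    simp [norm_smul, abs_of_pos hρ]
    rw [mul_lt_iff_lt_one_right hρ]
  by_cases h : z ∈ ball (0 : Eu n) 1
  · rw [indicator_of_mem h, indicator_of_mem (this.2 h)]
  · rw [indicator_of_notMem h, indicator_of_notMem (fun h' => h (this.1 h'))]

lemma lint_sq {α : Type*} [MeasurableSpace α] (μ : Measure α) (f : α → ℝ≥0∞) (hf : AEMeasurable f μ) :
    (∫⁻ a, f a ∂μ) ^ 2 ≤ μ univ * ∫⁻ a, f a ^ 2 ∂μ := by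
  have := ENNReal.lintegral_mul_le_Lp_mul_Lq μ Real.HolderConjugate.two_two
    (f := fun _ => 1) (g := f) aemeasurable_const hf
  simp only [Pi.mul_apply, one_mul, ENNReal.one_rpow, lintegral_const] at this
  calc (∫⁻ a, f a ∂μ) ^ 2 ≤ _ := pow_le_pow_left' this 2
    _ = _ := by
      rw [mul_pow, ← ENNReal.rpow_natCast, ← ENNReal.rpow_mul, ← ENNReal.rpow_natCast, ← ENNReal.rpow_mul]
      norm_num

lemma seg_bound {n : ℕ} {Ω : Set (Eu n)} (hΩ : IsOpen Ω) {v : Eu n → ℝ} (hv : ContDiffOn ℝ 1 v Ω)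
    (p q : Eu n) (hseg : ∀ s ∈ Icc (0:ℝ) 1, p + s • q ∈ Ω) :
    ‖v (p + q) - v p‖ₑ ≤ ∫⁻ s in Icc (0:ℝ) 1, ‖q‖ₑ * ‖fderiv ℝ v (p + s • q)‖ₑ := by
  have hd : ∀ s ∈ Icc (0:ℝ) 1, HasDerivAt (fun s : ℝ => v (p + s • q)) (fderiv ℝ v (p + s • q) q) s := by
    intro s hs
    have h1 : HasFDerivAt v (fderiv ℝ v (p + s • q)) (p + s • q) :=
      ((hv.contDiffAt (hΩ.mem_nhds (hseg s hs))).differentiableAt (by norm_num)).hasFDerivAt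
    have h2 : HasDerivAt (fun s : ℝ => p + s • q) q s := by
      simpa using ((hasDerivAt_id s).smul_const q).const_add p
    exact h1.comp_hasDerivAt s h2
  have hc : ContinuousOn (fun s : ℝ => fderiv ℝ v (p + s • q) q) (Icc 0 1) := by
    have := (hv.continuousOn_fderiv_of_isOpen hΩ le_rfl).comp (f := fun s : ℝ => p + s • q) (s := Icc 0 1)
      (by fun_prop) (fun s hs => hseg s hs)
    exact this.clm_apply continuousOn_const
  have hI : ∫ s in (0:ℝ)..1, fderiv ℝ v (p + s • q) q = v (p + q) - v p := by
    rw [intervalIntegral.integral_eq_sub_of_hasDerivAt (f := fun s : ℝ => v (p + s • q))]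
    · simp
    · intro s hs; rw [uIcc_of_le zero_le_one] at hs; exact hd s hs
    · apply ContinuousOn.intervalIntegrable; rwa [uIcc_of_le zero_le_one]
  rw [← hI, intervalIntegral.integral_of_le zero_le_one, ← integral_Icc_eq_integral_Ioc]
  refine (enorm_integral_le_lintegral_enorm _).trans (lintegral_mono fun s => ?_)
  rw [mul_comm]
  exact ContinuousLinearMap.le_opENorm _ _

lemma poinc {n : ℕ} {Ω : Set (Eu n)} (hΩ : IsOpen Ω) {v : Eu n → ℝ} (hv : ContDiffOn ℝ 1 v Ω)
    (x y : Eu n) {ρ ρ' m L : ℝ} (hm : 0 < m) (h1 : m ≤ ρ) (h2 : m ≤ ρ')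
    (K : Set (Eu n)) (hK : Convex ℝ K) (hKΩ : K ⊆ Ω) (hx : closedBall x ρ ⊆ K) (hy : closedBall y ρ' ⊆ K)
    (hL : dist x y + |ρ - ρ'| ≤ L) :
    ENNReal.ofReal ((av v x ρ - av v y ρ') ^ 2) ≤
      ENNReal.ofReal ((ωn n)⁻¹ * L ^ 2 * (m ^ n)⁻¹) * ∫⁻ z in K, gr2 Ω v z := by
  have hL0 : 0 ≤ L := le_trans (by positivity) hL
  have hint : ∀ (x : Eu n) (ρ : ℝ), 0 < ρ → closedBall x ρ ⊆ K →
      IntegrableOn (fun z => v (x + ρ • z)) (ball (0 : Eu n) 1) := by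
    intro x ρ hρ hx
    have hmap : ∀ z ∈ closedBall (0 : Eu n) 1, x + ρ • z ∈ closedBall x ρ := by
      intro z hz
      simp only [mem_closedBall, dist_zero_right, dist_self_add_left, norm_smul, Real.norm_eq_abs, abs_of_pos hρ] at hz ⊢
      nlinarith
    have : ContinuousOn (fun z => v (x + ρ • z)) (closedBall (0 : Eu n) 1) :=
      hv.continuousOn.comp (f := fun z => x + ρ • z) (by fun_prop) (fun z hz => hKΩ (hx (hmap z hz)))
    exact (this.integrableOn_compact (isCompact_closedBall _ _)).mono_set ball_subset_closedBall
  have hρ : 0 < ρ := hm.trans_le h1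
  have hρ' : 0 < ρ' := hm.trans_le h2
  have e1 : av v x ρ - av v y ρ' = (ωn n)⁻¹ * ∫ z in ball (0 : Eu n) 1, (v (x + ρ • z) - v (y + ρ' • z)) := by
    rw [integral_sub (hint x ρ hρ hx) (hint y ρ' hρ' hy), mul_sub]; rfl
  set B := ball (0 : Eu n) 1
  set G : ℝ → Eu n → ℝ≥0∞ := fun s z => ‖fderiv ℝ v ((y + s • (x - y)) + (ρ' + s * (ρ - ρ')) • z)‖ₑ with hG
  have hGm : Measurable (Function.uncurry G) := by
    refine (measurable_fderiv ℝ v).enorm.comp ?_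
    refine Continuous.measurable ?_
    fun_prop
  have hin : ∀ z ∈ closedBall (0 : Eu n) 1, ∀ s ∈ Icc (0:ℝ) 1,
      (y + s • (x - y)) + (ρ' + s * (ρ - ρ')) • z ∈ K := by
    intro z hz s hs
    have hmap : ∀ (x : Eu n) (ρ : ℝ), 0 < ρ → x + ρ • z ∈ closedBall x ρ := by
      intro x ρ hρ
      simp only [mem_closedBall, dist_zero_right, dist_self_add_left, norm_smul, Real.norm_eq_abs, abs_of_pos hρ] at hz ⊢
      nlinarith
    have := hK (hy (hmap y ρ' hρ')) (hx (hmap x ρ hρ)) (by linarith [hs.2] : 0 ≤ 1 - s) hs.1 (by ring)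
    convert this using 1
    module
  have b1 : ‖∫ z in B, (v (x + ρ • z) - v (y + ρ' • z))‖ₑ ≤
      ∫⁻ z in B, ∫⁻ s in Icc (0:ℝ) 1, ENNReal.ofReal L * G s z := by
    refine (enorm_integral_le_lintegral_enorm _).trans (setLIntegral_mono' measurableSet_ball fun z hz => ?_)
    have hz' := ball_subset_closedBall hz
    have := seg_bound hΩ hv (y + ρ' • z) ((x - y) + (ρ - ρ') • z) (by
      intro s hs
      have := hKΩ (hin z hz' s hs)
      convert this using 1
      module)
    have e2 : y + ρ' • z + (x - y + (ρ - ρ') • z) = x + ρ • z := by module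
    rw [e2] at this
    refine this.trans (lintegral_mono fun s => ?_)
    have e3 : y + ρ' • z + s • (x - y + (ρ - ρ') • z) = (y + s • (x - y)) + (ρ' + s * (ρ - ρ')) • z := by module
    simp only [hG]
    rw [e3]
    gcongr
    rw [← ofReal_norm]
    apply ENNReal.ofReal_le_ofReal
    refine le_trans ?_ hL
    refine (norm_add_le _ _).trans ?_
    rw [norm_smul, dist_eq_norm, Real.norm_eq_abs]
    have : ‖z‖ ≤ 1 := by simpa using hz'
    nlinarith [abs_nonneg (ρ - ρ')]
  have b2 : (∫⁻ z in B, ∫⁻ s in Icc (0:ℝ) 1, ENNReal.ofReal L * G s z) ^ 2 ≤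
      ENNReal.ofReal (ωn n) * (ENNReal.ofReal (L ^ 2) * (ENNReal.ofReal (m ^ n)⁻¹ * ∫⁻ z in K, gr2 Ω v z)) := by
    have hm2 : Measurable (fun p : Eu n × ℝ => ENNReal.ofReal L * G p.2 p.1) :=
      (hGm.comp measurable_swap).const_mul _
    rw [← lintegral_prod (fun p : Eu n × ℝ => ENNReal.ofReal L * G p.2 p.1) hm2.aemeasurable]
    refine (lint_sq _ _ hm2.aemeasurable).trans ?_
    gcongr
    · rw [← univ_prod_univ, Measure.prod_prod]
      simp [B, ωn, ENNReal.ofReal_toReal measure_ball_lt_top.ne]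
    · rw [lintegral_prod_symm _ (hm2.pow_const 2).aemeasurable]
      simp only [mul_pow, ← ENNReal.ofReal_pow hL0]
      have : ∀ s ∈ Icc (0:ℝ) 1, ∫⁻ z in B, ENNReal.ofReal (L ^ 2) * G s z ^ 2 ≤
          ENNReal.ofReal (L ^ 2) * (ENNReal.ofReal (m ^ n)⁻¹ * ∫⁻ z in K, gr2 Ω v z) := by
        intro s hs
        rw [lintegral_const_mul' _ _ ENNReal.ofReal_ne_top]
        gcongr
        have hms : m ≤ ρ' + s * (ρ - ρ') := by nlinarith [hs.1, hs.2]
        have hps : 0 < ρ' + s * (ρ - ρ') := hm.trans_le hms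
        have e4 : ∫⁻ z in B, G s z ^ 2 = ∫⁻ z in B, gr2 Ω v ((y + s • (x - y)) + (ρ' + s * (ρ - ρ')) • z) := by
          refine setLIntegral_congr_fun measurableSet_ball fun z hz => ?_
          simp only [gr2, hG]
          rw [indicator_of_mem (hKΩ (hin z (ball_subset_closedBall hz) s hs))]
        rw [e4, lint_scale _ (gr2_meas hΩ v) _ hps]
        have hsub : ball (y + s • (x - y)) (ρ' + s * (ρ - ρ')) ⊆ K := by
          intro w hw
          have := hin ((ρ' + s * (ρ - ρ'))⁻¹ • (w - (y + s • (x - y)))) ?_ s hs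
          · rwa [smul_smul, mul_inv_cancel₀ hps.ne', one_smul, add_sub_cancel] at this
          · rw [mem_ball, dist_eq_norm] at hw
            simp only [mem_closedBall, dist_zero_right, norm_smul, norm_inv, Real.norm_eq_abs, abs_of_pos hps]
            rw [inv_mul_le_iff₀ hps]; linarith
        gcongr
      calc _ ≤ ∫⁻ s in Icc (0:ℝ) 1, ENNReal.ofReal (L ^ 2) * (ENNReal.ofReal (m ^ n)⁻¹ * ∫⁻ z in K, gr2 Ω v z) :=
            setLIntegral_mono' measurableSet_Icc this
        _ = _ := by simp
  rw [e1, mul_pow, ENNReal.ofReal_mul (by positivity)]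
  have e5 : ENNReal.ofReal ((∫ z in B, (v (x + ρ • z) - v (y + ρ' • z))) ^ 2) =
      ‖∫ z in B, (v (x + ρ • z) - v (y + ρ' • z))‖ₑ ^ 2 := by
    rw [Real.enorm_eq_ofReal_abs, ← ENNReal.ofReal_pow (abs_nonneg _), sq_abs]
  rw [e5]
  have hω := ωn_pos n
  calc _ ≤ ENNReal.ofReal ((ωn n)⁻¹ ^ 2) * (ENNReal.ofReal (ωn n) * (ENNReal.ofReal (L ^ 2) * (ENNReal.ofReal (m ^ n)⁻¹ * ∫⁻ z in K, gr2 Ω v z))) := by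
        gcongr
        exact (pow_le_pow_left' b1 2).trans b2
    _ = _ := by
      rw [← mul_assoc, ← mul_assoc, ← mul_assoc, ← ENNReal.ofReal_mul (by positivity), ← ENNReal.ofReal_mul (by positivity), ← ENNReal.ofReal_mul (by positivity)]
      congr 2
      field_simp

end RG

namespace RG

lemma front_ne {n : ℕ} (hn : 3 ≤ n) {Ω : Set (Eu n)} (hb : Bornology.IsBounded Ω) (hne : Ω.Nonempty) :
    (frontier Ω).Nonempty := by
  have : NeZero n := ⟨by omega⟩
  by_contra h
  rw [not_nonempty_iff_eq_empty, frontier_eq_empty_iff] at h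
  rcases h with h | h
  · exact hne.ne_empty h
  · rw [h] at hb
    exact NormedSpace.unbounded_univ ℝ (Eu n) hb

lemma ball_sub {n : ℕ} {Ω : Set (Eu n)} {z : Eu n} (hz : z ∈ Ω) :
    ball z (infDist z (frontier Ω)) ⊆ Ω := by
  intro w hw
  by_contra hwΩ
  have hpos : 0 < infDist z (frontier Ω) := lt_of_le_of_lt dist_nonneg hw
  have hc : IsPreconnected (ball z (infDist z (frontier Ω))) := (convex_ball _ _).isPreconnected
  have : (ball z (infDist z (frontier Ω)) ∩ frontier Ω).Nonempty := by
    by_contra hcon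
    have hdis : ∀ q ∈ ball z (infDist z (frontier Ω)), q ∉ frontier Ω := fun q hq hqf => hcon ⟨q, hq, hqf⟩
    obtain ⟨q, -, hq1, hq2⟩ := hc (interior Ω) (closure Ω)ᶜ isOpen_interior isClosed_closure.isOpen_compl
      (fun q hq => by
        by_contra h
        simp only [mem_union, mem_compl_iff, not_or, not_not] at h
        exact hdis q hq ⟨h.2, h.1⟩)
      ⟨z, mem_ball_self hpos, by
        by_contra h
        exact hdis z (mem_ball_self hpos) ⟨subset_closure hz, h⟩⟩
      ⟨w, hw, fun h => hdis w hw ⟨h, fun h' => hwΩ (interior_subset h')⟩⟩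
    exact hq2 (subset_closure (interior_subset hq1))
  obtain ⟨q, hq, hqf⟩ := this
  have := infDist_le_dist_of_mem (x := z) hqf
  rw [mem_ball, dist_comm] at hq
  linarith

lemma cork {n : ℕ} (hn : 3 ≤ n) {M : ℝ} {Ω : Set (Eu n)} (h : IsOneSidedNTA M Ω)
    (hb : Bornology.IsBounded Ω) (hne : Ω.Nonempty)
    {Z : Eu n} (hZ : Z ∈ closure Ω) {s : ℝ} (hs : 0 < s) (hsD : s < diam Ω / 10) :
    ∃ x ∈ Ω, dist x Z < s ∧ (2 * M)⁻¹ * s ≤ infDist x (frontier Ω) := by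
  have hM := h.M_gt_one
  by_cases hδ : s / 2 ≤ infDist Z (frontier Ω)
  · refine ⟨Z, ?_, by simpa using hs, ?_⟩
    · by_contra hZΩ
      have : Z ∈ frontier Ω := ⟨hZ, fun h' => hZΩ (interior_subset h')⟩
      rw [infDist_zero_of_mem this] at hδ
      linarith
    · refine le_trans ?_ hδ
      rw [mul_comm, div_eq_mul_inv]
      gcongr
      linarith
  · push Not at hδ
    obtain ⟨Q, hQ, hQd⟩ := (infDist_lt_iff (front_ne hn hb hne)).1 hδ
    obtain ⟨A, ⟨hA, hAQ⟩, hA2⟩ := h.corkscrew Q hQ (s / 2) (by linarith) (by linarith)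
    refine ⟨A, hA, ?_, ?_⟩
    · have := dist_triangle A Q Z
      rw [dist_comm Q Z] at this
      rw [mem_ball] at hAQ
      linarith
    · refine le_trans (le_of_eq ?_) hA2
      field_simp

lemma ofReal_sq_add {a b c : ℝ} : ENNReal.ofReal ((a - c) ^ 2) ≤
    2 * (ENNReal.ofReal ((a - b) ^ 2) + ENNReal.ofReal ((b - c) ^ 2)) := by
  rw [← ENNReal.ofReal_add (by positivity) (by positivity)]
  rw [show (2 : ℝ≥0∞) = ENNReal.ofReal 2 by simp, ← ENNReal.ofReal_mul (by norm_num)]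
  apply ENNReal.ofReal_le_ofReal
  nlinarith [sq_nonneg (a - b - (b - c))]

lemma sq_chain (a : ℕ → ℝ) (N : ℕ) (T : ℝ≥0∞)
    (h : ∀ i, 1 ≤ i → i < N → ENNReal.ofReal ((a i - a (i + 1)) ^ 2) ≤ T) :
    ∀ i, 1 ≤ i → i ≤ N → ENNReal.ofReal ((a 1 - a i) ^ 2) ≤ 4 ^ i * T := by
  intro i hi
  induction i, hi using Nat.le_induction with
  | base => intro _; simp
  | succ i hi ih =>
    intro hN
    have h1 := ih (by omega)
    have h2 := h i hi (by omega)
    refine (ofReal_sq_add (b := a i)).trans ?_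
    calc _ ≤ 2 * (4 ^ i * T + 4 ^ i * T) := by
          gcongr
          refine h2.trans ?_
          exact le_mul_of_one_le_left' (one_le_pow₀ (by norm_num))
      _ = _ := by rw [pow_succ]; ring

set_option maxHeartbeats 1000000 in
lemma chain {n : ℕ} (M : ℝ) (hM : 1 < M) : ∃ θ C Λ : ℝ, 0 < θ ∧ θ ≤ (2 * M)⁻¹ / 10 ∧ 0 < C ∧ 0 < Λ ∧
    ∀ Ω : Set (Eu n), IsOneSidedNTA M Ω → ∀ v : Eu n → ℝ, ContDiffOn ℝ 1 v Ω →
      ∀ s, 0 < s → 10 * s < diam Ω / 10 → ∀ x ∈ Ω, ∀ y ∈ Ω, (2 * M)⁻¹ * s ≤ infDist x (frontier Ω) →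
        (2 * M)⁻¹ * s ≤ infDist y (frontier Ω) → dist x y ≤ 10 * s →
        ENNReal.ofReal ((av v x (θ * s) - av v y (θ * s)) ^ 2) ≤
          ENNReal.ofReal (C * s ^ 2 * (s ^ n)⁻¹) * ∫⁻ z in ball x (Λ * s), gr2 Ω v z := by
  set c1 := (2 * M)⁻¹ with hc1
  have hc1p : 0 < c1 := by positivity
  have hc1l : c1 ≤ 1 := inv_le_one_of_one_le₀ (by linarith)
  obtain ⟨k', hk'⟩ := pow_unbounded_of_one_lt (10 / c1) (one_lt_two : (1:ℝ) < 2)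
  set k := k' + 1 with hk
  have hk2 : 10 ≤ 2 ^ k * c1 := by
    rw [div_lt_iff₀ hc1p] at hk'
    rw [hk, pow_succ]; nlinarith [pow_pos (two_pos : (0:ℝ) < 2) k']
  set N := ⌈M * (k : ℝ)⌉₊ with hN
  have hN1 : 1 ≤ N := by
    rw [hN, Nat.one_le_ceil_iff]; positivity
  set θ := c1 * (9 / 10) ^ N / 10 with hθ
  have hθp : 0 < θ := by positivity
  have hθl : θ ≤ c1 / 10 := by
    rw [hθ]; gcongr
    exact mul_le_of_le_one_right hc1p.le (pow_le_one₀ (by norm_num) (by norm_num))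
  set R := ((11:ℝ) / 10) ^ N * 11 with hR
  have hRp : 11 ≤ R := by
    have : (1:ℝ) ≤ (11 / 10) ^ N := one_le_pow₀ (by norm_num)
    rw [hR]; linarith
  clear_value R θ N k c1
  refine ⟨θ, 4 ^ N * ((ωn n)⁻¹ * R ^ 2 * (θ ^ n)⁻¹), (N + 1) * R, hθp, hθl, ?_, by positivity, ?_⟩
  · have := ωn_pos n; positivity
  intro Ω h v hv s hs hsD x hx y hy hδx hδy hxy
  have hω := ωn_pos n
  set e := ∫⁻ z in ball x ((N + 1) * R * s), gr2 Ω v z with he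
  -- single step
  have step : ∀ p q : Eu n, ∀ K : Set (Eu n), Convex ℝ K → K ⊆ Ω → K ⊆ ball x ((N + 1) * R * s) →
      closedBall p (θ * s) ⊆ K → closedBall q (θ * s) ⊆ K → dist p q ≤ R * s →
      ENNReal.ofReal ((av v p (θ * s) - av v q (θ * s)) ^ 2) ≤
        ENNReal.ofReal ((ωn n)⁻¹ * R ^ 2 * (θ ^ n)⁻¹ * s ^ 2 * (s ^ n)⁻¹) * e := by
    intro p q K hK hKΩ hKb hp hq hpq
    refine (poinc h.isOpen hv p q (m := θ * s) (L := R * s) (by positivity) le_rfl le_rfl K hK hKΩ hp hq (by simpa using hpq)).trans ?_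
    have heq : (ωn n)⁻¹ * (R * s) ^ 2 * ((θ * s) ^ n)⁻¹ = (ωn n)⁻¹ * R ^ 2 * (θ ^ n)⁻¹ * s ^ 2 * (s ^ n)⁻¹ := by
      rw [mul_pow, mul_pow, mul_inv]; ring
    rw [heq]
    exact mul_le_mul_right (lintegral_mono_set hKb) _
  have fin : ENNReal.ofReal ((av v x (θ * s) - av v y (θ * s)) ^ 2) ≤
      4 ^ N * (ENNReal.ofReal ((ωn n)⁻¹ * R ^ 2 * (θ ^ n)⁻¹ * s ^ 2 * (s ^ n)⁻¹) * e) := by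
    by_cases hδ : 11 * s ≤ infDist x (frontier Ω)
    · refine le_trans ?_ (le_mul_of_one_le_left' (one_le_pow₀ (by norm_num)))
      have hθs : θ * s < s := by nlinarith
      apply step x y (ball x (11 * s)) (convex_ball _ _)
      · exact (ball_subset_ball hδ).trans (ball_sub hx)
      · apply ball_subset_ball
        have : (0:ℝ) ≤ N := by positivity
        nlinarith [mul_nonneg this (by linarith : 0 ≤ R), mul_le_mul_of_nonneg_right hRp hs.le, mul_nonneg (mul_nonneg this (by linarith : 0 ≤ R)) hs.le]
      · exact closedBall_subset_ball (by linarith)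
      · intro z hz
        rw [mem_closedBall] at hz
        rw [mem_ball]
        have := dist_triangle z y x
        rw [dist_comm y x] at this
        linarith
      · nlinarith
    · push Not at hδ
      by_cases hxye : x = y
      · subst hxye; simp
      obtain ⟨c, ρ, hcx, hcy, hc⟩ := h.harnack (dist x y) (c1 * s) k (dist_pos.2 hxye) (by linarith) (by positivity) (by omega) x hx y hy rfl hδx hδy (by nlinarith)
      rw [← hN] at hcy hc
      set δ := fun i => infDist (c i) (frontier Ω) with hδd
      have hdist : ∀ i, 1 ≤ i → i < N → dist (c (i+1)) (c i) ≤ δ i / 10 := by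
        intro i hi hiN
        obtain ⟨-, h2, -, h4⟩ := hc i hi hiN.le
        have := h4 hiN
        rw [mem_ball] at this
        exact this.le.trans h2
      have hind : ∀ i, 1 ≤ i → i ≤ N → c1 * s * (9/10) ^ i ≤ δ i ∧ δ i ≤ 11 * s * (11/10) ^ i ∧ dist (c i) x ≤ i * (R * s) ∧ c i ∈ Ω := by
        intro i hi
        induction i, hi using Nat.le_induction with
        | base =>
          intro _
          simp only [hδd, hcx]
          refine ⟨?_, by linarith, by simp; positivity, hx⟩
          nlinarith [mul_pos hc1p hs]
        | succ i hi ih =>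
          intro hiN
          obtain ⟨i1, i2, i3, i4⟩ := ih (by omega)
          have hd := hdist i hi (by omega)
          have l1 : δ i ≤ δ (i+1) + dist (c (i+1)) (c i) := by
            rw [dist_comm]; exact infDist_le_infDist_add_dist
          have l2 : δ (i+1) ≤ δ i + dist (c (i+1)) (c i) := infDist_le_infDist_add_dist
          have hδpos : 0 ≤ δ i := infDist_nonneg
          obtain ⟨-, -, hball, hmem⟩ := hc i hi (by omega)
          refine ⟨?_, ?_, ?_, hball (hmem (by omega))⟩
          · rw [pow_succ]; nlinarith
          · rw [pow_succ]; nlinarith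
          · have : δ i ≤ R * s := by
              refine i2.trans ?_
              have : ((11:ℝ)/10)^i ≤ (11/10)^N := pow_le_pow_right₀ (by norm_num) (by omega)
              rw [hR]; nlinarith
            have := dist_triangle (c (i+1)) (c i) x
            push_cast
            nlinarith
      have := sq_chain (fun i => av v (c i) (θ * s)) N (ENNReal.ofReal ((ωn n)⁻¹ * R ^ 2 * (θ ^ n)⁻¹ * s ^ 2 * (s ^ n)⁻¹) * e) ?_ N hN1 le_rfl
      · simpa only [hcx, hcy] using this
      intro i hi hiN
      obtain ⟨i1, i2, i3, i4⟩ := hind i hi hiN.le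
      have hd := hdist i hi hiN
      have hδR : δ i ≤ R * s := by
        refine i2.trans ?_
        have : ((11:ℝ)/10)^i ≤ (11/10)^N := pow_le_pow_right₀ (by norm_num) (by omega)
        rw [hR]; nlinarith
      have hθs : θ * s ≤ δ i / 10 := by
        have : ((9:ℝ)/10)^N ≤ (9/10)^i := pow_le_pow_of_le_one (by norm_num) (by norm_num) (by omega)
        have : c1 * s * (9/10)^N ≤ c1 * s * (9/10)^i := by gcongr
        rw [hθ]; linarith
      have hδpos : 0 < δ i := by nlinarith [mul_pos hθp hs]
      apply step (c i) (c (i+1)) (ball (c i) (δ i / 2)) (convex_ball _ _)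
      · exact (ball_subset_ball (by linarith)).trans (ball_sub i4)
      · intro z hz
        rw [mem_ball] at hz ⊢
        have := dist_triangle z (c i) x
        have : (i:ℝ) ≤ N := by exact_mod_cast hiN.le
        have : (i:ℝ) * (R * s) ≤ N * (R * s) := by gcongr
        nlinarith
      · exact closedBall_subset_ball (by linarith)
      · intro z hz
        rw [mem_closedBall] at hz
        rw [mem_ball]
        have := dist_triangle z (c (i+1)) (c i)
        linarith
      · rw [dist_comm]; linarith
  refine fin.trans (le_of_eq ?_)
  rw [← mul_assoc]
  congr 1
  rw [show (4 : ℝ≥0∞) ^ N = ENNReal.ofReal (4 ^ N) by rw [ENNReal.ofReal_pow (by norm_num)]; norm_num, ← ENNReal.ofReal_mul (by positivity)]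
  congr 1
  ring

end RG

namespace RG

structure Geo {n : ℕ} (Ω : Set (Eu n)) (θ C Λ : ℝ) (ck : Eu n → ℝ → Eu n) : Prop where
  hn : 3 ≤ n
  op : IsOpen Ω
  bd : Bornology.IsBounded Ω
  ne : Ω.Nonempty
  Dp : 0 < diam Ω
  θp : 0 < θ
  θl : θ ≤ 1
  Cp : 0 < C
  Λp : 1 ≤ Λ
  F1 : ∀ Z ∈ closure Ω, ∀ s, 0 < s → s ≤ diam Ω / 200 → closedBall (ck Z s) (θ * s) ⊆ Ω ∩ ball Z (2 * s)
  F2 : ∀ v : Eu n → ℝ, ContDiffOn ℝ 1 v Ω → ∀ Z ∈ closure Ω, ∀ Z' ∈ closure Ω, ∀ s, 0 < s → s ≤ diam Ω / 200 →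
    dist Z Z' ≤ 8 * s → ENNReal.ofReal ((av v (ck Z s) (θ * s) - av v (ck Z' s) (θ * s)) ^ 2) ≤
      ENNReal.ofReal (C * (s ^ (n - 2))⁻¹) * ∫⁻ z in ball Z (Λ * s), gr2 Ω v z
  F3 : ∀ v : Eu n → ℝ, ContDiffOn ℝ 1 v Ω → ∀ Z ∈ closure Ω, ∀ s, 0 < s → s ≤ diam Ω / 200 →
    ENNReal.ofReal ((av v (ck Z s) (θ * s) - av v (ck Z (s / 2)) (θ * (s / 2))) ^ 2) ≤
      ENNReal.ofReal (C * (s ^ (n - 2))⁻¹) * ∫⁻ z in ball Z (Λ * s), gr2 Ω v z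
  F4 : ∀ X ∈ Ω, ∃ Q ∈ frontier Ω, ∀ v : Eu n → ℝ, ContDiffOn ℝ 1 v Ω → ∀ s, s = diam Ω / 200 →
    ENNReal.ofReal ((av v (ck X s) (θ * s) - av v (ck Q s) (θ * s)) ^ 2) ≤
      ENNReal.ofReal (C * (s ^ (n - 2))⁻¹) * ∫⁻ z, gr2 Ω v z

lemma sq_mul_inv {n : ℕ} (hn : 3 ≤ n) {s : ℝ} (hs : 0 < s) : s ^ 2 * (s ^ n)⁻¹ = (s ^ (n - 2))⁻¹ := by
  obtain ⟨m, rfl⟩ : ∃ m, n = m + 2 := ⟨n - 2, by omega⟩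
  rw [Nat.add_sub_cancel, pow_add]; field_simp

lemma two_ofReal {a b t : ℝ} {e : ℝ≥0∞} (ha : 0 ≤ a) (hb : 0 ≤ b) (ht : 0 ≤ t) :
    2 * (ENNReal.ofReal (a * t) * e + ENNReal.ofReal (b * t) * e) = ENNReal.ofReal (2 * (a + b) * t) * e := by
  rw [← add_mul, ← mul_assoc, ← ENNReal.ofReal_add (by positivity) (by positivity),
    show (2:ℝ≥0∞) = ENNReal.ofReal 2 by simp, ← ENNReal.ofReal_mul (by norm_num), ← add_mul, ← mul_assoc]

lemma diam_pos {n : ℕ} (hn : 3 ≤ n) {Ω : Set (Eu n)} (ho : IsOpen Ω) (hb : Bornology.IsBounded Ω)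
    (hne : Ω.Nonempty) : 0 < diam Ω := by
  obtain ⟨x, hx⟩ := hne
  obtain ⟨ε, hε, hsub⟩ := Metric.isOpen_iff.1 ho x hx
  have : NeZero n := ⟨by omega⟩
  have : Nontrivial (Eu n) := inferInstance
  have h1 := Metric.diam_mono hsub hb
  have : diam (ball x ε) = 2 * ε := by
    rw [diam_ball_eq x hε.le]
  linarith

set_option maxHeartbeats 1000000 in
lemma exists_geo {n : ℕ} (hn : 3 ≤ n) (M : ℝ) (hM : 1 < M) : ∃ θ C Λ : ℝ, ∀ Ω : Set (Eu n), IsOneSidedNTA M Ω →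
    Bornology.IsBounded Ω → Ω.Nonempty → ∃ ck, Geo Ω θ C Λ ck := by
  obtain ⟨θ, C, Λ, hθ, hθl, hC, hΛ, hch⟩ := chain (n := n) M hM
  have hω := ωn_pos n
  set c1 := (2 * M)⁻¹ with hc1
  have hc1p : 0 < c1 := by positivity
  have hc1l : c1 ≤ 1 := inv_le_one_of_one_le₀ (by linarith)
  set C1 := (ωn n)⁻¹ * 202 ^ 2 * (θ ^ n)⁻¹ with hC1
  set C2 := 2 ^ n * C with hC2
  set C3 := 2 ^ n * ((ωn n)⁻¹ * (θ ^ n)⁻¹) with hC3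
  have hC1p : 0 < C1 := by positivity
  have hC2p : 0 < C2 := by positivity
  have hC3p : 0 < C3 := by positivity
  have hCC2 : C ≤ C2 := by
    have : (1:ℝ) ≤ 2 ^ n := one_le_pow₀ (by norm_num)
    rw [hC2]; nlinarith
  clear_value C1 C2 C3 c1
  refine ⟨θ, 2 * (C1 + C2 + C3), Λ + 2, fun Ω h hb hne => ?_⟩
  have hD := diam_pos hn h.isOpen hb hne
  have hΩ := h.isOpen
  set D := diam Ω with hDd
  have key : ∀ Z s, ∃ x, (Z ∈ closure Ω ∧ 0 < s ∧ s ≤ D / 200) → x ∈ Ω ∧ dist x Z < s ∧ c1 * s ≤ infDist x (frontier Ω) := by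
    intro Z s
    by_cases hh : Z ∈ closure Ω ∧ 0 < s ∧ s ≤ D / 200
    · obtain ⟨x, hx⟩ := cork hn h hb hne hh.1 hh.2.1 (by linarith [hh.2.2])
      rw [← hc1] at hx
      exact ⟨x, fun _ => hx⟩
    · exact ⟨0, fun h' => absurd h' hh⟩
  choose ck hck using key
  have mainF2 : ∀ v : Eu n → ℝ, ContDiffOn ℝ 1 v Ω → ∀ Z ∈ closure Ω, ∀ Z' ∈ closure Ω, ∀ s, 0 < s → s ≤ D / 200 →
    dist Z Z' ≤ 8 * s → ENNReal.ofReal ((av v (ck Z s) (θ * s) - av v (ck Z' s) (θ * s)) ^ 2) ≤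
      ENNReal.ofReal (C * (s ^ (n - 2))⁻¹) * ∫⁻ z in ball Z ((Λ + 2) * s), gr2 Ω v z := by
    intro v hv Z hZ Z' hZ' s hs hsD hd
    obtain ⟨a1, a2, a3⟩ := hck Z s ⟨hZ, hs, hsD⟩
    obtain ⟨b1, b2, b3⟩ := hck Z' s ⟨hZ', hs, hsD⟩
    refine (hch Ω h v hv s hs (by linarith) _ a1 _ b1 a3 b3 ?_).trans ?_
    · have := dist_triangle4_right (ck Z s) (ck Z' s) Z Z'
      linarith
    · rw [mul_assoc, sq_mul_inv hn hs]
      refine mul_le_mul_right (lintegral_mono_set (ball_subset_ball' ?_)) _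
      linarith
  have wk : ∀ (K s : ℝ) (e : ℝ≥0∞), K ≤ 2 * (C1 + C2 + C3) → 0 < s → ENNReal.ofReal (K * (s ^ (n - 2))⁻¹) * e ≤
      ENNReal.ofReal (2 * (C1 + C2 + C3) * (s ^ (n - 2))⁻¹) * e := by
    intro K s e hK hs
    gcongr
  refine ⟨ck, hn, hΩ, hb, hne, hD, hθ, by linarith, by positivity, by linarith, ?_, ?_, ?_, ?_⟩
  · intro Z hZ s hs hsD z hz
    obtain ⟨a1, a2, a3⟩ := hck Z s ⟨hZ, hs, hsD⟩
    rw [mem_closedBall] at hz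
    refine ⟨ball_sub a1 (mem_ball.2 ?_), mem_ball.2 ?_⟩
    · nlinarith
    · have := dist_triangle z (ck Z s) Z
      nlinarith
  · intro v hv Z hZ Z' hZ' s hs hsD hd
    exact (mainF2 v hv Z hZ Z' hZ' s hs hsD hd).trans (wk _ _ _ (by linarith) hs)
  · intro v hv Z hZ s hs hsD
    obtain ⟨a1, a2, a3⟩ := hck Z s ⟨hZ, hs, hsD⟩
    obtain ⟨b1, b2, b3⟩ := hck Z (s/2) ⟨hZ, by linarith, by linarith⟩
    have e1 : (ENNReal.ofReal ((av v (ck Z s) (θ * (s/2)) - av v (ck Z (s/2)) (θ * (s/2))) ^ 2)) ≤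
        ENNReal.ofReal (C2 * (s ^ (n - 2))⁻¹) * ∫⁻ z in ball Z ((Λ + 2) * s), gr2 Ω v z := by
      refine (hch Ω h v hv (s/2) (by linarith) (by linarith) _ a1 _ b1 (by nlinarith) b3 ?_).trans ?_
      · have := dist_triangle_right (ck Z s) (ck Z (s/2)) Z
        linarith
      · refine mul_le_mul' (ENNReal.ofReal_le_ofReal ?_) (lintegral_mono_set (ball_subset_ball' ?_))
        · rw [← sq_mul_inv hn hs, hC2, div_pow, div_pow, inv_div]
          have : 0 < C * s ^ 2 * (2 ^ n / s ^ n) := by positivity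
          calc _ = (C * s ^ 2 * (2 ^ n / s ^ n)) / 4 := by ring
            _ ≤ C * s ^ 2 * (2 ^ n / s ^ n) := by linarith
            _ = _ := by ring
        · nlinarith
    have e2 : (ENNReal.ofReal ((av v (ck Z s) (θ * s) - av v (ck Z s) (θ * (s/2))) ^ 2)) ≤
        ENNReal.ofReal (C3 * (s ^ (n - 2))⁻¹) * ∫⁻ z in ball Z ((Λ + 2) * s), gr2 Ω v z := by
      refine (poinc hΩ hv (ck Z s) (ck Z s) (m := θ * (s/2)) (L := s) (by positivity) (by nlinarith) le_rfl (ball (ck Z s) (c1 * s)) (convex_ball _ _) ((ball_subset_ball a3).trans (ball_sub a1)) (closedBall_subset_ball (by nlinarith)) (closedBall_subset_ball (by nlinarith)) ?_).trans ?_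
      · rw [dist_self, zero_add, abs_of_nonneg (by nlinarith)]
        nlinarith
      · refine mul_le_mul' (ENNReal.ofReal_le_ofReal (le_of_eq ?_)) (lintegral_mono_set (ball_subset_ball' ?_))
        · rw [← sq_mul_inv hn hs, hC3, mul_pow, div_pow]
          field_simp
        · nlinarith
    refine (ofReal_sq_add (b := av v (ck Z s) (θ * (s/2)))).trans ?_
    refine (mul_le_mul_right (add_le_add e2 e1) _).trans ?_
    rw [two_ofReal (by positivity) (by positivity) (by positivity)]
    exact wk _ _ _ (by linarith) hs
  · intro X hX
    obtain ⟨Q, hQ, hQd⟩ := (isClosed_frontier (s := Ω)).exists_infDist_eq_dist (front_ne hn hb hne) X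
    have hQc : Q ∈ closure Ω := frontier_subset_closure hQ
    have hXc : X ∈ closure Ω := subset_closure hX
    refine ⟨Q, hQ, fun v hv s hs => ?_⟩
    have hsp : 0 < s := by rw [hs]; positivity
    by_cases hδ : infDist X (frontier Ω) ≤ 8 * s
    · refine (mainF2 v hv X hXc Q hQc s hsp hs.le (hQd ▸ hδ)).trans ?_
      exact (wk _ _ _ (by linarith) hsp).trans (mul_le_mul_right (setLIntegral_le_lintegral _ _) _)
    · push Not at hδ
      rw [hQd] at hδ
      have hdD : dist X Q ≤ D := by
        rw [hDd, ← Metric.diam_closure]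
        exact dist_le_diam_of_mem hb.closure hXc hQc
      set t := 8 * s / dist X Q with ht
      have hd0 : 0 < dist X Q := by linarith
      have ht0 : 0 < t := by positivity
      have ht1 : t < 1 := by rw [ht, div_lt_one hd0]; exact hδ
      have htd : t * dist X Q = 8 * s := by rw [ht]; field_simp
      set X' := AffineMap.lineMap Q X t with hX'
      have d1 : dist X' X = dist X Q - 8 * s := by
        rw [hX', dist_lineMap_right, Real.norm_of_nonneg (by linarith), dist_comm Q X]; linarith
      have d2 : dist X' Q = 8 * s := by
        rw [hX', dist_lineMap_left, Real.norm_of_nonneg ht0.le, dist_comm Q X, htd]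
      have hX'Ω : X' ∈ Ω := ball_sub hX (by rw [mem_ball, hQd, d1]; linarith)
      obtain ⟨a1, a2, a3⟩ := hck X s ⟨hXc, hsp, hs.le⟩
      obtain ⟨b1, b2, b3⟩ := hck X' s ⟨subset_closure hX'Ω, hsp, hs.le⟩
      have hθs : θ * s ≤ s := by nlinarith
      have e1 : (ENNReal.ofReal ((av v (ck X s) (θ * s) - av v (ck X' s) (θ * s)) ^ 2)) ≤
          ENNReal.ofReal (C1 * (s ^ (n - 2))⁻¹) * ∫⁻ z, gr2 Ω v z := by
        refine (poinc hΩ hv (ck X s) (ck X' s) (m := θ * s) (L := 202 * s) (by positivity) le_rfl le_rfl (ball X (infDist X (frontier Ω))) (convex_ball _ _) (ball_sub hX) ?_ ?_ ?_).trans ?_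
        · intro z hz
          rw [mem_closedBall] at hz
          rw [mem_ball, hQd]
          have := dist_triangle z (ck X s) X
          linarith
        · intro z hz
          rw [mem_closedBall] at hz
          rw [mem_ball, hQd]
          have := dist_triangle4 z (ck X' s) X' X
          linarith
        · have := dist_triangle4_right (ck X s) (ck X' s) X X'
          rw [dist_comm X X'] at this
          rw [sub_self, abs_zero, add_zero]
          linarith
        · refine mul_le_mul' (ENNReal.ofReal_le_ofReal (le_of_eq ?_)) (setLIntegral_le_lintegral _ _)
          rw [← sq_mul_inv hn hsp, hC1, mul_pow, mul_pow, mul_inv]; ring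
      have e2 := (mainF2 v hv X' (subset_closure hX'Ω) Q hQc s hsp hs.le d2.le).trans (mul_le_mul_right (setLIntegral_le_lintegral _ _) _)
      refine (ofReal_sq_add (b := av v (ck X' s) (θ * s))).trans ?_
      refine (mul_le_mul_right (add_le_add e1 e2) _).trans ?_
      rw [two_ofReal (by positivity) (by positivity) (by positivity)]
      exact wk _ _ _ (by linarith) hsp

end RG

namespace RG

noncomputable def An {n : ℕ} (θ : ℝ) (ck : Eu n → ℝ → Eu n) (v : Eu n → ℝ) (Z : Eu n) (s : ℝ) : ℝ :=
  av v (ck Z s) (θ * s)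

lemma av_int {n : ℕ} {v : Eu n → ℝ} {x : Eu n} {ρ : ℝ} (hρ : 0 < ρ)
    (hv : ContinuousOn v (closedBall x ρ)) : IntegrableOn (fun z => v (x + ρ • z)) (ball (0 : Eu n) 1) := by
  have hc : ContinuousOn (fun z => v (x + ρ • z)) (closedBall (0 : Eu n) 1) := by
    apply hv.comp (by fun_prop)
    intro z hz
    rw [mem_closedBall, dist_zero_right] at hz
    rw [mem_closedBall, dist_eq_norm, add_sub_cancel_left, norm_smul, Real.norm_of_nonneg hρ.le]
    nlinarith
  exact (hc.integrableOn_compact (isCompact_closedBall _ _)).mono_set ball_subset_closedBall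

lemma map_ball {n : ℕ} {x z : Eu n} {ρ : ℝ} (hρ : 0 < ρ) (hz : z ∈ ball (0 : Eu n) 1) :
    x + ρ • z ∈ closedBall x ρ := by
  rw [mem_ball, dist_zero_right] at hz
  rw [mem_closedBall, dist_eq_norm, add_sub_cancel_left, norm_smul, Real.norm_of_nonneg hρ.le]
  nlinarith

lemma av_close {n : ℕ} {v : Eu n → ℝ} {x : Eu n} {ρ c ε : ℝ} (hρ : 0 < ρ)
    (hv : ContinuousOn v (closedBall x ρ)) (h : ∀ w ∈ closedBall x ρ, |v w - c| ≤ ε) :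
    |av v x ρ - c| ≤ ε := by
  have hω := ωn_pos n
  have h1 : av v x ρ - c = (ωn n)⁻¹ * ∫ z in ball (0 : Eu n) 1, (v (x + ρ • z) - c) := by
    rw [integral_sub (av_int hρ hv) (integrableOn_const measure_ball_lt_top.ne), setIntegral_const, mul_sub]
    simp only [av, ωn, Measure.real, smul_eq_mul]
    congr 1
    rw [← mul_assoc, inv_mul_cancel₀, one_mul]
    exact hω.ne'
  have h2 : ‖∫ z in ball (0 : Eu n) 1, (v (x + ρ • z) - c)‖ ≤ ε * (volume : Measure (Eu n)).real (ball (0 : Eu n) 1) := by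
    apply norm_setIntegral_le_of_norm_le_const measure_ball_lt_top
    intro z hz
    exact h _ (map_ball hρ hz)
  rw [h1, abs_mul, abs_of_pos (by positivity), inv_mul_le_iff₀ hω, mul_comm]
  exact h2

lemma Geo.An_close {n : ℕ} {Ω : Set (Eu n)} {θ C Λ : ℝ} {ck : Eu n → ℝ → Eu n} (G : Geo Ω θ C Λ ck)
    {v : Eu n → ℝ} (hv : ContinuousOn v Ω) {Z : Eu n} (hZ : Z ∈ closure Ω) {s c ε : ℝ} (hs : 0 < s)
    (hsD : s ≤ diam Ω / 200) (h : ∀ w ∈ Ω ∩ ball Z (2 * s), |v w - c| ≤ ε) : |An θ ck v Z s - c| ≤ ε :=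
  av_close (mul_pos G.θp hs) (hv.mono ((G.F1 Z hZ s hs hsD).trans inter_subset_left))
    (fun w hw => h w (G.F1 Z hZ s hs hsD hw))

lemma Geo.An_lim {n : ℕ} {Ω : Set (Eu n)} {θ C Λ : ℝ} {ck : Eu n → ℝ → Eu n} (G : Geo Ω θ C Λ ck)
    {v : Eu n → ℝ} (hv : ContinuousOn v (closure Ω)) {Z : Eu n} (hZ : Z ∈ closure Ω) {s : ℝ} (hs : 0 < s)
    (hsD : s ≤ diam Ω / 200) : Filter.Tendsto (fun k : ℕ => An θ ck v Z (s * (1/2) ^ k)) Filter.atTop (𝓝 (v Z)) := by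
  rw [Metric.tendsto_atTop]
  intro ε hε
  obtain ⟨δ, hδ, hd⟩ := Metric.continuousOn_iff.1 hv Z hZ (ε / 2) (by linarith)
  have h0 : Filter.Tendsto (fun k : ℕ => 2 * (s * (1/2:ℝ) ^ k)) Filter.atTop (𝓝 (2 * (s * 0))) :=
    ((tendsto_pow_atTop_nhds_zero_of_lt_one (by norm_num) (by norm_num)).const_mul s).const_mul 2
  simp only [mul_zero] at h0
  obtain ⟨N, hN⟩ := Filter.eventually_atTop.1 (h0.eventually_lt_const hδ)
  refine ⟨N, fun k hk => ?_⟩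
  have hp : (1/2:ℝ) ^ k ≤ 1 := pow_le_one₀ (by norm_num) (by norm_num)
  have := G.An_close (hv.mono subset_closure) hZ (s := s * (1/2) ^ k) (c := v Z) (ε := ε / 2) (by positivity) (by nlinarith) ?_
  · rw [Real.dist_eq]; linarith
  · intro w hw
    have := hd w (subset_closure hw.1) (lt_trans (mem_ball.1 hw.2) (hN k hk))
    rw [Real.dist_eq] at this
    exact this.le

lemma tele {a : ℕ → ℝ} {l B r : ℝ} (hr1 : r < 1) (ha : Filter.Tendsto a Filter.atTop (𝓝 l))
    (h : ∀ k, |a k - a (k + 1)| ≤ B * r ^ k) : |l - a 0| ≤ B / (1 - r) := by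
  have := dist_le_of_le_geometric_of_tendsto₀ r B hr1 (fun k => by rw [Real.dist_eq]; exact h k) ha
  rwa [Real.dist_eq, abs_sub_comm] at this

lemma Geo.pw {n : ℕ} {Ω : Set (Eu n)} {θ C Λ : ℝ} {ck : Eu n → ℝ → Eu n} (G : Geo Ω θ C Λ ck)
    {v : Eu n → ℝ} (hv1 : ContDiffOn ℝ 1 v Ω) (hv : ContinuousOn v (closure Ω)) {Z : Eu n} (hZ : Z ∈ closure Ω)
    {s : ℝ} (hs : 0 < s) (hsD : s ≤ diam Ω / 200) {r : ℝ} (hr0 : 0 < r) (hr1 : r < 1) (B : ℝ≥0∞)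
    (hB : ∀ k : ℕ, ENNReal.ofReal (C * ((s * (1/2) ^ k) ^ (n - 2))⁻¹) *
      ∫⁻ z in ball Z (Λ * (s * (1/2) ^ k)), gr2 Ω v z ≤ B * ENNReal.ofReal (r ^ k) ^ 2) :
    ENNReal.ofReal ((v Z - An θ ck v Z s) ^ 2) ≤ ENNReal.ofReal ((1 - r)⁻¹ ^ 2) * B := by
  by_cases hBt : B = ⊤
  · have : 0 < (1 - r)⁻¹ ^ 2 := by have : 0 < 1 - r := by linarith
                                   positivity
    rw [hBt, ENNReal.mul_top (ENNReal.ofReal_pos.2 this).ne']; exact le_top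
  have h1 := tele (a := fun k : ℕ => An θ ck v Z (s * (1/2) ^ k)) (B := √ B.toReal) hr1 (G.An_lim hv hZ hs hsD) ?_
  · simp only [pow_zero, mul_one] at h1
    rw [← ENNReal.ofReal_toReal hBt, ← ENNReal.ofReal_mul (by positivity)]
    apply ENNReal.ofReal_le_ofReal
    rw [← sq_abs]
    refine (pow_le_pow_left₀ (abs_nonneg _) h1 2).trans (le_of_eq ?_)
    rw [div_eq_mul_inv, mul_pow, Real.sq_sqrt ENNReal.toReal_nonneg, mul_comm]
  · intro k
    have hp : (1/2:ℝ) ^ k ≤ 1 := pow_le_one₀ (by norm_num) (by norm_num)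
    have h2 := (G.F3 v hv1 Z hZ (s * (1/2) ^ k) (by positivity) (by nlinarith)).trans (hB k)
    rw [← ENNReal.ofReal_toReal hBt, ← ENNReal.ofReal_pow (by positivity), ← ENNReal.ofReal_mul (by positivity), ENNReal.ofReal_le_ofReal_iff (by positivity)] at h2
    rw [show s * (1/2:ℝ) ^ k / 2 = s * (1/2) ^ (k + 1) by rw [pow_succ]; ring] at h2
    refine abs_le_of_sq_le_sq ?_ (by positivity)
    rw [mul_pow, Real.sq_sqrt ENNReal.toReal_nonneg]
    exact h2

lemma e_meas {n : ℕ} {g : Eu n → ℝ≥0∞} (hg : Measurable g) (R : ℝ) :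
    Measurable (fun z => ∫⁻ w in ball z R, g w) := by
  have : (fun z => ∫⁻ w in ball z R, g w) = fun z => ∫⁻ w, ({p : Eu n × Eu n | dist p.2 p.1 < R}.indicator (fun p => g p.2)) (z, w) := by
    ext z
    rw [← lintegral_indicator measurableSet_ball]
    rfl
  rw [this]
  apply Measurable.lintegral_prod_right'
  apply (hg.comp measurable_snd).indicator
  exact measurableSet_lt (by fun_prop) measurable_const

lemma lint_e {n : ℕ} {g : Eu n → ℝ≥0∞} (hg : Measurable g) (R : ℝ) (μ : Measure (Eu n)) [SFinite μ] :
    ∫⁻ z, (∫⁻ w in ball z R, g w) ∂μ = ∫⁻ w, g w * μ (ball w R) := by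
  have : ∀ z, (∫⁻ w in ball z R, g w) = ∫⁻ w, ({p : Eu n × Eu n | dist p.2 p.1 < R}.indicator (fun p => g p.2)) (z, w) := by
    intro z
    rw [← lintegral_indicator measurableSet_ball]
    rfl
  simp_rw [this]
  rw [lintegral_lintegral_swap]
  · congr 1; ext w
    rw [← setLIntegral_const, ← lintegral_indicator measurableSet_ball]
    congr 1; ext z
    simp only [indicator, mem_ofPred_eq, mem_ball, dist_comm]
  · apply Measurable.aemeasurable
    apply (hg.comp measurable_snd).indicator
    exact measurableSet_lt (by fun_prop) measurable_const

lemma Geo.An_L2 {n : ℕ} {Ω : Set (Eu n)} {θ C Λ : ℝ} {ck : Eu n → ℝ → Eu n} (G : Geo Ω θ C Λ ck)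
    {v : Eu n → ℝ} (hv : ContinuousOn v Ω) {Z : Eu n} (hZ : Z ∈ closure Ω) {s : ℝ} (hs : 0 < s)
    (hsD : s ≤ diam Ω / 200) : ENNReal.ofReal ((An θ ck v Z s) ^ 2) ≤
      ENNReal.ofReal ((ωn n)⁻¹ * (θ ^ n)⁻¹ * (s ^ n)⁻¹) * ∫⁻ z in Ω, ENNReal.ofReal (v z ^ 2) := by
  have hω := ωn_pos n
  have hθ := G.θp
  have hρ := mul_pos hθ hs
  set x := ck Z s
  set g : Eu n → ℝ≥0∞ := Ω.indicator (fun z => ENNReal.ofReal (v z ^ 2)) with hg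
  have hgm : Measurable g := by
    have : ContinuousOn (fun z => ENNReal.ofReal (v z ^ 2)) Ω :=
      ENNReal.continuous_ofReal.comp_continuousOn (hv.pow 2)
    classical
    rw [hg, ← Set.piecewise_eq_indicator]
    exact this.measurable_piecewise continuousOn_const G.op.measurableSet
  have hsub := (G.F1 Z hZ s hs hsD).trans inter_subset_left
  have h1 : ENNReal.ofReal ((An θ ck v Z s) ^ 2) = ENNReal.ofReal ((ωn n)⁻¹ ^ 2) * ‖∫ z in ball (0 : Eu n) 1, v (x + (θ * s) • z)‖ₑ ^ 2 := by
    rw [Real.enorm_eq_ofReal_abs, ← ENNReal.ofReal_pow (abs_nonneg _), ← ENNReal.ofReal_mul (by positivity), sq_abs, ← mul_pow]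
    rfl
  have h2 : ‖∫ z in ball (0 : Eu n) 1, v (x + (θ * s) • z)‖ₑ ^ 2 ≤ ENNReal.ofReal (ωn n) * ∫⁻ z in ball (0 : Eu n) 1, g (x + (θ * s) • z) := by
    refine (pow_le_pow_left' (enorm_integral_le_lintegral_enorm _) 2).trans ?_
    refine (lint_sq _ _ (av_int hρ (hv.mono hsub)).aestronglyMeasurable.enorm).trans ?_
    rw [Measure.restrict_apply_univ, ωn, ENNReal.ofReal_toReal measure_ball_lt_top.ne]
    refine mul_le_mul_right (le_of_eq (setLIntegral_congr_fun measurableSet_ball fun z hz => ?_)) _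
    simp only [hg]
    rw [indicator_of_mem (hsub (map_ball hρ hz)), Real.enorm_eq_ofReal_abs, ← ENNReal.ofReal_pow (abs_nonneg _), sq_abs]
  rw [h1]
  refine (mul_le_mul_right h2 _).trans ?_
  rw [lint_scale g hgm x hρ, ← mul_assoc, ← mul_assoc, ← ENNReal.ofReal_mul (by positivity), ← ENNReal.ofReal_mul (by positivity)]
  refine mul_le_mul' (ENNReal.ofReal_le_ofReal (le_of_eq ?_)) ?_
  · rw [mul_pow θ]; field_simp
  · refine (setLIntegral_le_lintegral _ _).trans ?_
    rw [hg, lintegral_indicator G.op.measurableSet]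

end RG

namespace RG

noncomputable def kap (n : ℕ) : ℝ := ((n:ℝ) - 1) / (n - 2)

lemma kap_gt {n : ℕ} (hn : 3 ≤ n) : 1 < kap n := by
  have : (3:ℝ) ≤ n := by exact_mod_cast hn
  rw [kap, one_lt_div (by linarith)]; linarith

lemma geom_sum_ofReal {x : ℝ} (h0 : 0 ≤ x) (h1 : x < 1) : ∑' k : ℕ, ENNReal.ofReal (x ^ k) = ENNReal.ofReal ((1 - x)⁻¹) := by
  rw [← ENNReal.ofReal_tsum_of_nonneg (fun k => by positivity) (summable_geometric_of_lt_one h0 h1), tsum_geometric_of_lt_one h0 h1]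

lemma pow_kap {n : ℕ} (hn : 3 ≤ n) {s : ℝ} (hs : 0 < s) : ((s ^ (n - 2))⁻¹) ^ kap n * s ^ n = s := by
  have h3 : (3:ℝ) ≤ n := by exact_mod_cast hn
  rw [Real.inv_rpow (by positivity), ← Real.rpow_natCast s (n-2), ← Real.rpow_mul hs.le, ← Real.rpow_natCast s n, ← Real.rpow_neg hs.le, ← Real.rpow_add hs]
  rw [Nat.cast_sub (by omega), kap]
  have : -(((n:ℝ) - (2:ℕ)) * (((n:ℝ) - 1) / (n - 2))) + n = 1 := by
    have : (n:ℝ) - 2 ≠ 0 := by linarith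
    push_cast
    field_simp
    ring
  rw [this, Real.rpow_one]

lemma sobolev (n : ℕ) (hn : 3 ≤ n) (C Λ : ℝ) (hC : 0 < C) (hΛ : 1 ≤ Λ) : ∃ K : ℝ, 0 < K ∧ ∀ (Ω : Set (Eu n)) (θ : ℝ) (ck : Eu n → ℝ → Eu n), Geo Ω θ C Λ ck →
    ∀ v : Eu n → ℝ, ContDiffOn ℝ 1 v Ω → ContinuousOn v (closure Ω) → ∀ s, 0 < s → s ≤ diam Ω / 200 →
    ∫⁻ z in Ω, ENNReal.ofReal ((v z - An θ ck v z s) ^ 2) ^ (kap n) ≤ ENNReal.ofReal (K * s) * (∫⁻ z, gr2 Ω v z) ^ (kap n) := by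
  have hκ := kap_gt hn
  set κ := kap n with hκd
  have hω := ωn_pos n
  set β := √ (2:ℝ) with hβ
  have hβp : 0 < β := by positivity
  have hβ1 : 1 < β := by rw [hβ, Real.lt_sqrt (by norm_num)]; norm_num
  have hβ2 : β / 2 < 1 := by
    have : β * β = 2 := Real.mul_self_sqrt (by norm_num)
    nlinarith
  set r := (β⁻¹) ^ (1 / (2 * κ)) with hr
  have hr0 : 0 < r := by positivity
  have hr1 : r < 1 := Real.rpow_lt_one (by positivity) (inv_lt_one_of_one_lt₀ hβ1) (by positivity)
  have hrk : ∀ k : ℕ, ((r ^ k) ^ 2) ^ κ = (β ^ k)⁻¹ := by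
    intro k
    rw [← pow_mul, ← Real.rpow_natCast, ← Real.rpow_mul hr0.le, hr, ← Real.rpow_mul (by positivity),
      ← inv_pow, ← Real.rpow_natCast (β⁻¹) k]
    congr 1
    push_cast
    field_simp
  set K0 := (1 - r)⁻¹ ^ 2 with hK0
  have hK0p : 0 < K0 := by
    have : 0 < 1 - r := by linarith
    positivity
  have h2β : 0 < (1 - β/2)⁻¹ := by
    have : 0 < 1 - β/2 := by linarith
    positivity
  refine ⟨K0 ^ κ * (C ^ κ * (ωn n * Λ ^ n)) * (1 - β/2)⁻¹, by positivity, ?_⟩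
  intro Ω θ ck G v hv1 hv s hs hsD
  set E := ∫⁻ z, gr2 Ω v z with hE
  set b : ℕ → Eu n → ℝ≥0∞ := fun k Z => ENNReal.ofReal (C * ((s * (1/2) ^ k) ^ (n - 2))⁻¹) *
      ∫⁻ z in ball Z (Λ * (s * (1/2) ^ k)), gr2 Ω v z with hb
  have hbm : ∀ k, Measurable (b k) := fun k => (e_meas (gr2_meas G.op v) _).const_mul _
  set T : Eu n → ℝ≥0∞ := fun Z => ∑' k, ENNReal.ofReal (β ^ k) * b k Z ^ κ with hT
  have hpt : ∀ Z ∈ Ω, ENNReal.ofReal ((v Z - An θ ck v Z s) ^ 2) ^ κ ≤ ENNReal.ofReal (K0 ^ κ) * T Z := by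
    intro Z hZ
    have := G.pw hv1 hv (subset_closure hZ) hs hsD hr0 hr1 (T Z ^ (1/κ)) ?_
    · refine (ENNReal.rpow_le_rpow this (by linarith)).trans (le_of_eq ?_)
      rw [ENNReal.mul_rpow_of_nonneg _ _ (by linarith), ← ENNReal.rpow_mul, one_div_mul_cancel (by linarith), ENNReal.rpow_one,
        ENNReal.ofReal_rpow_of_pos hK0p]
    · intro k
      change b k Z ≤ _
      rw [← ENNReal.rpow_le_rpow_iff (z := κ) (by linarith), ENNReal.mul_rpow_of_nonneg (T Z ^ (1/κ)) _ (by linarith), ← ENNReal.rpow_mul, one_div_mul_cancel (by linarith), ENNReal.rpow_one,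
        ← ENNReal.ofReal_pow (by positivity), ENNReal.ofReal_rpow_of_pos (by positivity), hrk]
      have h1 : ENNReal.ofReal (β ^ k) * b k Z ^ κ ≤ T Z := ENNReal.le_tsum k
      calc b k Z ^ κ = (ENNReal.ofReal (β ^ k) * b k Z ^ κ) * ENNReal.ofReal (β ^ k)⁻¹ := by
            rw [mul_comm, ← mul_assoc, ← ENNReal.ofReal_mul (by positivity), inv_mul_cancel₀ (by positivity)]; simp
        _ ≤ _ := by gcongr
  have hk : ∀ k, ∫⁻ Z in Ω, ENNReal.ofReal (β ^ k) * b k Z ^ κ ≤ ENNReal.ofReal (C ^ κ * (ωn n * Λ ^ n) * s) * E ^ κ * ENNReal.ofReal ((β/2) ^ k) := by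
    intro k
    set sk := s * (1/2) ^ k with hsk
    have hskp : 0 < sk := by positivity
    rw [lintegral_const_mul _ ((hbm k).pow_const κ)]
    have h1 : ∀ Z, b k Z ^ κ ≤ ENNReal.ofReal ((C * (sk ^ (n - 2))⁻¹) ^ κ) * (E ^ (κ - 1) * ∫⁻ z in ball Z (Λ * sk), gr2 Ω v z) := by
      intro Z
      simp only [hb]
      rw [ENNReal.mul_rpow_of_nonneg _ _ (by linarith), ENNReal.ofReal_rpow_of_pos (by positivity)]
      gcongr
      calc _ = (∫⁻ z in ball Z (Λ * sk), gr2 Ω v z) ^ (κ - 1 + 1) := by congr 1; ring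
        _ = (∫⁻ z in ball Z (Λ * sk), gr2 Ω v z) ^ (κ - 1) * (∫⁻ z in ball Z (Λ * sk), gr2 Ω v z) := by
          rw [ENNReal.rpow_add_of_nonneg _ _ (by linarith) (by norm_num), ENNReal.rpow_one]
        _ ≤ _ := by
          refine mul_le_mul_left (ENNReal.rpow_le_rpow (setLIntegral_le_lintegral _ _) (by linarith)) _
    have h2 : ∫⁻ Z in Ω, b k Z ^ κ ≤ ENNReal.ofReal ((C * (sk ^ (n - 2))⁻¹) ^ κ) * (E ^ (κ - 1) * (E * ENNReal.ofReal (ωn n * (Λ * sk) ^ n))) := by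
      refine (lintegral_mono h1).trans ?_
      rw [lintegral_const_mul _ ((e_meas (gr2_meas G.op v) _).const_mul _), lintegral_const_mul _ (e_meas (gr2_meas G.op v) _)]
      gcongr
      refine (setLIntegral_le_lintegral _ _).trans ?_
      rw [lint_e (gr2_meas G.op v)]
      simp_rw [vol_ball _ (by positivity : 0 < Λ * sk)]
      rw [lintegral_mul_const _ (gr2_meas G.op v)]
    refine (mul_le_mul_right h2 _).trans (le_of_eq ?_)
    have hEκ : E ^ κ = E ^ (κ - 1) * E := by
      rw [← ENNReal.rpow_one E, ← ENNReal.rpow_mul, ← ENNReal.rpow_mul, ← ENNReal.rpow_add_of_nonneg _ _ (by linarith) (by norm_num)]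
      congr 1; ring
    rw [hEκ]
    calc _ = (ENNReal.ofReal (β ^ k) * (ENNReal.ofReal ((C * (sk ^ (n - 2))⁻¹) ^ κ) * ENNReal.ofReal (ωn n * (Λ * sk) ^ n))) * (E ^ (κ - 1) * E) := by ring
      _ = (ENNReal.ofReal (C ^ κ * (ωn n * Λ ^ n) * s) * ENNReal.ofReal ((β/2) ^ k)) * (E ^ (κ - 1) * E) := by
        congr 1
        rw [← ENNReal.ofReal_mul (by positivity), ← ENNReal.ofReal_mul (by positivity), ← ENNReal.ofReal_mul (by positivity)]
        congr 1
        rw [Real.mul_rpow hC.le (by positivity), mul_pow Λ]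
        have := pow_kap hn hskp
        calc _ = β ^ k * (C ^ κ * ((((sk ^ (n - 2))⁻¹) ^ κ) * sk ^ n) * (ωn n * Λ ^ n)) := by ring
          _ = _ := by rw [this, hsk, div_pow, div_pow, one_pow]; ring
      _ = _ := by ring
  calc _ ≤ ∫⁻ Z in Ω, ENNReal.ofReal (K0 ^ κ) * T Z := setLIntegral_mono' G.op.measurableSet hpt
    _ = ENNReal.ofReal (K0 ^ κ) * ∑' k, ∫⁻ Z in Ω, ENNReal.ofReal (β ^ k) * b k Z ^ κ := by
      rw [lintegral_const_mul' _ _ ENNReal.ofReal_ne_top, lintegral_tsum]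
      exact fun k => (((hbm k).pow_const κ).const_mul _).aemeasurable
    _ ≤ ENNReal.ofReal (K0 ^ κ) * ∑' k, ENNReal.ofReal (C ^ κ * (ωn n * Λ ^ n) * s) * E ^ κ * ENNReal.ofReal ((β/2) ^ k) := by
      gcongr with k; exact hk k
    _ = _ := by
      rw [ENNReal.tsum_mul_left, geom_sum_ofReal (by positivity) hβ2]
      calc _ = (ENNReal.ofReal (K0 ^ κ) * (ENNReal.ofReal (C ^ κ * (ωn n * Λ ^ n) * s) * ENNReal.ofReal ((1 - β/2)⁻¹))) * E ^ κ := by ring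
        _ = _ := by
          rw [← ENNReal.ofReal_mul (by positivity), ← ENNReal.ofReal_mul (by positivity)]
          congr 2; ring

end RG

namespace RG

lemma sig_fin {n : ℕ} {M Cσ d cd : ℝ} {Ω : Set (Eu n)} {σ : Measure (Eu n)} (P : IsMixedPair M Cσ d cd Ω σ) :
    IsFiniteMeasure σ := by
  refine ⟨?_⟩
  have : σ univ ≤ σ (frontier Ω) + σ (frontier Ω)ᶜ := by
    rw [← union_compl_self (frontier Ω)]; exact measure_union_le _ _
  rw [P.null_outside, add_zero] at this
  exact lt_of_le_of_lt this P.finite.lt_top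

lemma sig_le {n : ℕ} {M Cσ d cd : ℝ} {Ω : Set (Eu n)} {σ : Measure (Eu n)} (P : IsMixedPair M Cσ d cd Ω σ)
    (s : Set (Eu n)) : σ s ≤ σ (s ∩ frontier Ω) := by
  have : σ s ≤ σ (s ∩ frontier Ω) + σ (frontier Ω)ᶜ := by
    refine le_trans (measure_mono ?_) (measure_union_le _ _)
    intro x hx
    by_cases h : x ∈ frontier Ω
    · exact Or.inl ⟨hx, h⟩
    · exact Or.inr h
  rwa [P.null_outside, add_zero] at this

lemma sig_le' {n : ℕ} {M Cσ d cd : ℝ} {Ω : Set (Eu n)} {σ : Measure (Eu n)} (P : IsMixedPair M Cσ d cd Ω σ)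
    (s : Set (Eu n)) : σ s ≤ σ (frontier Ω) := (sig_le P s).trans (measure_mono inter_subset_right)

lemma sig_ball {n : ℕ} (hn : 3 ≤ n) {M Cσ d cd Λ : ℝ} {Ω : Set (Eu n)} {σ : Measure (Eu n)} (P : IsMixedPair M Cσ d cd Ω σ)
    (hD : 0 < diam Ω) (hΛ : 1 ≤ Λ) (w : Eu n) (k : ℕ) :
    σ (ball w (Λ * (diam Ω / 200 * (1/2) ^ k))) ≤ ENNReal.ofReal ((1 + cd⁻¹) * (Λ / 50) ^ d * ((1/2) ^ d) ^ k) * σ (frontier Ω) := by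
  have := sig_fin P
  have hcd := P.cd_pos
  have h3 : (3:ℝ) ≤ n := by exact_mod_cast hn
  have hd : 0 < d := by linarith [P.d_gt]
  set R := Λ * (diam Ω / 200 * (1/2) ^ k) with hR
  have hRp : 0 < R := by positivity
  have hrat : (Λ / 50) ^ d * ((1/2) ^ d) ^ k = (2 * R / (diam Ω / 2)) ^ d := by
    rw [← Real.rpow_natCast, ← Real.rpow_mul (by positivity), mul_comm d, Real.rpow_mul (by positivity), Real.rpow_natCast, ← Real.mul_rpow (by positivity) (by positivity)]
    congr 1
    rw [hR]; field_simp; ring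
  rw [mul_assoc, hrat]
  by_cases hne : (ball w R ∩ frontier Ω).Nonempty
  · obtain ⟨Q, hQ, hQf⟩ := hne
    rw [mem_ball] at hQ
    have hsub : ball w R ⊆ ball Q (2 * R) := ball_subset_ball' (by rw [dist_comm]; linarith)
    by_cases hlt : 2 * R < diam Ω / 2
    · refine (measure_mono hsub).trans ?_
      rw [← ENNReal.ofReal_toReal (measure_ne_top σ (frontier Ω)), ← ENNReal.ofReal_mul (by positivity), ← ENNReal.ofReal_toReal (measure_ne_top σ (ball Q (2 * R)))]
      apply ENNReal.ofReal_le_ofReal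
      have h1 := P.lower_dim Q hQf (diam Ω / 2) (2 * R) (by positivity) hlt (by linarith)
      have h2 : (σ (ball Q (diam Ω / 2))).toReal ≤ (σ (frontier Ω)).toReal := ENNReal.toReal_mono (measure_ne_top _ _) (sig_le' P _)
      have h3 : (2 * R / (diam Ω / 2)) ^ d = ((diam Ω / 2 / (2 * R)) ^ d)⁻¹ := by
        rw [← Real.inv_rpow (by positivity), inv_div]
      have hx : 0 < (diam Ω / 2 / (2 * R)) ^ d := by positivity
      rw [h3]
      set x := (diam Ω / 2 / (2 * R)) ^ d
      set y := (σ (ball Q (2 * R))).toReal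
      set S := (σ (frontier Ω)).toReal
      have hS : 0 ≤ S := ENNReal.toReal_nonneg
      have : y ≤ cd⁻¹ * x⁻¹ * S := by
        rw [← mul_inv, ← div_eq_inv_mul, le_div_iff₀ (by positivity)]
        nlinarith
      have : 0 ≤ x⁻¹ * S := by positivity
      nlinarith
    · push Not at hlt
      have h1 : (1:ℝ) ≤ (2 * R / (diam Ω / 2)) ^ d := Real.one_le_rpow (by rwa [le_div_iff₀ (by positivity), one_mul]) hd.le
      refine (sig_le' P _).trans (le_mul_of_one_le_left' ?_)
      rw [ENNReal.one_le_ofReal]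
      have : 0 < cd⁻¹ := by positivity
      nlinarith
  · rw [not_nonempty_iff_eq_empty] at hne
    refine (sig_le P _).trans ?_
    rw [hne]; simp

lemma sig_dbl {n : ℕ} {M Cσ d cd : ℝ} {Ω : Set (Eu n)} {σ : Measure (Eu n)} (P : IsMixedPair M Cσ d cd Ω σ)
    (hD : 0 < diam Ω) {Q : Eu n} (hQ : Q ∈ frontier Ω) :
    (σ (frontier Ω)).toReal ≤ Cσ ^ 8 * (σ (ball Q (diam Ω / 200) ∩ frontier Ω)).toReal := by
  have := sig_fin P
  have h1 : ∀ i : ℕ, i ≤ 8 → (σ (ball Q (2 ^ i * (diam Ω / 200)))).toReal ≤ Cσ ^ i * (σ (ball Q (diam Ω / 200))).toReal := by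
    intro i
    induction i with
    | zero => intro _; simp
    | succ i ih =>
      intro hi
      have h7 : (2:ℝ) ^ i ≤ 2 ^ 7 := pow_le_pow_right₀ (by norm_num) (by omega)
      have h2 := P.doubling Q hQ (2 ^ i * (diam Ω / 200)) (by positivity) (by norm_num at h7 ⊢; nlinarith)
      rw [← mul_assoc, ← pow_succ'] at h2
      have h3 := mul_le_mul_of_nonneg_left (ih (by omega)) P.Cσ_pos.le
      rw [pow_succ' Cσ, mul_assoc]
      linarith
  refine le_trans ?_ ((h1 8 le_rfl).trans ?_)
  · refine ENNReal.toReal_mono (measure_ne_top _ _) (measure_mono fun z hz => ?_)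
    rw [mem_ball]
    have : dist z Q ≤ diam Ω := by
      rw [← Metric.diam_closure]
      exact dist_le_diam_of_mem P.bounded.closure (frontier_subset_closure hz) (frontier_subset_closure hQ)
    norm_num; linarith
  · exact mul_le_mul_of_nonneg_left (ENNReal.toReal_mono (measure_ne_top _ _) (sig_le P _)) (by have := P.Cσ_pos; positivity)

lemma Geo.down {n : ℕ} {Ω : Set (Eu n)} {θ C Λ : ℝ} {ck : Eu n → ℝ → Eu n} (G : Geo Ω θ C Λ ck)
    {v : Eu n → ℝ} (hv1 : ContDiffOn ℝ 1 v Ω) {B : ℝ} (hB : 0 ≤ B) (hE : ∫⁻ z, gr2 Ω v z ≤ ENNReal.ofReal B)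
    {Z : Eu n} (hZ : Z ∈ closure Ω) (k : ℕ) :
    |An θ ck v Z (diam Ω / 200) - An θ ck v Z (diam Ω / 200 * (1/2) ^ k)| ≤
      3 * √ (C * ((diam Ω / 200 * (1/2) ^ k) ^ (n - 2))⁻¹ * B) := by
  have hC := G.Cp
  have hD := G.Dp
  induction k with
  | zero => simp
  | succ k ih =>
    set s := diam Ω / 200 * (1/2) ^ k with hs
    have hsp : 0 < s := by positivity
    have hp : (1/2:ℝ) ^ k ≤ 1 := pow_le_one₀ (by norm_num) (by norm_num)
    have h1 := (G.F3 v hv1 Z hZ s hsp (by nlinarith)).trans (mul_le_mul_right ((setLIntegral_le_lintegral _ _).trans hE) _)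
    rw [← ENNReal.ofReal_mul (by positivity), ENNReal.ofReal_le_ofReal_iff (by positivity)] at h1
    have h2 := Real.abs_le_sqrt h1
    have e : diam Ω / 200 * (1/2) ^ (k + 1) = s / 2 := by rw [hs, pow_succ]; ring
    rw [e]
    have h3 : √2 * √ (C * (s ^ (n - 2))⁻¹ * B) ≤ √ (C * ((s / 2) ^ (n - 2))⁻¹ * B) := by
      rw [← Real.sqrt_mul (by norm_num)]
      apply Real.sqrt_le_sqrt
      rw [div_pow, inv_div]
      have h4 : (2:ℝ) ≤ 2 ^ (n - 2) := le_self_pow₀ (by norm_num) (by have := G.hn; omega)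
      have : 0 ≤ C * (s ^ (n - 2))⁻¹ * B := by positivity
      calc _ ≤ 2 ^ (n-2) * (C * (s ^ (n - 2))⁻¹ * B) := by gcongr
        _ = _ := by ring
    have h5 : (4:ℝ) ≤ 3 * √2 := by
      have : (4/3:ℝ) ≤ √2 := Real.le_sqrt_of_sq_le (by norm_num)
      linarith
    have h6 : 0 ≤ √ (C * (s ^ (n - 2))⁻¹ * B) := Real.sqrt_nonneg _
    have h7 := abs_sub_le (An θ ck v Z (diam Ω / 200)) (An θ ck v Z s) (An θ ck v Z (s/2))
    have h8 : |An θ ck v Z s - An θ ck v Z (s/2)| ≤ √ (C * (s ^ (n - 2))⁻¹ * B) := h2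
    nlinarith

lemma trace (n : ℕ) (hn : 3 ≤ n) (C Λ Cσ d cd : ℝ) (hC : 0 < C) (hΛ : 1 ≤ Λ) (hCσ : 0 < Cσ) (hd : (n:ℝ) - 2 < d) (hcd : 0 < cd) :
    ∃ K : ℝ, 0 < K ∧ ∀ (Ω : Set (Eu n)) (σ : Measure (Eu n)) (M θ : ℝ) (ck : Eu n → ℝ → Eu n), IsMixedPair M Cσ d cd Ω σ → Geo Ω θ C Λ ck →
    ∀ Q0 ∈ frontier Ω, ∀ v : Eu n → ℝ, ContDiffOn ℝ 1 v Ω → ContinuousOn v (closure Ω) →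
    ∀ B, 0 < B → ∫⁻ z, gr2 Ω v z ≤ ENNReal.ofReal B → ∀ f : Eu n → ℝ≥0∞, AEMeasurable f (σ.restrict (frontier Ω)) →
    ∀ b, 0 < b → ∫⁻ z in frontier Ω, f z ∂σ ≤ ENNReal.ofReal b →
    ∃ Q ∈ frontier Ω, dist Q Q0 < diam Ω / 200 ∧ f Q ≤ ENNReal.ofReal (K * b / (σ (frontier Ω)).toReal) ∧
      (v Q - An θ ck v Q (diam Ω / 200)) ^ 2 ≤ K * ((diam Ω / 200) ^ (n - 2))⁻¹ * B := by
  have h3 : (3:ℝ) ≤ n := by exact_mod_cast hn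
  have hd0 : 0 < d := by linarith
  set q : ℝ := 2 ^ (n - 2) * (1/2) ^ d with hq
  have hq0 : 0 < q := by positivity
  have hq1 : q < 1 := by
    rw [hq, one_div, Real.inv_rpow (by norm_num), ← div_eq_mul_inv, div_lt_one (by positivity), ← Real.rpow_natCast]
    apply Real.rpow_lt_rpow_of_exponent_lt (by norm_num)
    rw [Nat.cast_sub (by omega)]; exact_mod_cast hd
  set r : ℝ := q ^ (1/4 : ℝ) with hr
  have hr0 : 0 < r := by positivity
  have hr1 : r < 1 := Real.rpow_lt_one hq0.le hq1 (by norm_num)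
  have hr4 : r ^ 4 = q := by
    rw [hr, ← Real.rpow_natCast, ← Real.rpow_mul hq0.le]; norm_num
  have hr2 : r ^ 2 < 1 := pow_lt_one₀ hr0.le hr1 (by norm_num)
  have hr2' : 0 < (1 - r ^ 2)⁻¹ := by
    have : 0 < 1 - r ^ 2 := by linarith
    positivity
  have hr1' : 0 < (1 - r)⁻¹ := by
    have : 0 < 1 - r := by linarith
    positivity
  set K1 := (1 + cd⁻¹) * (Λ / 50) ^ d with hK1
  have hK1p : 0 < K1 := by positivity
  set K2 := C * K1 * (1 - r ^ 2)⁻¹ with hK2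
  have hK2p : 0 < K2 := by positivity
  set K3 := (1 - r)⁻¹ ^ 2 * (2 * K2 * Cσ ^ 8) with hK3
  have hK3p : 0 < K3 := by positivity
  refine ⟨2 * Cσ ^ 8 + K3, by positivity, ?_⟩
  intro Ω σ M θ ck P G Q0 hQ0 v hv1 hv B hB hE f hf b hb hfb
  have := sig_fin P
  have hD := G.Dp
  set s0 := diam Ω / 200 with hs0
  have hs0p : 0 < s0 := by positivity
  set Δ := ball Q0 s0 ∩ frontier Ω with hΔ
  have hΔm : MeasurableSet Δ := measurableSet_ball.inter isClosed_frontier.measurableSet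
  have hdbl := sig_dbl P hD hQ0
  rw [← hs0, ← hΔ] at hdbl
  set S := (σ (frontier Ω)).toReal with hS
  have hSp : 0 < S := ENNReal.toReal_pos (ne_of_gt (lt_of_lt_of_le (P.supp_pos Q0 hQ0 1 one_pos) (sig_le' P _))) (measure_ne_top _ _)
  set m := (σ Δ).toReal with hm
  have hmp : 0 < m := ENNReal.toReal_pos (ne_of_gt (lt_of_lt_of_le (P.supp_pos Q0 hQ0 s0 hs0p) (sig_le P _))) (measure_ne_top _ _)
  have hσm : σ Δ = ENNReal.ofReal m := (ENNReal.ofReal_toReal (measure_ne_top _ _)).symm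
  have hσS : σ (frontier Ω) = ENNReal.ofReal S := (ENNReal.ofReal_toReal (measure_ne_top _ _)).symm
  set bb : ℕ → Eu n → ℝ≥0∞ := fun k Z => ENNReal.ofReal (C * ((s0 * (1/2) ^ k) ^ (n - 2))⁻¹) *
      ∫⁻ z in ball Z (Λ * (s0 * (1/2) ^ k)), gr2 Ω v z with hbb
  have hbm : ∀ k, Measurable (bb k) := fun k => (e_meas (gr2_meas G.op v) _).const_mul _
  set T : Eu n → ℝ≥0∞ := fun Z => ∑' k, ENNReal.ofReal ((r ^ 2)⁻¹ ^ k) * bb k Z with hT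
  have hTm : Measurable T := Measurable.tsum fun k => (hbm k).const_mul _
  have hTint : ∫⁻ z in Δ, T z ∂σ ≤ ENNReal.ofReal (K2 * (s0 ^ (n - 2))⁻¹ * B * S) := by
    rw [hT, lintegral_tsum fun k => ((hbm k).const_mul _).aemeasurable]
    have hk : ∀ k, ∫⁻ Z in Δ, ENNReal.ofReal ((r ^ 2)⁻¹ ^ k) * bb k Z ∂σ ≤ ENNReal.ofReal (C * K1 * (s0 ^ (n - 2))⁻¹ * B * S) * ENNReal.ofReal ((r ^ 2) ^ k) := by
      intro k
      rw [lintegral_const_mul _ (hbm k), hbb]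
      simp only
      rw [lintegral_const_mul _ (e_meas (gr2_meas G.op v) _), lint_e (gr2_meas G.op v)]
      have h1 : ∫⁻ w, gr2 Ω v w * (σ.restrict Δ) (ball w (Λ * (s0 * (1/2) ^ k))) ≤ ENNReal.ofReal B * ENNReal.ofReal (K1 * ((1/2) ^ d) ^ k * S) := by
        calc _ ≤ ∫⁻ w, gr2 Ω v w * ENNReal.ofReal (K1 * ((1/2) ^ d) ^ k * S) := by
              refine lintegral_mono fun w => mul_le_mul_right ((Measure.restrict_apply_le _ _).trans ?_) _
              rw [ENNReal.ofReal_mul (by positivity), ← hσS]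
              exact sig_ball hn P hD hΛ w k
          _ = (∫⁻ w, gr2 Ω v w) * ENNReal.ofReal (K1 * ((1/2) ^ d) ^ k * S) := lintegral_mul_const _ (gr2_meas G.op v)
          _ ≤ _ := mul_le_mul_left hE _
      refine (mul_le_mul_right (mul_le_mul_right h1 _) _).trans (le_of_eq ?_)
      rw [← ENNReal.ofReal_mul (by positivity), ← ENNReal.ofReal_mul (by positivity), ← ENNReal.ofReal_mul (by positivity), ← ENNReal.ofReal_mul (by positivity)]
      congr 1
      have e1 : ((s0 * (1/2) ^ k) ^ (n - 2))⁻¹ = (s0 ^ (n - 2))⁻¹ * (2 ^ (n - 2)) ^ k := by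
        rw [mul_pow, mul_inv, one_div, ← pow_mul, ← pow_mul, mul_comm k, inv_pow, inv_inv]
      have e2 : (r ^ 2)⁻¹ * (2 ^ (n-2) * (1/2:ℝ) ^ d) = r ^ 2 := by
        rw [← hq, ← hr4]; field_simp
      have e3 : (r ^ 2) ^ k = (r ^ 2)⁻¹ ^ k * ((2 ^ (n - 2)) ^ k * ((1/2:ℝ) ^ d) ^ k) := by
        rw [← mul_pow, ← mul_pow, e2]
      rw [e1, e3]
      ring
    refine (ENNReal.tsum_le_tsum hk).trans (le_of_eq ?_)
    rw [ENNReal.tsum_mul_left, geom_sum_ofReal (by positivity) hr2, ← ENNReal.ofReal_mul (by positivity)]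
    congr 1; rw [hK2]; ring
  set κP := K2 * (s0 ^ (n - 2))⁻¹ * B * S with hκP
  have hκPp : 0 < κP := by positivity
  have hfΔ : AEMeasurable f (σ.restrict Δ) := hf.mono_measure (Measure.restrict_mono inter_subset_right le_rfl)
  obtain ⟨Q, hQ, hQle⟩ := exists_le_setLAverage (μ := σ) (s := Δ) (f := fun Z => ENNReal.ofReal b⁻¹ * f Z + ENNReal.ofReal κP⁻¹ * T Z)
    (by rw [hσm]; exact (ENNReal.ofReal_pos.2 hmp).ne') (measure_ne_top _ _) ((hfΔ.const_mul _).add (hTm.aemeasurable.const_mul _))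
  have havg : ⨍⁻ Z in Δ, (ENNReal.ofReal b⁻¹ * f Z + ENNReal.ofReal κP⁻¹ * T Z) ∂σ ≤ ENNReal.ofReal (2 / m) := by
    rw [setLAverage_eq, lintegral_add_right' _ (hTm.aemeasurable.const_mul _), lintegral_const_mul' _ _ ENNReal.ofReal_ne_top, lintegral_const_mul _ hTm, hσm, ENNReal.ofReal_div_of_pos hmp]
    gcongr
    have a1 : ENNReal.ofReal b⁻¹ * ∫⁻ Z in Δ, f Z ∂σ ≤ 1 := by
      refine (mul_le_mul_right ((lintegral_mono_set inter_subset_right).trans hfb) _).trans (le_of_eq ?_)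
      rw [← ENNReal.ofReal_mul (by positivity), inv_mul_cancel₀ hb.ne', ENNReal.ofReal_one]
    have a2 : ENNReal.ofReal κP⁻¹ * ∫⁻ Z in Δ, T Z ∂σ ≤ 1 := by
      refine (mul_le_mul_right hTint _).trans (le_of_eq ?_)
      rw [← ENNReal.ofReal_mul (by positivity), inv_mul_cancel₀ hκPp.ne', ENNReal.ofReal_one]
    refine (add_le_add a1 a2).trans (le_of_eq ?_)
    rw [one_add_one_eq_two]; simp
  have hQ2 := hQle.trans havg
  have hmS : 2 / m ≤ 2 * Cσ ^ 8 / S := by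
    rw [div_le_div_iff₀ hmp hSp]; nlinarith
  have inv_cancel : ∀ (c : ℝ) (x : ℝ≥0∞), 0 < c → ENNReal.ofReal c⁻¹ * x ≤ ENNReal.ofReal (2 / m) → x ≤ ENNReal.ofReal (c * (2 * Cσ ^ 8 / S)) := by
    intro c x hc hx
    calc x = ENNReal.ofReal c * (ENNReal.ofReal c⁻¹ * x) := by
          rw [← mul_assoc, ← ENNReal.ofReal_mul hc.le, mul_inv_cancel₀ hc.ne', ENNReal.ofReal_one, one_mul]
      _ ≤ ENNReal.ofReal c * ENNReal.ofReal (2 * Cσ ^ 8 / S) := mul_le_mul_right (hx.trans (ENNReal.ofReal_le_ofReal hmS)) _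
      _ = _ := by rw [← ENNReal.ofReal_mul hc.le]
  have hfQ := inv_cancel b (f Q) hb (le_self_add.trans hQ2)
  have hTQ := inv_cancel κP (T Q) hκPp (le_add_self.trans hQ2)
  refine ⟨Q, hQ.2, mem_ball.1 hQ.1, hfQ.trans (ENNReal.ofReal_le_ofReal ?_), ?_⟩
  · rw [← mul_div_assoc]
    apply div_le_div_of_nonneg_right _ hSp.le
    nlinarith [mul_pos hb hK3p]
  · have h1 := G.pw hv1 hv (frontier_subset_closure hQ.2) hs0p le_rfl hr0 hr1 (T Q) ?_
    · have h2 := h1.trans (mul_le_mul_right hTQ _)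
      rw [← ENNReal.ofReal_mul (by positivity), ENNReal.ofReal_le_ofReal_iff (by positivity)] at h2
      refine h2.trans ?_
      have : (1 - r)⁻¹ ^ 2 * (κP * (2 * Cσ ^ 8 / S)) = K3 * (s0 ^ (n - 2))⁻¹ * B := by
        rw [hκP, hK3]; field_simp
      rw [this]
      gcongr
      have : 0 < 2 * Cσ ^ 8 := by positivity
      linarith
    · intro k
      have h2 : ENNReal.ofReal ((r ^ 2)⁻¹ ^ k) * bb k Q ≤ T Q := ENNReal.le_tsum k
      calc bb k Q = (ENNReal.ofReal ((r ^ 2)⁻¹ ^ k) * bb k Q) * ENNReal.ofReal (r ^ k) ^ 2 := by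
            rw [← ENNReal.ofReal_pow (by positivity), mul_right_comm, ← ENNReal.ofReal_mul (by positivity)]
            have : (r ^ 2)⁻¹ ^ k * (r ^ k) ^ 2 = 1 := by
              rw [← pow_mul, mul_comm k 2, pow_mul, ← mul_pow, inv_mul_cancel₀ (by positivity), one_pow]
            rw [this]; simp
        _ ≤ _ := mul_le_mul_left h2 _

lemma anchor (n : ℕ) (hn : 3 ≤ n) (C Λ Cσ d cd : ℝ) (hC : 0 < C) (hΛ : 1 ≤ Λ) (hCσ : 0 < Cσ) (hd : (n:ℝ) - 2 < d) (hcd : 0 < cd) :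
    ∃ K : ℝ, 0 < K ∧ ∀ (Ω : Set (Eu n)) (σ : Measure (Eu n)) (M θ : ℝ) (ck : Eu n → ℝ → Eu n), IsMixedPair M Cσ d cd Ω σ → Geo Ω θ C Λ ck →
    ∀ X ∈ Ω, ∀ v : Eu n → ℝ, ContDiffOn ℝ 1 v Ω → ContinuousOn v (closure Ω) →
    ∀ B, 0 < B → ∫⁻ z, gr2 Ω v z ≤ ENNReal.ofReal B → ∀ f : Eu n → ℝ≥0∞, AEMeasurable f (σ.restrict (frontier Ω)) →
    ∀ b, 0 < b → ∫⁻ z in frontier Ω, f z ∂σ ≤ ENNReal.ofReal b →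
    ∃ Q ∈ frontier Ω, f Q ≤ ENNReal.ofReal (K * b / (σ (frontier Ω)).toReal) ∧
      ∀ k : ℕ, ∀ Z ∈ closure Ω, dist X Z ≤ 8 * (diam Ω / 200 * (1/2) ^ k) →
      (An θ ck v Z (diam Ω / 200 * (1/2) ^ k) - v Q) ^ 2 ≤ K * ((diam Ω / 200 * (1/2) ^ k) ^ (n - 2))⁻¹ * B := by
  obtain ⟨K, hK, h⟩ := trace n hn C Λ Cσ d cd hC hΛ hCσ hd hcd
  refine ⟨5 * (K + 12 * C), by positivity, ?_⟩
  intro Ω σ M θ ck P G X hX v hv1 hv B hB hE f hf b hb hfb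
  have hD := G.Dp
  obtain ⟨Q0, hQ0, hF4⟩ := G.F4 X hX
  obtain ⟨Q, hQ, hQd, hfQ, hvQ⟩ := h Ω σ M θ ck P G Q0 hQ0 v hv1 hv B hB hE f hf b hb hfb
  have hXc := subset_closure hX
  refine ⟨Q, hQ, hfQ.trans (ENNReal.ofReal_le_ofReal ?_), ?_⟩
  · gcongr; linarith
  intro k Z hZ hXZ
  set s0 := diam Ω / 200 with hs0
  have hs0p : 0 < s0 := by positivity
  set s := s0 * (1/2) ^ k with hs
  have hsp : 0 < s := by positivity
  have hp : (1/2:ℝ) ^ k ≤ 1 := pow_le_one₀ (by norm_num) (by norm_num)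
  have hss0 : s ≤ s0 := by nlinarith
  have conv : ∀ (x t : ℝ) (e : ℝ≥0∞), 0 < t → e ≤ ENNReal.ofReal B → ENNReal.ofReal (x ^ 2) ≤ ENNReal.ofReal (C * (t ^ (n - 2))⁻¹) * e → x ^ 2 ≤ C * (t ^ (n - 2))⁻¹ * B := by
    intro x t e ht he hx
    have := hx.trans (mul_le_mul_right he _)
    rwa [← ENNReal.ofReal_mul (by positivity), ENNReal.ofReal_le_ofReal_iff (by positivity)] at this
  have a1 := conv _ s0 _ hs0p hE (hF4 v hv1 s0 rfl)
  have a2 := conv _ s0 _ hs0p ((setLIntegral_le_lintegral _ _).trans hE) (G.F2 v hv1 Q (frontier_subset_closure hQ) Q0 (frontier_subset_closure hQ0) s0 hs0p le_rfl (by linarith))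
  have a3 := conv _ s _ hsp ((setLIntegral_le_lintegral _ _).trans hE) (G.F2 v hv1 X hXc Z hZ s hsp hss0 hXZ)
  have a4 := pow_le_pow_left₀ (abs_nonneg _) (G.down hv1 hB.le hE hXc k) 2
  rw [mul_pow, Real.sq_sqrt (by positivity), sq_abs, ← hs0, ← hs] at a4
  change (An θ ck v X s0 - An θ ck v Q0 s0) ^ 2 ≤ _ at a1
  change (An θ ck v Q s0 - An θ ck v Q0 s0) ^ 2 ≤ _ at a2
  change (An θ ck v X s - An θ ck v Z s) ^ 2 ≤ _ at a3
  have hmono : (s0 ^ (n - 2))⁻¹ ≤ (s ^ (n - 2))⁻¹ := by gcongr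
  have m1 : C * (s0 ^ (n - 2))⁻¹ * B ≤ C * (s ^ (n - 2))⁻¹ * B := by gcongr
  have m2 : K * (s0 ^ (n - 2))⁻¹ * B ≤ K * (s ^ (n - 2))⁻¹ * B := by gcongr
  have five : ∀ x1 x2 x3 x4 x5 : ℝ, (x1 + x2 + x3 + x4 + x5) ^ 2 ≤ 5 * (x1 ^ 2 + x2 ^ 2 + x3 ^ 2 + x4 ^ 2 + x5 ^ 2) := by
    intro x1 x2 x3 x4 x5
    nlinarith [sq_nonneg (x1 - x2), sq_nonneg (x1 - x3), sq_nonneg (x1 - x4), sq_nonneg (x1 - x5), sq_nonneg (x2 - x3), sq_nonneg (x2 - x4), sq_nonneg (x2 - x5), sq_nonneg (x3 - x4), sq_nonneg (x3 - x5), sq_nonneg (x4 - x5)]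
  have := five (-(An θ ck v X s - An θ ck v Z s)) (-(An θ ck v X s0 - An θ ck v X s)) (An θ ck v X s0 - An θ ck v Q0 s0) (-(An θ ck v Q s0 - An θ ck v Q0 s0)) (-(v Q - An θ ck v Q s0))
  simp only [neg_sq] at this
  calc _ = (-(An θ ck v X s - An θ ck v Z s) + -(An θ ck v X s0 - An θ ck v X s) + (An θ ck v X s0 - An θ ck v Q0 s0) + -(An θ ck v Q s0 - An θ ck v Q0 s0) + -(v Q - An θ ck v Q s0)) ^ 2 := by ring
    _ ≤ _ := this
    _ ≤ 5 * (C * (s ^ (n - 2))⁻¹ * B + 3 ^ 2 * (C * (s ^ (n - 2))⁻¹ * B) + C * (s ^ (n - 2))⁻¹ * B + C * (s ^ (n - 2))⁻¹ * B + K * (s ^ (n - 2))⁻¹ * B) := by linarith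
    _ = _ := by ring

end RG

namespace RG

structure Ker {n : ℕ} (L s : ℝ) (k : Eu n → ℝ) : Prop where
  sm : ContDiff ℝ (⊤ : ℕ∞) k
  nn : ∀ x, 0 ≤ k x
  su : ∀ x, s ≤ ‖x‖ → k x = 0
  one : ∫ x, k x = 1
  lip : ∀ x y, |k x - k y| ≤ L * (s ^ (n+1))⁻¹ * ‖x - y‖

lemma Ker.cs {n : ℕ} {L s : ℝ} {k : Eu n → ℝ} (K : Ker L s k) : HasCompactSupport k := by
  apply HasCompactSupport.of_support_subset_isCompact (isCompact_closedBall (0 : Eu n) s)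
  intro x hx
  by_contra h
  exact hx (K.su x (by simpa using (not_le.1 (fun h' => h (by simpa using h'))).le))

lemma exists_ker (n : ℕ) : ∃ L : ℝ, 0 < L ∧ ∀ s : ℝ, 0 < s → ∃ k : Eu n → ℝ, Ker L s k := by
  let f : ContDiffBump (0 : Eu n) := ⟨1/2, 1, by norm_num, by norm_num⟩
  have hc : HasCompactSupport (f.normed volume) := f.hasCompactSupport_normed
  have hs : ContDiff ℝ (⊤ : ℕ∞) (f.normed volume) := f.contDiff_normed
  obtain ⟨L, hL⟩ := hs.lipschitzWith_of_hasCompactSupport hc (by simp)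
  refine ⟨L + 1, by positivity, fun s hsp => ⟨fun x => (s ^ n)⁻¹ * f.normed volume (s⁻¹ • x), ?_, ?_, ?_, ?_, ?_⟩⟩
  · exact contDiff_const.mul (hs.comp (contDiff_const_smul _))
  · intro x; exact mul_nonneg (by positivity) (f.nonneg_normed _)
  · intro x hx
    have : f.normed volume (s⁻¹ • x) = 0 := by
      apply Function.notMem_support.1
      rw [f.support_normed_eq]
      simp only [mem_ball_zero_iff, not_lt, norm_smul, norm_inv, Real.norm_eq_abs, abs_of_pos hsp]
      show 1 ≤ _
      rw [inv_mul_eq_div, le_div_iff₀ hsp]; linarith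
    simp [this]
  · rw [integral_const_mul, Measure.integral_comp_smul, f.integral_normed]
    simp [abs_of_pos hsp, hsp.ne']
  · intro x y
    have h := hL.dist_le_mul (s⁻¹ • x) (s⁻¹ • y)
    rw [Real.dist_eq, dist_eq_norm, ← smul_sub, norm_smul, norm_inv, Real.norm_eq_abs, abs_of_pos hsp] at h
    rw [← mul_sub, abs_mul, abs_of_pos (by positivity : 0 < (s ^ n)⁻¹), pow_succ]
    calc (s ^ n)⁻¹ * |f.normed volume (s⁻¹ • x) - f.normed volume (s⁻¹ • y)| ≤ (s ^ n)⁻¹ * ((L+1) * (s⁻¹ * ‖x - y‖)) := by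
          gcongr
          refine h.trans ?_
          gcongr; linarith
      _ = _ := by rw [mul_inv]; ring

lemma Ker.int {n : ℕ} {L s : ℝ} {k : Eu n → ℝ} (K : Ker L s k) (z : Eu n) : Integrable (fun y => k (z - y)) :=
  (K.sm.continuous.integrable_of_hasCompactSupport K.cs).comp_sub_left z

lemma Ker.int1 {n : ℕ} {L s : ℝ} {k : Eu n → ℝ} (K : Ker L s k) (z : Eu n) : ∫ y, k (z - y) = 1 := by
  rw [integral_sub_left_eq_self k volume z, K.one]

lemma Ker.close {n : ℕ} {L s : ℝ} {k : Eu n → ℝ} (K : Ker L s k) {a : Eu n → ℝ} (ha : Measurable a) {A : ℝ}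
    (hA : ∀ y, |a y| ≤ A) {z : Eu n} {c ε : ℝ} (h : ∀ y, dist y z < s → |a y - c| ≤ ε) :
    |(∫ y, a y * k (z - y)) - c| ≤ ε := by
  have h1 : Integrable (fun y => a y * k (z - y)) :=
    (K.int z).bdd_mul ha.aestronglyMeasurable (Filter.Eventually.of_forall hA)
  have h2 : (∫ y, a y * k (z - y)) - c = ∫ y, (a y - c) * k (z - y) := by
    simp_rw [sub_mul]
    rw [integral_sub h1 ((K.int z).const_mul c), integral_const_mul, K.int1, mul_one]
  rw [h2, ← Real.norm_eq_abs]
  calc _ ≤ ∫ y, ε * k (z - y) := by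
        apply norm_integral_le_of_norm_le ((K.int z).const_mul ε)
        refine Filter.Eventually.of_forall fun y => ?_
        rw [norm_mul, Real.norm_eq_abs, Real.norm_eq_abs, abs_of_nonneg (K.nn _)]
        by_cases hy : dist y z < s
        · exact mul_le_mul_of_nonneg_right (h y hy) (K.nn _)
        · rw [K.su (z - y) (by rw [← dist_eq_norm, dist_comm]; linarith)]; simp
    _ = ε := by rw [integral_const_mul, K.int1, mul_one]

lemma Ker.lipc {n : ℕ} {L s : ℝ} {k : Eu n → ℝ} (K : Ker L s k) (hL : 0 < L) (hs : 0 < s) {a : Eu n → ℝ} (ha : Measurable a) {A : ℝ}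
    (hA : ∀ y, |a y| ≤ A) {z z' : Eu n} (hz : dist z' z ≤ s) {c ε : ℝ} (h : ∀ y, dist y z < 2 * s → |a y - c| ≤ ε) :
    |(∫ y, a y * k (z' - y)) - (∫ y, a y * k (z - y))| ≤ ε * L * ωn n * 2 ^ n * s⁻¹ * ‖z' - z‖ := by
  have h1 : ∀ z, Integrable (fun y => a y * k (z - y)) := fun z =>
    (K.int z).bdd_mul ha.aestronglyMeasurable (Filter.Eventually.of_forall hA)
  have h2 : (∫ y, a y * k (z' - y)) - (∫ y, a y * k (z - y)) = ∫ y, (a y - c) * (k (z' - y) - k (z - y)) := by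
    have e : ∀ y, (a y - c) * (k (z' - y) - k (z - y)) = (a y * k (z' - y) - c * k (z' - y)) - (a y * k (z - y) - c * k (z - y)) := fun y => by ring
    simp_rw [e]
    have i1 : ∀ z, Integrable (fun y => a y * k (z - y) - c * k (z - y)) := fun z => (h1 z).sub ((K.int z).const_mul c)
    rw [integral_sub (i1 z') (i1 z),
      integral_sub (h1 z') ((K.int z').const_mul c), integral_sub (h1 z) ((K.int z).const_mul c), integral_const_mul, integral_const_mul, K.int1, K.int1]
    ring
  have h3 : ∫ y, (a y - c) * (k (z' - y) - k (z - y)) = ∫ y in ball z (2 * s), (a y - c) * (k (z' - y) - k (z - y)) := by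
    rw [setIntegral_eq_integral_of_forall_compl_eq_zero]
    intro y hy
    rw [mem_ball, not_lt] at hy
    rw [K.su (z - y) (by rw [← dist_eq_norm, dist_comm]; linarith), K.su (z' - y)]
    · simp
    · rw [← dist_eq_norm]; have := dist_triangle y z' z; rw [dist_comm] at this ⊢
      rw [dist_comm z y] at this; linarith [dist_comm y z']
  have hε : 0 ≤ ε := (abs_nonneg _).trans (h z (by simp [hs]))
  rw [h2, h3, ← Real.norm_eq_abs]
  have h4 := norm_setIntegral_le_of_norm_le_const (μ := volume) (s := ball z (2 * s)) (f := fun y => (a y - c) * (k (z' - y) - k (z - y)))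
    (C := ε * (L * (s ^ (n+1))⁻¹ * ‖z' - z‖)) measure_ball_lt_top ?_
  · refine h4.trans (le_of_eq ?_)
    rw [Measure.real, vol_ball z (by positivity), ENNReal.toReal_ofReal (by have := ωn_pos n; positivity)]
    rw [mul_pow, pow_succ]
    field_simp
  · intro y hy
    rw [norm_mul, Real.norm_eq_abs, Real.norm_eq_abs]
    have := K.lip (z' - y) (z - y)
    rw [sub_sub_sub_cancel_right] at this
    exact mul_le_mul (h y hy) this (abs_nonneg _) hε

lemma dens {n : ℕ} {Ω : Set (Eu n)} {θ C Λ : ℝ} {ck : Eu n → ℝ → Eu n} (G : Geo Ω θ C Λ ck)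
    {w : Eu n → ℝ} (hw1 : ContDiffOn ℝ 1 w Ω) (hw : ContinuousOn w (closure Ω)) (hE : ∫⁻ z, gr2 Ω w z ≠ ⊤)
    {Y : Eu n} {ρ : ℝ} (hρ : 0 < ρ) (hY : ∀ z ∈ Ω, dist z Y < ρ → w z = 0) :
    ∃ B : ℝ, ∀ ε : ℝ, 0 < ε → ∃ φ : Eu n → ℝ, ContDiff ℝ (⊤ : ℕ∞) φ ∧ HasCompactSupport φ ∧
      (∀ z ∈ closure Ω, |φ z - w z| ≤ ε) ∧ (∀ z ∈ closure Ω, dist z Y < ρ / 2 → φ z = 0) ∧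
      ∫⁻ z in Ω, ‖fderiv ℝ φ z‖ₑ ^ 2 ≤ ENNReal.ofReal B := by
  obtain ⟨L, hL, hker⟩ := exists_ker n
  have hωp := ωn_pos n
  have hn0 : (0:ℝ) < n := by have := G.hn; exact_mod_cast (by omega : 0 < n)
  have hcpt : IsCompact (closure Ω) := G.bd.isCompact_closure
  have hD := G.Dp
  refine ⟨(L * ωn n * 2 ^ n) ^ 2 * C * (ωn n * (Λ + 3) ^ n) * (∫⁻ z, gr2 Ω w z).toReal, fun ε hε => ?_⟩
  obtain ⟨δ, hδ, hδw⟩ := Metric.uniformContinuousOn_iff.1 (hcpt.uniformContinuousOn_of_continuous hw) ε hε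
  obtain ⟨A, hA⟩ := hcpt.exists_bound_of_continuousOn hw
  set s : ℝ := min (diam Ω / 200) (min (δ / 12) (ρ / 12)) with hs
  have hsp : 0 < s := by rw [hs]; positivity
  have hsD : s ≤ diam Ω / 200 := min_le_left _ _
  have hsδ : 12 * s ≤ δ := by
    have : s ≤ δ / 12 := (min_le_right _ _).trans (min_le_left _ _)
    linarith
  have hsρ : 12 * s ≤ ρ := by
    have : s ≤ ρ / 12 := (min_le_right _ _).trans (min_le_right _ _)
    linarith
  obtain ⟨k, K⟩ := hker s hsp
  set cell : Eu n → (Fin n → ℤ) := fun y i => ⌊y i / (s / n)⌋ with hcell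
  have cellm : Measurable cell := by
    apply measurable_pi_lambda
    intro i
    apply Int.measurable_floor.comp
    have : Measurable (fun y : Eu n => y i) := (EuclideanSpace.proj (𝕜 := ℝ) i).continuous.measurable
    exact this.div_const _
  have celld : ∀ y y', cell y = cell y' → dist y y' ≤ s := by
    intro y y' h
    rw [EuclideanSpace.dist_eq]
    have h1 : ∀ i, dist (y i) (y' i) ^ 2 ≤ (s / n) ^ 2 := by
      intro i
      have h2 := Int.abs_sub_lt_one_of_floor_eq_floor (congrFun h i)
      rw [← sub_div, abs_div, abs_of_pos (by positivity : 0 < s / n), div_lt_one (by positivity)] at h2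
      rw [Real.dist_eq]
      exact pow_le_pow_left₀ (abs_nonneg _) h2.le 2
    have h3 : ∑ i, dist (y i) (y' i) ^ 2 ≤ s ^ 2 := by
      refine (Finset.sum_le_sum (fun i _ => h1 i)).trans ?_
      simp only [Finset.sum_const, Finset.card_univ, Fintype.card_fin, nsmul_eq_mul]
      rw [div_pow, mul_div_assoc', div_le_iff₀ (by positivity)]
      have : (1:ℝ) ≤ n := by have := G.hn; exact_mod_cast (by omega : 1 ≤ n)
      nlinarith [mul_pos (pow_pos hsp 2) hn0]
    calc _ ≤ √(s ^ 2) := Real.sqrt_le_sqrt h3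
      _ = s := Real.sqrt_sq hsp.le
  have hZ : ∀ m : Fin n → ℤ, ∃ Z ∈ closure Ω, ∀ y, ∀ z ∈ closure Ω, cell y = m → dist z y ≤ 2 * s → dist Z y ≤ 3 * s := by
    intro m
    by_cases h : ∃ y, ∃ z ∈ closure Ω, cell y = m ∧ dist z y ≤ 2 * s
    · obtain ⟨y, z, hz, hy, hd⟩ := h
      refine ⟨z, hz, fun y' z' _ hy' _ => ?_⟩
      have := celld y y' (hy.trans hy'.symm)
      have := dist_triangle z y y'
      linarith
    · obtain ⟨z0, hz0⟩ := G.ne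
      refine ⟨z0, subset_closure hz0, fun y z hz hy hd => absurd ⟨y, z, hz, hy, hd⟩ h⟩
  choose Zf hZc hZd using hZ
  obtain ⟨R, hR⟩ := hcpt.isBounded.subset_ball (0 : Eu n)
  set a : Eu n → ℝ := (ball (0 : Eu n) (R + 2 * s)).indicator (fun y => An θ ck w (Zf (cell y)) s) with ha
  have ham : Measurable a := by
    apply Measurable.indicator _ measurableSet_ball
    exact (measurable_of_countable (fun m => An θ ck w (Zf m) s)).comp cellm
  have hwΩ : ContinuousOn w Ω := hw.mono subset_closure
  have hAn : ∀ m, |An θ ck w (Zf m) s| ≤ A := by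
    intro m
    have := G.An_close hwΩ (hZc m) (c := 0) (ε := A) hsp hsD (fun z hz => by simpa using hA z (subset_closure hz.1))
    simpa using this
  have hA0 : 0 ≤ A := (abs_nonneg _).trans (hAn 0)
  have haA : ∀ y, |a y| ≤ A := by
    intro y
    by_cases hy : y ∈ ball (0 : Eu n) (R + 2 * s)
    · rw [ha, indicator_of_mem hy]; exact hAn _
    · rw [ha, indicator_of_notMem hy]; simpa using hA0
  have hae : ∀ z ∈ closure Ω, ∀ y, dist y z < 2 * s → a y = An θ ck w (Zf (cell y)) s ∧ dist (Zf (cell y)) y ≤ 3 * s := by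
    intro z hz y hy
    refine ⟨?_, hZd _ y z hz rfl (by rw [dist_comm]; exact hy.le)⟩
    rw [ha, indicator_of_mem]
    have h1 := mem_ball.1 (hR hz)
    have := dist_triangle y z 0
    rw [mem_ball]; linarith
  have hclose : ∀ z ∈ closure Ω, ∀ c e : ℝ, (∀ x ∈ Ω, dist x z < 6 * s → |w x - c| ≤ e) → |(∫ y, a y * k (z - y)) - c| ≤ e := by
    intro z hz c e h
    refine K.close ham haA fun y hy => ?_
    obtain ⟨e1, e2⟩ := hae z hz y (by linarith)
    rw [e1]
    refine G.An_close hwΩ (hZc _) hsp hsD fun x hx => h x hx.1 ?_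
    have := mem_ball.1 hx.2
    have h1 := dist_triangle x (Zf (cell y)) z
    have h2 := dist_triangle (Zf (cell y)) y z
    linarith
  refine ⟨fun z => ∫ y, a y * k (z - y), ?_, ?_, ?_, ?_, ?_⟩
  · have hli : LocallyIntegrable a volume := by
      have : MemLp a ⊤ volume := memLp_top_of_bound ham.aestronglyMeasurable A (Filter.Eventually.of_forall haA)
      exact this.locallyIntegrable le_top
    exact K.cs.contDiff_convolution_right (ContinuousLinearMap.mul ℝ ℝ) hli K.sm
  · have hac : HasCompactSupport a := by
      apply HasCompactSupport.of_support_subset_isCompact (isCompact_closedBall (0 : Eu n) (R + 2 * s))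
      exact (support_indicator_subset).trans ball_subset_closedBall
    exact hac.convolution (ContinuousLinearMap.mul ℝ ℝ) K.cs
  · intro z hz
    refine hclose z hz _ _ fun x hx hxz => ?_
    have := hδw x (subset_closure hx) z hz (by linarith)
    rw [Real.dist_eq] at this; exact this.le
  · intro z hz hzY
    have := hclose z hz 0 0 fun x hx hxz => ?_
    · simpa using this
    · have := dist_triangle x z Y
      rw [hY x hx (by linarith)]; simp
  · set g := gr2 Ω w with hg
    have hgm : Measurable g := gr2_meas G.op w
    have hpt : ∀ z ∈ Ω, ‖fderiv ℝ (fun z => ∫ y, a y * k (z - y)) z‖ₑ ^ 2 ≤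
        ENNReal.ofReal ((L * ωn n * 2 ^ n) ^ 2 * C * (s ^ n)⁻¹) * ∫⁻ x in ball z ((Λ + 3) * s), g x := by
      intro z hzΩ
      have hz := subset_closure hzΩ
      set I := ∫⁻ x in ball z ((Λ + 3) * s), g x with hI
      have hIt : I ≠ ⊤ := ne_top_of_le_ne_top hE (setLIntegral_le_lintegral _ _)
      set ee := √(C * (s ^ (n-2))⁻¹ * I.toReal) with hee
      have hCp := G.Cp
      have he2 : ee ^ 2 = C * (s ^ (n-2))⁻¹ * I.toReal := Real.sq_sqrt (by positivity)
      have hle : ‖fderiv ℝ (fun z => ∫ y, a y * k (z - y)) z‖ ≤ ee * L * ωn n * 2 ^ n * s⁻¹ := by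
        apply norm_fderiv_le_of_lip' ℝ (by positivity)
        filter_upwards [ball_mem_nhds z hsp] with z' hz'
        refine K.lipc hL hsp ham haA (mem_ball.1 hz').le (c := An θ ck w (Zf (cell z)) s) fun y hy => ?_
        obtain ⟨e1, e2⟩ := hae z hz y hy
        obtain ⟨-, e3⟩ := hae z hz z (by simp [hsp])
        rw [e1]
        have hF := G.F2 w hw1 _ (hZc (cell z)) _ (hZc (cell y)) s hsp hsD (by
          have h1 := dist_triangle (Zf (cell z)) z (Zf (cell y))
          have h2 := dist_triangle z y (Zf (cell y))
          rw [dist_comm z y, dist_comm y (Zf (cell y))] at h2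
          linarith)
        have hsub : ∫⁻ x in ball (Zf (cell z)) (Λ * s), gr2 Ω w x ≤ I := by
          apply lintegral_mono_set
          apply ball_subset_ball'
          linarith
        have hF2 := hF.trans (mul_le_mul_right hsub _)
        rw [← ENNReal.ofReal_toReal hIt, ← ENNReal.ofReal_mul (by positivity), ENNReal.ofReal_le_ofReal_iff (by positivity), ← he2] at hF2
        rw [abs_sub_comm]
        exact abs_le_of_sq_le_sq hF2 (by positivity)
      rw [← ENNReal.ofReal_toReal hIt, ← ENNReal.ofReal_mul (by positivity), ← ofReal_norm, ← ENNReal.ofReal_pow (norm_nonneg _)]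
      apply ENNReal.ofReal_le_ofReal
      refine (pow_le_pow_left₀ (norm_nonneg _) hle 2).trans (le_of_eq ?_)
      have : (ee * L * ωn n * 2 ^ n * s⁻¹) ^ 2 = ee ^ 2 * (L * ωn n * 2 ^ n) ^ 2 * (s ^ 2)⁻¹ := by
        rw [← inv_pow]; ring
      rw [this, he2]
      have e4 := sq_mul_inv G.hn hsp
      rw [← e4]; field_simp
    calc _ ≤ ∫⁻ z in Ω, ENNReal.ofReal ((L * ωn n * 2 ^ n) ^ 2 * C * (s ^ n)⁻¹) * ∫⁻ x in ball z ((Λ + 3) * s), g x :=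
          setLIntegral_mono' G.op.measurableSet hpt
      _ ≤ ∫⁻ z, ENNReal.ofReal ((L * ωn n * 2 ^ n) ^ 2 * C * (s ^ n)⁻¹) * ∫⁻ x in ball z ((Λ + 3) * s), g x :=
          setLIntegral_le_lintegral _ _
      _ = ENNReal.ofReal ((L * ωn n * 2 ^ n) ^ 2 * C * (s ^ n)⁻¹) * (∫⁻ x, g x * ENNReal.ofReal (ωn n * ((Λ + 3) * s) ^ n)) := by
          rw [lintegral_const_mul _ (e_meas hgm _), lint_e hgm]
          have hΛ := G.Λp
          simp_rw [fun x : Eu n => vol_ball x (by positivity : 0 < (Λ + 3) * s)]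
      _ = _ := by
          have hΛ := G.Λp
          have hCp := G.Cp
          rw [lintegral_mul_const _ hgm, ← ENNReal.ofReal_toReal hE, ← ENNReal.ofReal_mul (by positivity), ← ENNReal.ofReal_mul (by positivity),
            ENNReal.toReal_ofReal (by positivity)]
          congr 1
          rw [mul_pow (Λ + 3) s n]; field_simp

end RG

namespace RG

lemma ngrad {n : ℕ} (f : Eu n → ℝ) (x : Eu n) : ‖gradient f x‖ = ‖fderiv ℝ f x‖ := by
  rw [gradient, LinearIsometryEquiv.norm_map]

lemma grad_meas {n : ℕ} (f : Eu n → ℝ) : Measurable (gradient f) :=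
  ((InnerProductSpace.toDual ℝ (Eu n)).symm.continuous.measurable).comp (measurable_fderiv ℝ f)

lemma grad_mul {n : ℕ} {f g : Eu n → ℝ} {x : Eu n} (hf : DifferentiableAt ℝ f x) (hg : DifferentiableAt ℝ g x) :
    gradient (fun z => f z * g z) x = f x • gradient g x + g x • gradient f x := by
  simp only [gradient]
  rw [fderiv_fun_mul hf hg]; simp

lemma grad_sub {n : ℕ} {f g : Eu n → ℝ} {x : Eu n} (hf : DifferentiableAt ℝ f x) (hg : DifferentiableAt ℝ g x) :
    gradient (fun z => f z - g z) x = gradient f x - gradient g x := by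
  simp only [gradient]
  rw [fderiv_fun_sub hf hg]; simp

lemma grad_comp {n : ℕ} {f : Eu n → ℝ} {Φ : ℝ → ℝ} {Φ' : ℝ} {x : Eu n} (hf : DifferentiableAt ℝ f x) (hΦ : HasDerivAt Φ Φ' (f x)) :
    gradient (fun z => Φ (f z)) x = Φ' • gradient f x := by
  have := (hΦ.comp_hasFDerivAt x hf.hasFDerivAt).fderiv
  simp only [gradient]
  rw [← map_smul, ← this]; rfl

lemma inner_grad {n : ℕ} (f g : Eu n → ℝ) (x : Eu n) :
    ⟪gradient f x, gradient g x⟫ = ∑ i : Fin n, fderiv ℝ f x (EuclideanSpace.single i 1) * fderiv ℝ g x (EuclideanSpace.single i 1) := by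
  rw [← OrthonormalBasis.sum_inner_mul_inner (EuclideanSpace.basisFun (Fin n) ℝ)]
  refine Finset.sum_congr rfl fun i _ => ?_
  rw [inner_gradient_left, real_inner_comm, inner_gradient_left]; simp

lemma cont_mul {n : ℕ} {S : Set (Eu n)} (hS : IsOpen S) {f p : Eu n → ℝ} (hf : ContinuousOn f S) (hp : Continuous p)
    (hpS : tsupport p ⊆ S) : Continuous (fun x => f x * p x) := by
  apply continuous_of_tsupport
  intro x hx
  have : x ∈ S := hpS (tsupport_mul_subset_right hx)
  exact (hf.continuousAt (hS.mem_nhds this)).mul hp.continuousAt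

lemma int_mul {n : ℕ} {S : Set (Eu n)} (hS : IsOpen S) {f p : Eu n → ℝ} (hf : ContinuousOn f S) (hp : Continuous p)
    (hpc : HasCompactSupport p) (hpS : tsupport p ⊆ S) : Integrable (fun x => f x * p x) :=
  (cont_mul hS hf hp hpS).integrable_of_hasCompactSupport hpc.mul_left

lemma cont_fd {n : ℕ} {S : Set (Eu n)} (hS : IsOpen S) {f : Eu n → ℝ} (hf : ContDiffOn ℝ 1 f S) (v : Eu n) :
    ContinuousOn (fun x => fderiv ℝ f x v) S :=
  (hf.continuousOn_fderiv_of_isOpen hS le_rfl).clm_apply continuousOn_const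

lemma ibp {n : ℕ} {S : Set (Eu n)} (hS : IsOpen S) {f p : Eu n → ℝ} (hf : ContDiffOn ℝ 1 f S) (hp : ContDiff ℝ 1 p)
    (hpc : HasCompactSupport p) (hpS : tsupport p ⊆ S) (v : Eu n) :
    ∫ x, f x * fderiv ℝ p x v = - ∫ x, fderiv ℝ f x v * p x := by
  have hc : Continuous (fun x => fderiv ℝ p x v) := (hp.continuous_fderiv (by norm_num)).clm_apply continuous_const
  apply integral_mul_fderiv_eq_neg_fderiv_mul_of_integrable
  · exact int_mul hS (cont_fd hS hf v) hp.continuous hpc hpS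
  · exact int_mul hS hf.continuousOn hc (hpc.fderiv_apply ℝ v) ((tsupport_fderiv_apply_subset ℝ v).trans hpS)
  · exact int_mul hS hf.continuousOn hp.continuous hpc hpS
  · intro x hx
    exact (hf.contDiffAt (hS.mem_nhds (hpS hx))).differentiableAt (by norm_num)
  · intro x _
    exact hp.differentiable (by norm_num) x

lemma ibp0 {n : ℕ} {S : Set (Eu n)} (hS : IsOpen S) {u p : Eu n → ℝ} (hu : IsHarmonicOn u S) (hp : ContDiff ℝ 1 p)
    (hpc : HasCompactSupport p) (hpS : tsupport p ⊆ S) : ∫ x, ⟪gradient u x, gradient p x⟫ = 0 := by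
  have hu2 : ContDiffOn ℝ 2 u S := fun x hx => (hu x hx).1.contDiffWithinAt
  have hu1 : ∀ v, ContDiffOn ℝ 1 (fun x => fderiv ℝ u x v) S := fun v =>
    ((hu2.fderiv_of_isOpen hS (by norm_num)).clm_apply contDiffOn_const)
  simp_rw [inner_grad]
  rw [integral_finsetSum]
  · simp_rw [fun i => ibp hS (hu1 (EuclideanSpace.single i 1)) hp hpc hpS (EuclideanSpace.single i 1)]
    rw [Finset.sum_neg_distrib, ← integral_finsetSum]
    · rw [neg_eq_zero]
      apply integral_eq_zero_of_ae
      refine Filter.Eventually.of_forall fun x => ?_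
      simp only [Pi.zero_apply]
      rw [← Finset.sum_mul]
      by_cases hx : x ∈ S
      · rw [mul_eq_zero]; left
        rw [← (hu x hx).2]
        refine Finset.sum_congr rfl fun i _ => ?_
        rw [iteratedFDeriv_two_apply]
        have hd : DifferentiableAt ℝ (fderiv ℝ u) x :=
          ((hu x hx).1.fderiv_right (m := 1) (by norm_num)).differentiableAt (by norm_num)
        rw [fderiv_clm_apply hd (differentiableAt_const _)]
        simp
      · rw [image_eq_zero_of_notMem_tsupport (fun h => hx (hpS h)), mul_zero]
    · intro i _
      exact int_mul hS (cont_fd hS (hu1 _) _) hp.continuous hpc hpS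
  · intro i _
    exact int_mul hS (hu1 _).continuousOn ((hp.continuous_fderiv (by norm_num)).clm_apply continuous_const) (hpc.fderiv_apply ℝ _) ((tsupport_fderiv_apply_subset ℝ _).trans hpS)

lemma cutoff {n : ℕ} {Ω K : Set (Eu n)} (hΩ : IsOpen Ω) (hK : IsCompact K) (hKΩ : K ⊆ Ω) :
    ∃ χ : Eu n → ℝ, ContDiff ℝ (⊤ : ℕ∞) χ ∧ HasCompactSupport χ ∧ tsupport χ ⊆ Ω ∧ (∀ x ∈ K, χ x = 1) ∧ ∀ x, χ x ∈ Icc (0:ℝ) 1 := by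
  obtain ⟨K', hK', h1, h2⟩ := exists_compact_between hK hΩ hKΩ
  obtain ⟨f, hf1, hf0, hf⟩ := exists_contMDiffMap_one_nhds_of_subset_interior (modelWithCornersSelf ℝ (Eu n)) (n := (⊤ : ℕ∞)) hK.isClosed h1
  have hs : tsupport f ⊆ K' := closure_minimal (fun x hx => by_contra fun h => hx (hf0 x h)) hK'.isClosed
  refine ⟨f, f.contMDiff.contDiff, HasCompactSupport.of_support_subset_isCompact hK' (subset_closure.trans hs), hs.trans h2, fun x hx => hf1.self_of_nhdsSet x hx, hf⟩

end RG

namespace RG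

structure Sol {n : ℕ} (Ω : Set (Eu n)) (σ : Measure (Eu n)) (a : ℝ) (Y : Eu n) (u : Eu n → ℝ) : Prop where
  op : IsOpen Ω
  bd : Bornology.IsBounded Ω
  hY : Y ∈ Ω
  ap : 0 < a
  fin : σ (frontier Ω) ≠ ⊤
  nn : ∀ x ∈ closure Ω \ {Y}, 0 ≤ u x
  co : ContinuousOn u (closure Ω \ {Y})
  ha : IsHarmonicOn u (Ω \ {Y})
  l2 : ∀ r : ℝ, 0 < r → IntegrableOn (fun X => ‖gradient u X‖ ^ 2) (Ω \ ball Y r)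
  l1 : IntegrableOn (fun X => ‖gradient u X‖) Ω
  wk : ∀ φ : Eu n → ℝ, ContDiff ℝ (⊤ : ℕ∞) φ → HasCompactSupport φ →
    (∫ X in Ω, ⟪gradient u X, gradient φ X⟫) + a * ∫ P in frontier Ω, u P * φ P ∂σ = φ Y

lemma ofReal_grad {n : ℕ} (f : Eu n → ℝ) (z : Eu n) : ENNReal.ofReal (‖gradient f z‖ ^ 2) = ‖fderiv ℝ f z‖ₑ ^ 2 := by
  rw [ENNReal.ofReal_pow (norm_nonneg _), ngrad, ofReal_norm]

lemma en_int {n : ℕ} {S : Set (Eu n)} {f : Eu n → ℝ} {B : ℝ} (hB : 0 ≤ B)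
    (h : ∫⁻ z in S, ‖fderiv ℝ f z‖ₑ ^ 2 ≤ ENNReal.ofReal B) :
    IntegrableOn (fun z => ‖gradient f z‖ ^ 2) S ∧ ∫ z in S, ‖gradient f z‖ ^ 2 ≤ B := by
  have hm : Measurable (fun z => ‖gradient f z‖ ^ 2) := (grad_meas f).norm.pow_const 2
  constructor
  · refine ⟨hm.aestronglyMeasurable, ?_⟩
    rw [hasFiniteIntegral_iff_ofReal (Filter.Eventually.of_forall fun z => by positivity)]
    simp_rw [ofReal_grad]
    exact h.trans_lt ENNReal.ofReal_lt_top
  · rw [integral_eq_lintegral_of_nonneg_ae (Filter.Eventually.of_forall fun z => by positivity) hm.aestronglyMeasurable]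
    simp_rw [ofReal_grad]
    exact ENNReal.toReal_le_of_le_ofReal hB h

lemma en_fin {n : ℕ} {Ω : Set (Eu n)} (hΩ : IsOpen Ω) {f : Eu n → ℝ} (h : IntegrableOn (fun z => ‖gradient f z‖ ^ 2) Ω) :
    ∫⁻ z, gr2 Ω f z = ENNReal.ofReal (∫ z in Ω, ‖gradient f z‖ ^ 2) := by
  rw [gr2, lintegral_indicator hΩ.measurableSet, ofReal_integral_eq_lintegral_ofReal h (Filter.Eventually.of_forall fun z => by positivity)]
  simp_rw [ofReal_grad]

lemma C1_mul {n : ℕ} {Ω : Set (Eu n)} (hΩ : IsOpen Ω) {d χ : Eu n → ℝ} (hd : ContDiffOn ℝ 1 d Ω) (hχ : ContDiff ℝ 1 χ)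
    (hs : tsupport χ ⊆ Ω) : ContDiff ℝ 1 (fun x => d x * χ x) := by
  rw [contDiff_iff_contDiffAt]
  intro x
  by_cases hx : x ∈ tsupport χ
  · exact (hd.contDiffAt (hΩ.mem_nhds (hs hx))).mul hχ.contDiffAt
  · have : (fun x => d x * χ x) =ᶠ[𝓝 x] fun _ => 0 := by
      filter_upwards [notMem_tsupport_iff_eventuallyEq.1 hx] with y hy
      simp [hy]
    exact (contDiffAt_const (c := (0:ℝ))).congr_of_eventuallyEq this

lemma bint {n : ℕ} {Ω : Set (Eu n)} {σ : Measure (Eu n)} (hb : Bornology.IsBounded Ω) (hf : σ (frontier Ω) ≠ ⊤)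
    {f : Eu n → ℝ} (h : ContinuousOn f (frontier Ω)) : IntegrableOn f (frontier Ω) σ := by
  have : IsFiniteMeasure (σ.restrict (frontier Ω)) := ⟨by simpa using lt_top_iff_ne_top.2 hf⟩
  have hc : IsCompact (frontier Ω) := hb.isCompact_closure.of_isClosed_subset isClosed_frontier frontier_subset_closure
  obtain ⟨A, hA⟩ := hc.exists_bound_of_continuousOn h
  refine Integrable.of_bound (h.aestronglyMeasurable isClosed_frontier.measurableSet) A ?_
  exact (ae_restrict_iff' isClosed_frontier.measurableSet).2 (Filter.Eventually.of_forall hA)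

lemma Sol.front {n : ℕ} {Ω : Set (Eu n)} {σ : Measure (Eu n)} {a : ℝ} {Y : Eu n} {u : Eu n → ℝ} (S : Sol Ω σ a Y u) :
    frontier Ω ⊆ closure Ω \ {Y} := fun x hx => ⟨frontier_subset_closure hx, fun h => by
      rw [mem_singleton_iff] at h
      rw [S.op.frontier_eq, h] at hx
      exact hx.2 S.hY⟩

lemma Sol.int_grad {n : ℕ} {Ω : Set (Eu n)} {σ : Measure (Eu n)} {a : ℝ} {Y : Eu n} {u : Eu n → ℝ} (S : Sol Ω σ a Y u)
    {φ : Eu n → ℝ} (hφ : ContDiff ℝ (⊤ : ℕ∞) φ) (hc : HasCompactSupport φ) :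
    IntegrableOn (fun x => ⟪gradient u x, gradient φ x⟫) Ω ∧ ∃ A, ∀ x, ‖gradient φ x‖ ≤ A := by
  obtain ⟨A, hA⟩ := (hc.fderiv ℝ).exists_bound_of_continuous (hφ.continuous_fderiv (by simp))
  refine ⟨?_, A, fun x => by rw [ngrad]; exact hA x⟩
  refine Integrable.mono' (S.l1.const_mul A) ((grad_meas u).inner (grad_meas φ)).aestronglyMeasurable ?_
  refine Filter.Eventually.of_forall fun x => (norm_inner_le_norm _ _).trans ?_
  rw [mul_comm, ngrad φ]
  exact mul_le_mul_of_nonneg_right (hA x) (norm_nonneg _)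

lemma wk_ext {n : ℕ} {Ω : Set (Eu n)} {σ : Measure (Eu n)} {a : ℝ} {Y : Eu n} {u : Eu n → ℝ} (S : Sol Ω σ a Y u)
    {θ C Λ : ℝ} {ck : Eu n → ℝ → Eu n} (G : Geo Ω θ C Λ ck)
    {w : Eu n → ℝ} (hw1 : ContDiffOn ℝ 1 w Ω) (hw : ContinuousOn w (closure Ω)) (hE : IntegrableOn (fun z => ‖gradient w z‖ ^ 2) Ω)
    {ρ : ℝ} (hρ : 0 < ρ) (hY : ∀ z ∈ Ω, dist z Y < ρ → w z = 0) :
    (∫ X in Ω, ⟪gradient u X, gradient w X⟫) + a * ∫ P in frontier Ω, u P * w P ∂σ = 0 := by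
  have hOm := S.op.measurableSet
  obtain ⟨B, hB⟩ := dens G hw1 hw (by rw [en_fin S.op hE]; exact ENNReal.ofReal_ne_top) hρ hY
  set B' := max B 0 with hB'
  have hB'0 : 0 ≤ B' := le_max_right _ _
  set Bw := ∫ z in Ω, ‖gradient w z‖ ^ 2 with hBw
  set Ω' := Ω \ ball Y (ρ / 2) with hΩ'
  have hΩ'm : MeasurableSet Ω' := hOm.diff measurableSet_ball
  have hl2 := S.l2 (ρ / 2) (by positivity)
  have huf := S.co.mono S.front
  have hbu : IntegrableOn u (frontier Ω) σ := bint S.bd S.fin huf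
  suffices H : ∀ e : ℝ, 0 < e → |(∫ X in Ω, ⟪gradient u X, gradient w X⟫) + a * ∫ P in frontier Ω, u P * w P ∂σ| ≤ e * (2 + B' + Bw) by
    have hp : 0 < 2 + B' + Bw := by
      have : 0 ≤ Bw := integral_nonneg fun z => by positivity
      positivity
    rw [← abs_eq_zero]
    refine le_antisymm (le_of_forall_pos_le_add fun e he => ?_) (abs_nonneg _)
    have := H (e / (2 + B' + Bw)) (by positivity)
    rw [div_mul_cancel₀ _ hp.ne'] at this
    linarith
  intro e he
  -- cutoff
  set μ := (volume.restrict Ω').withDensity (fun z => ENNReal.ofReal (‖gradient u z‖ ^ 2)) with hμ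
  have : IsFiniteMeasure μ := isFiniteMeasure_withDensity_ofReal hl2.2
  obtain ⟨K, hKΩ, hK, hKμ⟩ := hOm.exists_isCompact_sdiff_lt (μ := μ) (measure_ne_top _ _) (ε := ENNReal.ofReal (e ^ 2)) (by simp; positivity)
  obtain ⟨χ, hχs, hχc, hχΩ, hχ1, hχI⟩ := cutoff S.op hK hKΩ
  obtain ⟨hχi, A, hA⟩ := S.int_grad hχs hχc
  have hA0 : 0 ≤ A := (norm_nonneg _).trans (hA 0)
  have hm1 : Measurable (fun z => (1 - χ z) ^ 2 * ‖gradient u z‖ ^ 2) :=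
    ((measurable_const.sub hχs.continuous.measurable).pow_const 2).mul ((grad_meas u).norm.pow_const 2)
  have hχ01 : ∀ z, (1 - χ z) ^ 2 ≤ 1 ∧ |1 - χ z| ≤ 1 := fun z => by
    have := hχI z
    constructor
    · nlinarith [this.1, this.2]
    · rw [abs_le]; constructor <;> linarith [this.1, this.2]
  have hsm : IntegrableOn (fun z => (1 - χ z) ^ 2 * ‖gradient u z‖ ^ 2) Ω' ∧ ∫ z in Ω', (1 - χ z) ^ 2 * ‖gradient u z‖ ^ 2 ≤ e ^ 2 := by
    constructor
    · refine Integrable.mono' hl2 hm1.aestronglyMeasurable (Filter.Eventually.of_forall fun z => ?_)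
      rw [Real.norm_eq_abs, abs_of_nonneg (by positivity)]
      exact mul_le_of_le_one_left (by positivity) (hχ01 z).1
    · rw [integral_eq_lintegral_of_nonneg_ae (Filter.Eventually.of_forall fun z => by positivity) hm1.aestronglyMeasurable]
      apply ENNReal.toReal_le_of_le_ofReal (by positivity)
      refine le_trans ?_ hKμ.le
      rw [hμ, withDensity_apply _ (hOm.diff hK.measurableSet), ← lintegral_indicator (hOm.diff hK.measurableSet)]
      apply setLIntegral_mono' hΩ'm
      intro z hz
      by_cases hzK : z ∈ K
      · simp [hχ1 z hzK]
      · rw [indicator_of_mem (show z ∈ Ω \ K from ⟨hz.1, hzK⟩)]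
        exact ENNReal.ofReal_le_ofReal (mul_le_of_le_one_left (by positivity) (hχ01 z).1)
  set N := A * ∫ z in Ω, ‖gradient u z‖ with hN
  set Nb := a * ∫ P in frontier Ω, |u P| ∂σ with hNb
  have hNn : 0 ≤ N := mul_nonneg hA0 (integral_nonneg fun z => norm_nonneg _)
  have hNbn : 0 ≤ Nb := mul_nonneg S.ap.le (integral_nonneg fun z => abs_nonneg _)
  set ε := e / (N + Nb + 1) with hε
  have hεp : 0 < ε := by positivity
  obtain ⟨φ, hφs, hφc, hφw, hφY, hφB⟩ := hB ε hεp
  obtain ⟨hφ2, hφB2⟩ := en_int hB'0 (hφB.trans (ENNReal.ofReal_le_ofReal (le_max_left _ _)))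
  obtain ⟨hφi, A', hA'⟩ := S.int_grad hφs hφc
  have hφ1 : ContDiff ℝ 1 φ := hφs.of_le (by simp)
  have hχ1' : ContDiff ℝ 1 χ := hχs.of_le (by simp)
  have dw : ∀ z ∈ Ω, DifferentiableAt ℝ w z := fun z hz => (hw1.contDiffAt (S.op.mem_nhds hz)).differentiableAt (by norm_num)
  have dφ : ∀ z, DifferentiableAt ℝ φ z := fun z => hφ1.differentiable (by norm_num) z
  have dχ : ∀ z, DifferentiableAt ℝ χ z := fun z => hχ1'.differentiable (by norm_num) z
  set d : Eu n → ℝ := fun z => φ z - w z with hd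
  have hd1 : ContDiffOn ℝ 1 d Ω := hφ1.contDiffOn.sub hw1
  have dd : ∀ z ∈ Ω, DifferentiableAt ℝ d z := fun z hz => (dφ z).sub (dw z hz)
  have gd : ∀ z ∈ Ω, gradient d z = gradient φ z - gradient w z := fun z hz => grad_sub (dφ z) (dw z hz)
  have d0 : ∀ z ∈ Ω, dist z Y < ρ / 2 → d z = 0 := fun z hz h => by
    rw [hd]; simp only; rw [hφY z (subset_closure hz) h, hY z hz (by linarith), sub_zero]
  have gd0 : ∀ z ∈ Ω ∩ ball Y (ρ / 2), gradient d z = 0 := fun z hz => by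
    have : d =ᶠ[𝓝 z] fun _ => 0 := by
      filter_upwards [(S.op.inter isOpen_ball).mem_nhds hz] with y hy
      exact d0 y hy.1 (mem_ball.1 hy.2)
    rw [gradient, this.fderiv_eq]; simp
  have hd2m : Measurable (fun z => ‖gradient d z‖ ^ 2) := (grad_meas d).norm.pow_const 2
  have hd2 : IntegrableOn (fun z => ‖gradient d z‖ ^ 2) Ω ∧ ∫ z in Ω, ‖gradient d z‖ ^ 2 ≤ 2 * B' + 2 * Bw := by
    have hle : ∀ z ∈ Ω, ‖gradient d z‖ ^ 2 ≤ 2 * ‖gradient φ z‖ ^ 2 + 2 * ‖gradient w z‖ ^ 2 := fun z hz => by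
      rw [gd z hz]
      have := norm_sub_le (gradient φ z) (gradient w z)
      nlinarith [norm_nonneg (gradient φ z - gradient w z), sq_nonneg (‖gradient φ z‖ - ‖gradient w z‖), norm_nonneg (gradient φ z), norm_nonneg (gradient w z)]
    have hI : IntegrableOn (fun z => 2 * ‖gradient φ z‖ ^ 2 + 2 * ‖gradient w z‖ ^ 2) Ω := (hφ2.const_mul 2).add (hE.const_mul 2)
    have hi : IntegrableOn (fun z => ‖gradient d z‖ ^ 2) Ω := by
      refine Integrable.mono' hI hd2m.aestronglyMeasurable ((ae_restrict_iff' hOm).2 (Filter.Eventually.of_forall fun z hz => ?_))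
      rw [Real.norm_eq_abs, abs_of_nonneg (by positivity)]; exact hle z hz
    refine ⟨hi, (setIntegral_mono_on hi hI hOm hle).trans ?_⟩
    rw [integral_add (hφ2.const_mul 2) (hE.const_mul 2), integral_const_mul, integral_const_mul]
    linarith
  have him : Measurable (fun z => ⟪gradient u z, gradient d z⟫) := (grad_meas u).inner (grad_meas d)
  have hid : IntegrableOn (fun z => ⟪gradient u z, gradient d z⟫) Ω := by
    rw [← sdiff_union_inter Ω (ball Y (ρ / 2))]
    refine IntegrableOn.union ?_ ?_
    · refine Integrable.mono' (hl2.add (hd2.1.mono_set sdiff_subset)) him.aestronglyMeasurable (Filter.Eventually.of_forall fun z => ?_)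
      refine (norm_inner_le_norm _ _).trans ?_
      simp only [Pi.add_apply]
      nlinarith [sq_nonneg (‖gradient u z‖ - ‖gradient d z‖), norm_nonneg (gradient u z), norm_nonneg (gradient d z)]
    · refine integrableOn_zero.congr_fun (f := fun _ => (0:ℝ)) (fun z hz => ?_) (hOm.inter measurableSet_ball)
      simp only [gd0 z hz, inner_zero_right]
  -- decomposition
  have e1 : ∫ z in Ω, ⟪gradient u z, gradient w z⟫ = (∫ z in Ω, ⟪gradient u z, gradient φ z⟫) - ∫ z in Ω, ⟪gradient u z, gradient d z⟫ := by
    rw [← integral_sub hφi hid]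
    refine setIntegral_congr_fun hOm fun z hz => ?_
    simp only [gd z hz, inner_sub_right]; ring
  have i2 : IntegrableOn (fun z => (1 - χ z) * ⟪gradient u z, gradient d z⟫) Ω :=
    hid.bdd_mul (measurable_const.sub hχs.continuous.measurable).aestronglyMeasurable (Filter.Eventually.of_forall fun z => (hχ01 z).2)
  have i3 : IntegrableOn (fun z => d z * ⟪gradient u z, gradient χ z⟫) Ω :=
    hχi.bdd_mul (c := ε) (hd1.continuousOn.aestronglyMeasurable hOm) ((ae_restrict_iff' hOm).2 (Filter.Eventually.of_forall fun z hz => hφw z (subset_closure hz)))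
  have e2 : ∫ z in Ω, ⟪gradient u z, gradient d z⟫ = (∫ z in Ω, (1 - χ z) * ⟪gradient u z, gradient d z⟫) - ∫ z in Ω, d z * ⟪gradient u z, gradient χ z⟫ := by
    have hp := C1_mul S.op hd1 hχ1' hχΩ
    have hts : tsupport (fun x => d x * χ x) ⊆ tsupport χ := tsupport_mul_subset_right
    have hYs : Y ∉ tsupport (fun x => d x * χ x) := by
      rw [notMem_tsupport_iff_eventuallyEq]
      filter_upwards [(S.op.inter isOpen_ball).mem_nhds ⟨S.hY, mem_ball_self (by positivity : 0 < ρ / 2)⟩] with y hy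
      simp [d0 y hy.1 (mem_ball.1 hy.2)]
    have h0 := ibp0 (S.op.sdiff isClosed_singleton) S.ha hp hχc.mul_left (fun x hx => ⟨hχΩ (hts hx), fun h => hYs (h ▸ hx)⟩)
    rw [← setIntegral_eq_integral_of_forall_compl_eq_zero (s := Ω)] at h0
    · have h1 : ∫ z in Ω, ⟪gradient u z, gradient (fun x => d x * χ x) z⟫ = ∫ z in Ω, (d z * ⟪gradient u z, gradient χ z⟫ + (⟪gradient u z, gradient d z⟫ - (1 - χ z) * ⟪gradient u z, gradient d z⟫)) := by
        refine setIntegral_congr_fun hOm fun z hz => ?_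
        simp only [grad_mul (dd z hz) (dχ z), inner_add_right, inner_smul_right]; ring
      have i4 : IntegrableOn (fun z => ⟪gradient u z, gradient d z⟫ - (1 - χ z) * ⟪gradient u z, gradient d z⟫) Ω := hid.sub i2
      rw [h1, integral_add i3 i4, integral_sub hid i2] at h0
      linarith
    · intro x hx
      have : gradient (fun x => d x * χ x) x = 0 := by
        rw [gradient, fderiv_of_notMem_tsupport (𝕜 := ℝ) (fun h => hx (hχΩ (hts h)))]; simp
      rw [this, inner_zero_right]
  have b3 : |∫ z in Ω, d z * ⟪gradient u z, gradient χ z⟫| ≤ ε * N := by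
    rw [← Real.norm_eq_abs, hN, ← integral_const_mul, ← integral_const_mul]
    refine norm_integral_le_of_norm_le ((S.l1.const_mul A).const_mul ε) ((ae_restrict_iff' hOm).2 (Filter.Eventually.of_forall fun z hz => ?_))
    rw [norm_mul]
    refine mul_le_mul (hφw z (subset_closure hz)) ((norm_inner_le_norm _ _).trans ?_) (norm_nonneg _) hεp.le
    rw [mul_comm]; exact mul_le_mul_of_nonneg_right (hA z) (norm_nonneg _)
  have b2 : |∫ z in Ω, (1 - χ z) * ⟪gradient u z, gradient d z⟫| ≤ e / 2 + e / 2 * (2 * B' + 2 * Bw) := by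
    have h1 : ∫ z in Ω, (1 - χ z) * ⟪gradient u z, gradient d z⟫ = ∫ z in Ω', (1 - χ z) * ⟪gradient u z, gradient d z⟫ := by
      apply setIntegral_eq_of_subset_of_forall_sdiff_eq_zero hOm sdiff_subset
      intro z hz
      rw [gd0 z ⟨hz.1, by_contra fun h => hz.2 ⟨hz.1, h⟩⟩, inner_zero_right, mul_zero]
    rw [h1, ← Real.norm_eq_abs]
    have hd2' := hd2.1.mono_set (sdiff_subset : Ω' ⊆ Ω)
    calc _ ≤ ∫ z in Ω', (1 / (2 * e) * ((1 - χ z) ^ 2 * ‖gradient u z‖ ^ 2) + e / 2 * ‖gradient d z‖ ^ 2) := by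
          refine norm_integral_le_of_norm_le ((hsm.1.const_mul _).add (hd2'.const_mul _)) (Filter.Eventually.of_forall fun z => ?_)
          rw [norm_mul]
          have hin : ‖(⟪gradient u z, gradient d z⟫ : ℝ)‖ ≤ ‖gradient u z‖ * ‖gradient d z‖ := norm_inner_le_norm _ _
          rw [Real.norm_eq_abs (1 - χ z), ← sq_abs (1 - χ z)]
          refine (mul_le_mul_of_nonneg_left hin (abs_nonneg _)).trans ?_
          set p := |1 - χ z|
          set q := ‖gradient u z‖
          set r := ‖gradient d z‖
          have : 1 / (2 * e) * (p ^ 2 * q ^ 2) + e / 2 * r ^ 2 - p * (q * r) = 1 / (2 * e) * (p * q - e * r) ^ 2 := by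
            field_simp; ring
          have h0 : 0 ≤ 1 / (2 * e) * (p * q - e * r) ^ 2 := by positivity
          linarith
      _ = 1 / (2 * e) * (∫ z in Ω', (1 - χ z) ^ 2 * ‖gradient u z‖ ^ 2) + e / 2 * ∫ z in Ω', ‖gradient d z‖ ^ 2 := by
          rw [integral_add (hsm.1.const_mul _) (hd2'.const_mul _), integral_const_mul, integral_const_mul]
      _ ≤ 1 / (2 * e) * e ^ 2 + e / 2 * (2 * B' + 2 * Bw) := by
          have : ∫ z in Ω', ‖gradient d z‖ ^ 2 ≤ ∫ z in Ω, ‖gradient d z‖ ^ 2 :=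
            setIntegral_mono_set hd2.1 (Filter.Eventually.of_forall fun z => by positivity) (Filter.Eventually.of_forall sdiff_subset)
          gcongr
          · exact hsm.2
          · exact this.trans hd2.2
      _ = _ := by field_simp
  have hφf : ContinuousOn φ (frontier Ω) := hφs.continuous.continuousOn
  have hwf : ContinuousOn w (frontier Ω) := hw.mono frontier_subset_closure
  have e3 : ∫ P in frontier Ω, u P * w P ∂σ = (∫ P in frontier Ω, u P * φ P ∂σ) - ∫ P in frontier Ω, u P * d P ∂σ := by
    have j1 : IntegrableOn (fun P => u P * φ P) (frontier Ω) σ := bint S.bd S.fin (huf.mul hφf)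
    have j2 : IntegrableOn (fun P => u P * d P) (frontier Ω) σ := bint S.bd S.fin (huf.mul (hφf.sub hwf))
    rw [← integral_sub j1 j2]
    congr 1; ext z; simp only [hd]; ring
  have b4 : |a * ∫ P in frontier Ω, u P * d P ∂σ| ≤ ε * Nb := by
    rw [abs_mul, abs_of_pos S.ap, hNb, ← mul_assoc, mul_comm ε a, mul_assoc, ← integral_const_mul]
    refine mul_le_mul_of_nonneg_left ?_ S.ap.le
    rw [← Real.norm_eq_abs]
    refine norm_integral_le_of_norm_le (hbu.abs.const_mul ε) ((ae_restrict_iff' isClosed_frontier.measurableSet).2 (Filter.Eventually.of_forall fun z hz => ?_))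
    rw [norm_mul, mul_comm, Real.norm_eq_abs (u z)]
    exact mul_le_mul_of_nonneg_right (hφw z (frontier_subset_closure hz)) (abs_nonneg _)
  have hwk := S.wk φ hφs hφc
  rw [hφY Y (subset_closure S.hY) (by simpa using (by positivity : 0 < ρ / 2))] at hwk
  have hfin : (∫ X in Ω, ⟪gradient u X, gradient w X⟫) + a * ∫ P in frontier Ω, u P * w P ∂σ =
      (∫ z in Ω, d z * ⟪gradient u z, gradient χ z⟫) - (∫ z in Ω, (1 - χ z) * ⟪gradient u z, gradient d z⟫) - a * ∫ P in frontier Ω, u P * d P ∂σ := by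
    rw [e1, e3, e2, mul_sub]; linarith
  rw [hfin]
  have hεe : ε * N + ε * Nb ≤ e := by
    rw [hε, ← mul_add, div_mul_eq_mul_div, div_le_iff₀ (by positivity)]
    nlinarith
  have t1 := abs_sub ((∫ z in Ω, d z * ⟪gradient u z, gradient χ z⟫) - (∫ z in Ω, (1 - χ z) * ⟪gradient u z, gradient d z⟫)) (a * ∫ P in frontier Ω, u P * d P ∂σ)
  have t2 := abs_sub (∫ z in Ω, d z * ⟪gradient u z, gradient χ z⟫) (∫ z in Ω, (1 - χ z) * ⟪gradient u z, gradient d z⟫)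
  nlinarith

end RG

namespace RG

lemma Sol.bdd {n : ℕ} {Ω : Set (Eu n)} {σ : Measure (Eu n)} {a : ℝ} {Y : Eu n} {u : Eu n → ℝ} (S : Sol Ω σ a Y u)
    {ρ : ℝ} (hρ : 0 < ρ) : ∃ A, 0 < A ∧ ∀ z ∈ closure Ω \ ball Y ρ, u z ∈ Icc 0 A := by
  have hc : IsCompact (closure Ω \ ball Y ρ) := S.bd.isCompact_closure.diff isOpen_ball
  have hs : closure Ω \ ball Y ρ ⊆ closure Ω \ {Y} := sdiff_subset_sdiff_right (by
    rw [singleton_subset_iff]; exact mem_ball_self hρ)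
  obtain ⟨A, hA⟩ := hc.exists_bound_of_continuousOn (S.co.mono hs)
  exact ⟨max A 1, by positivity, fun z hz => ⟨S.nn z (hs hz), (le_abs_self _).trans ((hA z hz).trans (le_max_left _ _))⟩⟩

lemma Sol.u1 {n : ℕ} {Ω : Set (Eu n)} {σ : Measure (Eu n)} {a : ℝ} {Y : Eu n} {u : Eu n → ℝ} (S : Sol Ω σ a Y u)
    {z : Eu n} (hz : z ∈ Ω) (hzY : z ≠ Y) : ContDiffAt ℝ 1 u z :=
  (S.ha z ⟨hz, hzY⟩).1.of_le (by norm_num)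

lemma Sol.test {n : ℕ} {Ω : Set (Eu n)} {σ : Measure (Eu n)} {a : ℝ} {Y : Eu n} {u : Eu n → ℝ} (S : Sol Ω σ a Y u)
    {ξ : Eu n → ℝ} (hξ : ContDiff ℝ 1 ξ) {ρ : ℝ} (hρ : 0 < ρ) (hξ0 : ∀ z ∈ ball Y ρ, ξ z = 0)
    {Φ : ℝ → ℝ} (hΦ : ∀ t, 0 ≤ t → ContDiffAt ℝ 1 Φ t) :
    ContDiffOn ℝ 1 (fun z => ξ z * Φ (u z)) Ω ∧ ContinuousOn (fun z => ξ z * Φ (u z)) (closure Ω) ∧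
    (∀ z ∈ Ω, gradient (fun z => ξ z * Φ (u z)) z = Φ (u z) • gradient ξ z + (ξ z * deriv Φ (u z)) • gradient u z) ∧
    IntegrableOn (fun z => ‖gradient (fun z => ξ z * Φ (u z)) z‖ ^ 2) Ω ∧
    IntegrableOn (fun z => ξ z * deriv Φ (u z) * ‖gradient u z‖ ^ 2) Ω ∧
    IntegrableOn (fun z => Φ (u z) * ⟪gradient u z, gradient ξ z⟫) Ω := by
  have hOm := S.op.measurableSet
  have hz0 : ∀ z ∈ ball Y ρ, (fun z => ξ z * Φ (u z)) =ᶠ[𝓝 z] fun _ => 0 := fun z hz => by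
    filter_upwards [isOpen_ball.mem_nhds hz] with y hy
    simp [hξ0 y hy]
  have hg0 : ∀ z ∈ ball Y ρ, gradient ξ z = 0 := fun z hz => by
    have : ξ =ᶠ[𝓝 z] fun _ => 0 := by
      filter_upwards [isOpen_ball.mem_nhds hz] with y hy
      exact hξ0 y hy
    rw [gradient, this.fderiv_eq]; simp
  have hG0 : ∀ z ∈ ball Y ρ, gradient (fun z => ξ z * Φ (u z)) z = 0 := fun z hz => by
    rw [gradient, (hz0 z hz).fderiv_eq]; simp
  have hgr : ∀ z ∈ Ω, gradient (fun z => ξ z * Φ (u z)) z = Φ (u z) • gradient ξ z + (ξ z * deriv Φ (u z)) • gradient u z := by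
    intro z hz
    by_cases hzb : z ∈ ball Y ρ
    · rw [hG0 z hzb, hg0 z hzb, hξ0 z hzb]; simp
    · have hzY : z ≠ Y := fun h => hzb (h ▸ mem_ball_self hρ)
      have hu := (S.u1 hz hzY).differentiableAt (by norm_num)
      have hd := (hΦ _ (S.nn z ⟨subset_closure hz, hzY⟩)).differentiableAt (by norm_num)
      have h1 : DifferentiableAt ℝ (fun z => Φ (u z)) z := hd.comp z hu
      rw [grad_mul (hξ.differentiable (by norm_num) z) h1, grad_comp hu hd.hasDerivAt, smul_smul, add_comm]
  obtain ⟨A, hA, hAu⟩ := S.bdd hρ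
  have hdc : ContinuousOn (deriv Φ) (Icc 0 A) := fun t ht => by
    have h1 := ((hΦ t ht.1).fderiv_right (m := 0) (by norm_num)).continuousAt
    have : ContinuousAt (fun t => fderiv ℝ Φ t 1) t := h1.clm_apply continuousAt_const
    simpa using this.continuousWithinAt
  obtain ⟨B1, hB1⟩ := isCompact_Icc.exists_bound_of_continuousOn hdc
  obtain ⟨B0, hB0⟩ := isCompact_Icc.exists_bound_of_continuousOn (fun t (ht : t ∈ Icc 0 A) => (hΦ t ht.1).continuousAt.continuousWithinAt)
  obtain ⟨B2, hB2⟩ := S.bd.isCompact_closure.exists_bound_of_continuousOn hξ.continuous.continuousOn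
  obtain ⟨B3, hB3⟩ := S.bd.isCompact_closure.exists_bound_of_continuousOn (hξ.continuous_fderiv (by norm_num)).continuousOn
  have hl2 := S.l2 ρ hρ
  have hfi : volume (Ω \ ball Y ρ) ≠ ⊤ := (S.bd.subset sdiff_subset).measure_lt_top.ne
  have hco : ContinuousOn (fun z => Φ (u z)) (Ω \ {Y}) := fun z hz =>
    ((hΦ _ (S.nn z ⟨subset_closure hz.1, hz.2⟩)).continuousAt.comp (S.u1 hz.1 hz.2).continuousAt).continuousWithinAt
  have hdco : ContinuousOn (fun z => deriv Φ (u z)) (Ω \ {Y}) := fun z hz => by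
    have h1 := ((hΦ _ (S.nn z ⟨subset_closure hz.1, hz.2⟩)).fderiv_right (m := 0) (by norm_num)).continuousAt
    have h2 : ContinuousAt (fun t => fderiv ℝ Φ t 1) (u z) := h1.clm_apply continuousAt_const
    have h3 : ContinuousAt (deriv Φ) (u z) := by simpa using h2
    exact (h3.comp (S.u1 hz.1 hz.2).continuousAt).continuousWithinAt
  have hsub : Ω \ ball Y ρ ⊆ Ω \ {Y} := sdiff_subset_sdiff_right (by
    rw [singleton_subset_iff]; exact mem_ball_self hρ)
  have hmm : MeasurableSet (Ω \ ball Y ρ) := hOm.diff measurableSet_ball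
  have hspl : ∀ f : Eu n → ℝ, (∀ z ∈ ball Y ρ, f z = 0) → IntegrableOn f (Ω \ ball Y ρ) → IntegrableOn f Ω := by
    intro f h0 h1
    rw [← sdiff_union_inter Ω (ball Y ρ)]
    exact h1.union (integrableOn_zero.congr_fun (f := fun _ => (0:ℝ)) (fun z hz => (h0 z hz.2).symm) (hOm.inter measurableSet_ball))
  refine ⟨?_, ?_, hgr, ?_, ?_, ?_⟩
  · intro z hz
    by_cases hzb : z ∈ ball Y ρ
    · exact ((contDiffAt_const (c := (0:ℝ))).congr_of_eventuallyEq (hz0 z hzb)).contDiffWithinAt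
    · have hzY : z ≠ Y := fun h => hzb (h ▸ mem_ball_self hρ)
      exact (hξ.contDiffAt.mul ((hΦ _ (S.nn z ⟨subset_closure hz, hzY⟩)).comp z (S.u1 hz hzY))).contDiffWithinAt
  · intro z hz
    by_cases hzb : z ∈ ball Y ρ
    · exact ((continuousAt_const (y := (0:ℝ))).congr (hz0 z hzb).symm).continuousWithinAt
    · have hzY : z ≠ Y := fun h => hzb (h ▸ mem_ball_self hρ)
      have h1 : ContinuousWithinAt u (closure Ω) z := by
        have := S.co z ⟨hz, hzY⟩
        refine this.mono_of_mem_nhdsWithin ?_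
        exact Filter.inter_mem self_mem_nhdsWithin (mem_nhdsWithin_of_mem_nhds (isOpen_compl_singleton.mem_nhds hzY))
      exact hξ.continuous.continuousWithinAt.mul ((hΦ _ (S.nn z ⟨hz, hzY⟩)).continuousAt.comp_continuousWithinAt h1)
  · refine hspl _ (fun z hz => by rw [hG0 z hz]; simp) ?_
    have hI : IntegrableOn (fun z => 2 * (B0 * B3) ^ 2 + 2 * (B2 * B1) ^ 2 * ‖gradient u z‖ ^ 2) (Ω \ ball Y ρ) :=
      (integrableOn_const hfi).add (hl2.const_mul _)
    refine Integrable.mono' hI ((grad_meas _).norm.pow_const 2).aestronglyMeasurable ((ae_restrict_iff' hmm).2 (Filter.Eventually.of_forall fun z hz => ?_))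
    rw [hgr z hz.1, Real.norm_eq_abs, abs_of_nonneg (by positivity)]
    have hcl : z ∈ closure Ω := subset_closure hz.1
    have h1 : ‖Φ (u z) • gradient ξ z‖ ≤ B0 * B3 := by
      rw [norm_smul, ngrad]
      exact mul_le_mul (hB0 _ (hAu z ⟨hcl, hz.2⟩)) (hB3 z hcl) (norm_nonneg _) ((norm_nonneg _).trans (hB0 _ (hAu z ⟨hcl, hz.2⟩)))
    have h2 : ‖(ξ z * deriv Φ (u z)) • gradient u z‖ ≤ B2 * B1 * ‖gradient u z‖ := by
      rw [norm_smul, norm_mul]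
      refine mul_le_mul_of_nonneg_right ?_ (norm_nonneg _)
      exact mul_le_mul (hB2 z hcl) (hB1 _ (hAu z ⟨hcl, hz.2⟩)) (norm_nonneg _) ((norm_nonneg _).trans (hB2 z hcl))
    have h3 := (norm_add_le (Φ (u z) • gradient ξ z) ((ξ z * deriv Φ (u z)) • gradient u z)).trans (add_le_add h1 h2)
    have h4 := pow_le_pow_left₀ (norm_nonneg _) h3 2
    refine h4.trans ?_
    nlinarith [sq_nonneg (B0 * B3 - B2 * B1 * ‖gradient u z‖)]
  · refine hspl _ (fun z hz => by rw [hξ0 z hz]; simp) ?_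
    refine hl2.bdd_mul (c := B2 * B1) ((hξ.continuous.continuousOn.mul (hdco.mono hsub)).aestronglyMeasurable hmm) ((ae_restrict_iff' hmm).2 (Filter.Eventually.of_forall fun z hz => ?_))
    have hcl : z ∈ closure Ω := subset_closure hz.1
    rw [norm_mul]
    exact mul_le_mul (hB2 z hcl) (hB1 _ (hAu z ⟨hcl, hz.2⟩)) (norm_nonneg _) ((norm_nonneg _).trans (hB2 z hcl))
  · refine hspl _ (fun z hz => by rw [hg0 z hz]; simp) ?_
    have hi : IntegrableOn (fun z => ⟪gradient u z, gradient ξ z⟫) (Ω \ ball Y ρ) := by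
      refine Integrable.mono' ((S.l1.mono_set (sdiff_subset : Ω \ ball Y ρ ⊆ Ω)).mul_const B3) ((grad_meas u).inner (grad_meas ξ)).aestronglyMeasurable ((ae_restrict_iff' hmm).2 (Filter.Eventually.of_forall fun z hz => ?_))
      refine (norm_inner_le_norm _ _).trans (mul_le_mul_of_nonneg_left ?_ (norm_nonneg _))
      rw [ngrad]; exact hB3 z (subset_closure hz.1)
    refine hi.bdd_mul (c := B0) ((hco.mono hsub).aestronglyMeasurable hmm) ((ae_restrict_iff' hmm).2 (Filter.Eventually.of_forall fun z hz => ?_))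
    exact hB0 _ (hAu z ⟨subset_closure hz.1, hz.2⟩)

/-- The basic (sub)solution inequality. -/
lemma Sol.sub {n : ℕ} {Ω : Set (Eu n)} {σ : Measure (Eu n)} {a : ℝ} {Y : Eu n} {u : Eu n → ℝ} (S : Sol Ω σ a Y u)
    {θ C Λ : ℝ} {ck : Eu n → ℝ → Eu n} (G : Geo Ω θ C Λ ck)
    {ξ : Eu n → ℝ} (hξ : ContDiff ℝ 1 ξ) {ρ : ℝ} (hρ : 0 < ρ) (hξ0 : ∀ z ∈ ball Y ρ, ξ z = 0) (hξn : ∀ z, 0 ≤ ξ z)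
    {Φ : ℝ → ℝ} (hΦ : ∀ t, 0 ≤ t → ContDiffAt ℝ 1 Φ t) (hΦn : ∀ t, 0 ≤ t → 0 ≤ Φ t) :
    ∫ z in Ω, ξ z * deriv Φ (u z) * ‖gradient u z‖ ^ 2 ≤ - ∫ z in Ω, Φ (u z) * ⟪gradient u z, gradient ξ z⟫ := by
  obtain ⟨t1, t2, t3, t4, t5, t6⟩ := S.test hξ hρ hξ0 hΦ
  have h := wk_ext S G t1 t2 t4 hρ (fun z _ hz => by rw [hξ0 z (mem_ball.2 hz), zero_mul])
  have h1 : ∫ X in Ω, ⟪gradient u X, gradient (fun z => ξ z * Φ (u z)) X⟫ = ∫ z in Ω, (Φ (u z) * ⟪gradient u z, gradient ξ z⟫ + ξ z * deriv Φ (u z) * ‖gradient u z‖ ^ 2) := by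
    refine setIntegral_congr_fun S.op.measurableSet fun z hz => ?_
    simp only [t3 z hz, inner_add_right, inner_smul_right, real_inner_self_eq_norm_sq]
  rw [h1, integral_add t6 t5] at h
  have h2 : 0 ≤ a * ∫ P in frontier Ω, u P * (ξ P * Φ (u P)) ∂σ := by
    refine mul_nonneg S.ap.le (setIntegral_nonneg isClosed_frontier.measurableSet fun P hP => ?_)
    have := S.nn P (S.front hP)
    exact mul_nonneg this (mul_nonneg (hξn P) (hΦn _ this))
  linarith

end RG

namespace RG

lemma auxfn {γ : ℝ} (h0 : 0 < γ) (h1 : γ < 1) {N : ℝ} (hN : 1 ≤ N) : ∃ v h : ℝ → ℝ, 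
    (∀ x, 1 ≤ x → ContDiffAt ℝ 1 v x ∧ ContDiffAt ℝ 1 h x ∧ HasDerivAt (fun t => v t ^ 2) (h x) x ∧ 0 ≤ v x ∧ v x ^ 2 ≤ N ∧ v x ≤ x ∧
      (x ≤ N → x ^ γ ≤ 2 * v x ^ 2) ∧ 0 ≤ h x ∧ h x ≤ h 1 ∧ (deriv v x) ^ 2 ≤ 1 / (4 * (1 - γ)) * (- deriv h x)) ∧ h 1 ≤ 1 := by
  have hN0 : 0 < N := by linarith
  set q : ℝ → ℝ := fun x => x * N / (N + x) with hq
  set q' : ℝ → ℝ := fun x => N ^ 2 / (N + x) ^ 2 with hq'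
  have qp : ∀ x, 1 ≤ x → 0 < q x := fun x hx => by simp only [hq]; positivity
  have q'p : ∀ x, 1 ≤ x → 0 < q' x := fun x hx => by simp only [hq']; positivity
  have dq : ∀ x, 1 ≤ x → HasDerivAt q (q' x) x := fun x hx => by
    have hne : N + x ≠ 0 := by positivity
    have := ((hasDerivAt_id x).mul_const N).div ((hasDerivAt_id x).const_add N) hne
    refine HasDerivAt.congr_deriv this ?_
    simp only [hq', id]
    field_simp; ring
  have dq' : ∀ x, 1 ≤ x → HasDerivAt q' (-(2 * N ^ 2 / (N + x) ^ 3)) x := fun x hx => by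
    have hne : N + x ≠ 0 := by positivity
    have := (hasDerivAt_const x (N ^ 2)).div (((hasDerivAt_id x).const_add N).pow 2) (pow_ne_zero 2 hne)
    refine HasDerivAt.congr_deriv this ?_
    simp
    field_simp
  have cq : ∀ x, 1 ≤ x → ContDiffAt ℝ 1 q x := fun x hx => by
    have hne : N + x ≠ 0 := by positivity
    exact (contDiffAt_id.mul contDiffAt_const).div (contDiffAt_const.add contDiffAt_id) hne
  have cq' : ∀ x, 1 ≤ x → ContDiffAt ℝ 1 q' x := fun x hx => by
    have hne : N + x ≠ 0 := by positivity
    exact contDiffAt_const.div ((contDiffAt_const.add contDiffAt_id).pow 2) (pow_ne_zero 2 hne)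
  have qmono : ∀ x, 1 ≤ x → q 1 ≤ q x := fun x hx => by
    simp only [hq]; rw [div_le_div_iff₀ (by positivity) (by positivity)]
    nlinarith [mul_nonneg (mul_nonneg hN0.le hN0.le) (sub_nonneg.2 hx)]
  have qleN : ∀ x, 1 ≤ x → q x ≤ N := fun x hx => by
    simp only [hq]; rw [div_le_iff₀ (by positivity)]; nlinarith
  have qlex : ∀ x, 1 ≤ x → q x ≤ x := fun x hx => by
    simp only [hq]; rw [div_le_iff₀ (by positivity)]; nlinarith
  have vsq : ∀ x, 1 ≤ x → (q x ^ (γ / 2)) ^ 2 = q x ^ γ := fun x hx => by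
    rw [← Real.rpow_natCast, ← Real.rpow_mul (qp x hx).le]; congr 1; push_cast; ring
  refine ⟨fun x => q x ^ (γ / 2), fun x => γ * q x ^ (γ - 1) * q' x, fun x hx => ?_, ?_⟩
  · have hqx := qp x hx
    have hq'x := q'p x hx
    have dv : HasDerivAt (fun x => q x ^ (γ / 2)) (q' x * (γ / 2) * q x ^ (γ / 2 - 1)) x := (dq x hx).rpow_const (Or.inl hqx.ne')
    have dp : HasDerivAt (fun x => q x ^ (γ - 1)) (q' x * (γ - 1) * q x ^ (γ - 1 - 1)) x := (dq x hx).rpow_const (Or.inl hqx.ne')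
    have dh := (dp.const_mul γ).mul (dq' x hx)
    refine ⟨(cq x hx).rpow_const_of_ne hqx.ne', (contDiffAt_const.mul ((cq x hx).rpow_const_of_ne hqx.ne')).mul (cq' x hx), ?_, by positivity, ?_, ?_, ?_, by positivity, ?_, ?_⟩
    · have := dv.pow 2
      refine HasDerivAt.congr_deriv this ?_
      have e : q x ^ (γ - 1) = q x ^ (γ / 2) * q x ^ (γ / 2 - 1) := by
        rw [← Real.rpow_add hqx]; congr 1; ring
      simp only; rw [e]; push_cast; ring
    · simp only; rw [vsq x hx]
      calc q x ^ γ ≤ N ^ γ := Real.rpow_le_rpow hqx.le (qleN x hx) h0.le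
        _ ≤ N ^ (1:ℝ) := Real.rpow_le_rpow_of_exponent_le hN h1.le
        _ = N := Real.rpow_one N
    · calc q x ^ (γ / 2) ≤ x ^ (γ / 2) := Real.rpow_le_rpow hqx.le (qlex x hx) (by linarith)
        _ ≤ x ^ (1:ℝ) := Real.rpow_le_rpow_of_exponent_le hx (by linarith)
        _ = x := Real.rpow_one x
    · intro hxN
      simp only; rw [vsq x hx]
      have hh : x ≤ 2 * q x := by
        simp only [hq]; rw [mul_div_assoc', le_div_iff₀ (by positivity)]; nlinarith
      calc x ^ γ ≤ (2 * q x) ^ γ := Real.rpow_le_rpow (by linarith) hh h0.le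
        _ = 2 ^ γ * q x ^ γ := Real.mul_rpow (by norm_num) hqx.le
        _ ≤ 2 ^ (1:ℝ) * q x ^ γ := by gcongr; norm_num
        _ = _ := by rw [Real.rpow_one]
    · simp only
      have a1 : q x ^ (γ - 1) ≤ q 1 ^ (γ - 1) := Real.rpow_le_rpow_of_nonpos (qp 1 le_rfl) (qmono x hx) (by linarith)
      have a2 : q' x ≤ q' 1 := by simp only [hq']; gcongr
      have := qp 1 le_rfl
      have := q'p 1 le_rfl
      gcongr
    · have e1 : deriv (fun x => γ * q x ^ (γ - 1) * q' x) x = _ := dh.deriv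
      rw [dv.deriv, e1]
      have e : (q x ^ (γ / 2 - 1)) ^ 2 = q x ^ (γ - 1 - 1) := by
        rw [← Real.rpow_natCast, ← Real.rpow_mul hqx.le]; congr 1; push_cast; ring
      have p1 : 0 < q x ^ (γ - 1 - 1) := by positivity
      have p2 : 0 ≤ γ * q x ^ (γ - 1) * (2 * N ^ 2 / (N + x) ^ 3) := by positivity
      rw [mul_pow, mul_pow, e, div_mul_eq_mul_div, le_div_iff₀ (by linarith)]
      have : q' x ^ 2 * (γ / 2) ^ 2 * q x ^ (γ - 1 - 1) * (4 * (1 - γ)) ≤ γ * (1 - γ) * q x ^ (γ - 1 - 1) * q' x ^ 2 := by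
        have p3 : 0 ≤ γ * (1 - γ) * q x ^ (γ - 1 - 1) * q' x ^ 2 := by
          have : 0 < 1 - γ := by linarith
          positivity
        nlinarith
      nlinarith
  · simp only
    have e : q' 1 = q 1 ^ (2:ℝ) := by rw [Real.rpow_two]; simp only [hq, hq']; field_simp
    rw [e, mul_assoc, ← Real.rpow_add (qp 1 le_rfl)]
    have : q 1 ^ (γ - 1 + 2) ≤ 1 := Real.rpow_le_one (qp 1 le_rfl).le (qlex 1 le_rfl) (by linarith)
    have : 0 ≤ q 1 ^ (γ - 1 + 2) := Real.rpow_nonneg (qp 1 le_rfl).le _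
    nlinarith

lemma fd_scale {n : ℕ} {f : Eu n → ℝ} (hf : Differentiable ℝ f) (Y : Eu n) (t : ℝ) (z : Eu n) :
    fderiv ℝ (fun z => f (t • (z - Y))) z = t • fderiv ℝ f (t • (z - Y)) := by
  have h1 : HasFDerivAt (fun z : Eu n => t • (z - Y)) (t • ContinuousLinearMap.id ℝ (Eu n)) z :=
    ((hasFDerivAt_id z).sub_const Y).const_smul t
  have := ((hf (t • (z - Y))).hasFDerivAt.comp z h1).fderiv
  have e : (f ∘ fun z : Eu n => t • (z - Y)) = fun z => f (t • (z - Y)) := rfl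
  rw [← e, this]; ext w; simp

lemma eta (n : ℕ) : ∃ K, 0 < K ∧ ∀ (Y : Eu n) (ε : ℝ), 0 < ε → ∃ η : Eu n → ℝ, ContDiff ℝ (⊤ : ℕ∞) η ∧
    tsupport η ⊆ closedBall Y (2 * ε) ∧ (∀ z ∈ ball Y ε, η z = 1) ∧ (∀ z, η z ∈ Icc (0:ℝ) 1) ∧
    (∀ z, ‖fderiv ℝ η z‖ ≤ K / ε) ∧ 
    (∀ z, |∑ i : Fin n, fderiv ℝ (fun x => fderiv ℝ η x (EuclideanSpace.single i 1)) z (EuclideanSpace.single i 1)| ≤ K / ε ^ 2) := by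
  let ψ : ContDiffBump (0 : Eu n) := ⟨1, 2, by norm_num, by norm_num⟩
  have hψ : ContDiff ℝ (⊤ : ℕ∞) (ψ : Eu n → ℝ) := ψ.contDiff
  have hψd : Differentiable ℝ (ψ : Eu n → ℝ) := hψ.differentiable (by simp)
  have hfd : ∀ w, ContDiff ℝ 1 (fun x => fderiv ℝ (ψ : Eu n → ℝ) x w) := fun w => 
    (hψ.fderiv_right (m := 1) (by norm_cast)).clm_apply contDiff_const
  obtain ⟨A, hA⟩ := (ψ.hasCompactSupport.fderiv ℝ).exists_bound_of_continuous (hψ.continuous_fderiv (by simp))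
  set L : Eu n → ℝ := fun z => ∑ i : Fin n, fderiv ℝ (fun x => fderiv ℝ (ψ : Eu n → ℝ) x (EuclideanSpace.single i 1)) z (EuclideanSpace.single i 1) with hL
  have hLc : Continuous L := continuous_finsetSum _ fun i _ => ((hfd _).continuous_fderiv (by norm_num)).clm_apply continuous_const
  have hLs : ∀ z, z ∉ tsupport (ψ : Eu n → ℝ) → L z = 0 := fun z hz => by
    refine Finset.sum_eq_zero fun i _ => ?_
    rw [fderiv_of_notMem_tsupport (𝕜 := ℝ) (fun h => hz (tsupport_fderiv_apply_subset ℝ _ h))]; simp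
  obtain ⟨B, hB⟩ := (show IsCompact (tsupport (ψ : Eu n → ℝ)) from ψ.hasCompactSupport).exists_bound_of_continuousOn hLc.continuousOn
  refine ⟨max (max A B) 1, by positivity, fun Y ε hε => ⟨fun z => ψ (ε⁻¹ • (z - Y)), ?_, ?_, ?_, ?_, ?_, ?_⟩⟩
  · exact hψ.comp ((contDiff_id.sub contDiff_const).const_smul _)
  · refine closure_minimal (fun z hz => ?_) isClosed_closedBall
    have h1 : ε⁻¹ • (z - Y) ∈ Function.support (ψ : Eu n → ℝ) := hz
    rw [ψ.support_eq, mem_ball_zero_iff, norm_smul, norm_inv, Real.norm_of_nonneg hε.le, inv_mul_lt_iff₀ hε] at h1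
    rw [mem_closedBall, dist_eq_norm]; linarith
  · intro z hz
    apply ψ.one_of_mem_closedBall
    rw [mem_closedBall_zero_iff, norm_smul, norm_inv, Real.norm_of_nonneg hε.le, inv_mul_le_iff₀ hε]
    rw [mem_ball, dist_eq_norm] at hz
    show _ ≤ ε * 1
    linarith
  · exact fun z => ⟨ψ.nonneg, ψ.le_one⟩
  · intro z
    rw [fd_scale hψd, norm_smul, norm_inv, Real.norm_of_nonneg hε.le, div_eq_inv_mul]
    exact mul_le_mul_of_nonneg_left ((hA _).trans ((le_max_left _ _).trans (le_max_left _ _))) (by positivity)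
  · intro z
    have e : ∀ i : Fin n, fderiv ℝ (fun x => fderiv ℝ (fun z => ψ (ε⁻¹ • (z - Y))) x (EuclideanSpace.single i (1:ℝ))) z (EuclideanSpace.single i (1:ℝ)) =
        (ε ^ 2)⁻¹ * fderiv ℝ (fun x => fderiv ℝ (ψ : Eu n → ℝ) x (EuclideanSpace.single i 1)) (ε⁻¹ • (z - Y)) (EuclideanSpace.single i 1) := fun i => by
      have h1 : (fun x => fderiv ℝ (fun z => ψ (ε⁻¹ • (z - Y))) x (EuclideanSpace.single i (1:ℝ))) =
          fun x => (fun x => ε⁻¹ * fderiv ℝ (ψ : Eu n → ℝ) x (EuclideanSpace.single i 1)) (ε⁻¹ • (x - Y)) := by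
        ext x; rw [fd_scale hψd]; simp
      have hd := (hfd (EuclideanSpace.single i 1)).differentiable (by norm_num)
      rw [h1, fd_scale (hd.const_mul _), fderiv_const_mul (hd _)]
      simp only [smul_apply, smul_eq_mul]
      rw [← mul_assoc, pow_two, mul_inv]
    simp_rw [e]
    rw [← Finset.mul_sum, abs_mul, abs_of_pos (by positivity), div_eq_inv_mul]
    refine mul_le_mul_of_nonneg_left ?_ (by positivity)
    by_cases hz : ε⁻¹ • (z - Y) ∈ tsupport (ψ : Eu n → ℝ)
    · exact (hB _ hz).trans ((le_max_right _ _).trans (le_max_left _ _))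
    · have := hLs _ hz
      simp only [hL] at this
      rw [this, abs_zero]; positivity

end RG

namespace RG

lemma grad_neg1 {n : ℕ} (η : Eu n → ℝ) (z : Eu n) : gradient (fun z => 1 - η z) z = - gradient η z := by
  simp only [gradient]
  rw [fderiv_const_sub]; simp

lemma flux {n : ℕ} {Ω : Set (Eu n)} (hΩ : IsOpen Ω) {Y : Eu n} {F η : Eu n → ℝ} (hF : ContDiffOn ℝ 1 F (Ω \ {Y}))
    (hη : ContDiff ℝ (⊤ : ℕ∞) η) (hs : tsupport η ⊆ Ω) {ε r N B : ℝ} (hε : 0 < ε) (hη1 : ∀ z ∈ ball Y ε, η z = 1)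
    (hr : tsupport η ⊆ ball Y r) (hN : ∀ z ∈ Ω \ {Y}, |F z| ≤ N) (hN0 : 0 ≤ N) (hB0 : 0 ≤ B)
    (hB : ∀ z, |∑ i : Fin n, fderiv ℝ (fun x => fderiv ℝ η x (EuclideanSpace.single i 1)) z (EuclideanSpace.single i 1)| ≤ B) :
    |∫ z in Ω, ⟪gradient F z, gradient η z⟫| ≤ N * B * volume.real (ball Y r) := by
  have hO : IsOpen (Ω \ {Y}) := hΩ.sdiff isClosed_singleton
  have hc : HasCompactSupport η := (isCompact_closedBall Y r).of_isClosed_subset (isClosed_tsupport η) (hr.trans ball_subset_closedBall)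
  have hp : ∀ i : Fin n, ContDiff ℝ 1 (fun x => fderiv ℝ η x (EuclideanSpace.single i (1:ℝ))) := fun i =>
    (hη.fderiv_right (m := 1) (by norm_cast)).clm_apply contDiff_const
  have hpc : ∀ i : Fin n, HasCompactSupport (fun x => fderiv ℝ η x (EuclideanSpace.single i (1:ℝ))) := fun i => hc.fderiv_apply ℝ _
  have hps : ∀ i : Fin n, tsupport (fun x => fderiv ℝ η x (EuclideanSpace.single i (1:ℝ))) ⊆ Ω \ {Y} := fun i x hx => by
    refine ⟨hs (tsupport_fderiv_apply_subset ℝ _ hx), fun h => ?_⟩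
    rw [mem_singleton_iff] at h
    rw [h] at hx
    refine notMem_tsupport_iff_eventuallyEq.2 ?_ hx
    filter_upwards [isOpen_ball.mem_nhds (mem_ball_self hε)] with y hy
    have : η =ᶠ[𝓝 y] fun _ => 1 := by
      filter_upwards [isOpen_ball.mem_nhds hy] with w hw
      exact hη1 w hw
    rw [this.fderiv_eq]; simp
  have e0 : ∫ z in Ω, ⟪gradient F z, gradient η z⟫ = ∫ z, ⟪gradient F z, gradient η z⟫ := by
    apply setIntegral_eq_integral_of_forall_compl_eq_zero
    intro x hx
    have : gradient η x = 0 := by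
      rw [gradient, fderiv_of_notMem_tsupport (𝕜 := ℝ) (fun h => hx (hs h))]; simp
    rw [this, inner_zero_right]
  have e1 : ∫ z, ⟪gradient F z, gradient η z⟫ = - ∫ z, F z * ∑ i : Fin n, fderiv ℝ (fun x => fderiv ℝ η x (EuclideanSpace.single i 1)) z (EuclideanSpace.single i 1) := by
    simp_rw [inner_grad, Finset.mul_sum]
    rw [integral_finsetSum, integral_finsetSum, ← Finset.sum_neg_distrib]
    · refine Finset.sum_congr rfl fun i _ => ?_
      rw [ibp hO hF (hp i) (hpc i) (hps i), neg_neg]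
    · intro i _
      exact int_mul hO hF.continuousOn (((hp i).continuous_fderiv (by norm_num)).clm_apply continuous_const) ((hpc i).fderiv_apply ℝ _) ((tsupport_fderiv_apply_subset ℝ _).trans (hps i))
    · intro i _
      exact int_mul hO (cont_fd hO hF _) (hp i).continuous (hpc i) (hps i)
  have hz : ∀ z, z ∉ tsupport η ∨ z = Y → ∑ i : Fin n, fderiv ℝ (fun x => fderiv ℝ η x (EuclideanSpace.single i 1)) z (EuclideanSpace.single i 1) = 0 := fun z hz => by
    refine Finset.sum_eq_zero fun i _ => ?_
    rw [fderiv_of_notMem_tsupport (𝕜 := ℝ)]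
    · simp
    · intro h
      rcases hz with hz | hz
      · exact hz (tsupport_fderiv_apply_subset ℝ _ h)
      · exact (hps i h).2 hz
  rw [e0, e1, abs_neg, ← setIntegral_eq_integral_of_forall_compl_eq_zero (s := ball Y r), ← Real.norm_eq_abs]
  · refine norm_setIntegral_le_of_norm_le_const measure_ball_lt_top fun z _ => ?_
    by_cases h : z ∉ tsupport η ∨ z = Y
    · rw [hz z h]; simp; positivity
    · push Not at h
      rw [norm_mul]
      exact mul_le_mul (hN z ⟨hs h.1, h.2⟩) (hB z) (norm_nonneg _) hN0
  · intro x hx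
    rw [hz x (Or.inl fun h => hx (hr h)), mul_zero]

set_option maxHeartbeats 1000000 in
lemma base_energy {n : ℕ} {Ω : Set (Eu n)} {σ : Measure (Eu n)} {a : ℝ} {Y : Eu n} {u : Eu n → ℝ} (S : Sol Ω σ a Y u)
    {θ C Λ : ℝ} {ck : Eu n → ℝ → Eu n} (G : Geo Ω θ C Λ ck) {γ l N δ : ℝ} (h1 : γ < 1) (hl : 0 < l) (hN : 1 ≤ N) (hδ : 0 < δ)
    {v h : ℝ → ℝ} (hv : ∀ x, 1 ≤ x → ContDiffAt ℝ 1 v x ∧ ContDiffAt ℝ 1 h x ∧ HasDerivAt (fun t => v t ^ 2) (h x) x ∧ 0 ≤ v x ∧ v x ^ 2 ≤ N ∧ v x ≤ x ∧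
      (x ≤ N → x ^ γ ≤ 2 * v x ^ 2) ∧ 0 ≤ h x ∧ h x ≤ h 1 ∧ (deriv v x) ^ 2 ≤ 1 / (4 * (1 - γ)) * (- deriv h x)) (hh1 : h 1 ≤ 1) :
    ∃ ξ : Eu n → ℝ, (∀ z, ξ z ∈ Icc (0:ℝ) 1) ∧ (∀ z ∉ ball Y δ, ξ z = 1) ∧ ContDiffOn ℝ 1 (fun z => ξ z * v (1 + l * u z)) Ω ∧
      ContinuousOn (fun z => ξ z * v (1 + l * u z)) (closure Ω) ∧ 
      ∫⁻ z, gr2 Ω (fun z => ξ z * v (1 + l * u z)) z ≤ ENNReal.ofReal ((1 / (2 * (1 - γ)) + 1) * l) := by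
  obtain ⟨K, hK, hη⟩ := eta n
  have hOm := S.op.measurableSet
  have hg : 0 < 1 - γ := by linarith
  have hN0 : 0 < N := by linarith
  obtain ⟨R, hR, hRΩ⟩ := Metric.isOpen_iff.1 S.op Y S.hY
  have hω := ωn_pos n
  set E := (1 / (2 * (1 - γ)) * (N * K) + 2 * N * K ^ 2) * (ωn n * 4 ^ n) with hE
  have hEp : 0 < E := by positivity
  obtain ⟨ε, hε, hεs⟩ : ∃ ε, 0 < ε ∧ ε < min (min 1 (R / 4)) (min (δ / 4) (l / E)) := exists_between (by positivity)
  simp only [lt_min_iff] at hεs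
  obtain ⟨⟨e1, e2⟩, e3, e4⟩ := hεs
  rw [lt_div_iff₀ hEp] at e4
  obtain ⟨η, η1, η2, η3, η4, η5, η6⟩ := hη Y ε hε
  have hr4 : tsupport η ⊆ ball Y (4 * ε) := η2.trans (closedBall_subset_ball (by linarith))
  have hsΩ : tsupport η ⊆ Ω := hr4.trans ((ball_subset_ball (by linarith)).trans hRΩ)
  have hcη : HasCompactSupport η := (isCompact_closedBall Y _).of_isClosed_subset (isClosed_tsupport η) η2
  have hV : volume.real (ball Y (4 * ε)) ≤ ωn n * 4 ^ n * (ε ^ 2 * ε) := by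
    rw [measureReal_def, vol_ball Y (by positivity), ENNReal.toReal_ofReal (by positivity), mul_pow, mul_assoc]
    have : ε ^ n ≤ ε ^ 2 * ε := by
      rw [← pow_succ]; exact pow_le_pow_of_le_one hε.le e1.le G.hn
    gcongr
  set V := volume.real (ball Y (4 * ε)) with hVd
  have hV0 : 0 ≤ V := measureReal_nonneg
  have hξc : ContDiff ℝ 1 (fun z => 1 - η z) := contDiff_const.sub (η1.of_le (by norm_cast))
  have hξ0 : ∀ z ∈ ball Y ε, (fun z => 1 - η z) z = 0 := fun z hz => by simp [η3 z hz]
  have hU : ∀ t, 0 ≤ t → 1 ≤ 1 + l * t := fun t ht => by nlinarith [mul_nonneg hl.le ht]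
  have hUd : ∀ t, HasDerivAt (fun t => 1 + l * t) l t := fun t => by
    simpa using ((hasDerivAt_id t).const_mul l).const_add 1
  have hUc : ∀ t, ContDiffAt ℝ 1 (fun t : ℝ => 1 + l * t) t := fun t => contDiffAt_const.add (contDiffAt_const.mul contDiffAt_id)
  have hvc : ∀ t, 0 ≤ t → ContDiffAt ℝ 1 (fun t => v (1 + l * t)) t := fun t ht => (hv _ (hU t ht)).1.comp t (hUc t)
  have hhc : ∀ t, 0 ≤ t → ContDiffAt ℝ 1 (fun t => h 1 - h (1 + l * t)) t := fun t ht =>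
    contDiffAt_const.sub ((hv _ (hU t ht)).2.1.comp t (hUc t))
  have dv : ∀ t, 0 ≤ t → deriv (fun t => v (1 + l * t)) t = deriv v (1 + l * t) * l := fun t ht =>
    (((hv _ (hU t ht)).1.differentiableAt (by norm_num)).hasDerivAt.comp t (hUd t)).deriv
  have dh : ∀ t, 0 ≤ t → deriv (fun t => h 1 - h (1 + l * t)) t = - (deriv h (1 + l * t) * l) := fun t ht =>
    ((((hv _ (hU t ht)).2.1.differentiableAt (by norm_num)).hasDerivAt.comp t (hUd t)).const_sub (h 1)).deriv
  obtain ⟨t1, t2, t3, t4, -, -⟩ := S.test hξc hε hξ0 hvc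
  obtain ⟨-, -, -, -, t5, t6⟩ := S.test hξc hε hξ0 hhc
  have hsub := S.sub G hξc hε hξ0 (fun z => by linarith [(η4 z).2]) hhc (fun t ht => by linarith [(hv _ (hU t ht)).2.2.2.2.2.2.2.2.1])
  set I1 := ∫ z in Ω, (1 - η z) * deriv (fun t => h 1 - h (1 + l * t)) (u z) * ‖gradient u z‖ ^ 2 with hI1
  -- the flux
  have hw := S.wk η η1 hcη
  have hb0 : ∫ P in frontier Ω, u P * η P ∂σ = 0 := by
    rw [setIntegral_congr_fun isClosed_frontier.measurableSet (g := fun _ => (0:ℝ)) (fun P hP => ?_)]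
    · simp
    · have : η P = 0 := image_eq_zero_of_notMem_tsupport fun hh => by
        have := hsΩ hh
        rw [S.op.frontier_eq] at hP; exact hP.2 this
      simp [this]
  rw [hb0, mul_zero, add_zero, η3 Y (mem_ball_self hε)] at hw
  have hi := (S.int_grad η1 hcη).1
  have hg0 : ∀ z, z = Y → gradient η z = 0 := fun z hz => by
    have : η =ᶠ[𝓝 z] fun _ => 1 := by
      filter_upwards [isOpen_ball.mem_nhds (by rw [hz]; exact mem_ball_self hε : z ∈ ball Y ε)] with y hy
      exact η3 y hy
    rw [gradient, this.fderiv_eq]; simp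
  have hF : ContDiffOn ℝ 1 (fun z => v (1 + l * u z) ^ 2) (Ω \ {Y}) := fun z hz =>
    (((hvc _ (S.nn z ⟨subset_closure hz.1, hz.2⟩)).comp z (S.u1 hz.1 hz.2)).pow 2).contDiffWithinAt
  have hfl := flux S.op hF η1 hsΩ hε η3 hr4 (N := N) (B := K / ε ^ 2) (fun z hz => by
    have := (hv _ (hU _ (S.nn z ⟨subset_closure hz.1, hz.2⟩))).2.2.2.2.1
    rw [abs_of_nonneg (by positivity)]; exact this) hN0.le (by positivity) η6
  have hFg : ∫ z in Ω, ⟪gradient (fun z => v (1 + l * u z) ^ 2) z, gradient η z⟫ = l * ∫ z in Ω, (h 1 * ⟪gradient u z, gradient η z⟫ + (h 1 - h (1 + l * u z)) * ⟪gradient u z, gradient (fun z => 1 - η z) z⟫) := by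
    rw [← integral_const_mul]
    refine setIntegral_congr_fun hOm fun z hz => ?_
    by_cases hzY : z = Y
    · simp only [grad_neg1, hg0 z hzY]; simp
    · have hun := S.nn z ⟨subset_closure hz, hzY⟩
      have hd := (hv _ (hU _ hun)).2.2.1.comp (u z) (hUd (u z))
      have hgc := grad_comp ((S.u1 hz hzY).differentiableAt (by norm_num)) hd
      have e : gradient (fun z => v (1 + l * u z) ^ 2) z = (h (1 + l * u z) * l) • gradient u z := hgc
      simp only [grad_neg1, e, inner_neg_right, inner_smul_left]
      simp; ring
  rw [hFg, integral_add (hi.const_mul _) t6, integral_const_mul, hw] at hfl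
  have hI1b : l * I1 ≤ l + N * (K / ε ^ 2) * V := by
    rw [← hVd] at hfl
    have h2 := (abs_le.1 hfl).1
    have h3 := mul_le_mul_of_nonneg_left hsub hl.le
    have h4 := mul_le_mul_of_nonneg_left hh1 hl.le
    linarith
  -- energy
  have hpt : ∀ z ∈ Ω, ‖gradient (fun z => (1 - η z) * v (1 + l * u z)) z‖ ^ 2 ≤ (ball Y (4 * ε)).indicator (fun _ => 2 * N * (K / ε) ^ 2) z + 
      1 / (2 * (1 - γ)) * l * ((1 - η z) * deriv (fun t => h 1 - h (1 + l * t)) (u z) * ‖gradient u z‖ ^ 2) := fun z hz => by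
    rw [t3 z hz]
    by_cases hzY : z = Y
    · have : (1 - η z) = 0 := hξ0 z (by rw [hzY]; exact mem_ball_self hε)
      rw [grad_neg1, hg0 z hzY, this]; simp
      exact indicator_nonneg (fun _ _ => by positivity) z
    · have hun := S.nn z ⟨subset_closure hz, hzY⟩
      obtain ⟨-, -, -, a4, a5, -, -, -, -, a10⟩ := hv _ (hU _ hun)
      rw [dv _ hun, dh _ hun, grad_neg1]
      have b1 : ‖v (1 + l * u z) • -gradient η z‖ ^ 2 ≤ (ball Y (4 * ε)).indicator (fun _ => N * (K / ε) ^ 2) z := by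
        rw [norm_smul, norm_neg, ngrad, mul_pow, Real.norm_eq_abs, sq_abs]
        by_cases hzb : z ∈ ball Y (4 * ε)
        · rw [indicator_of_mem hzb]
          exact mul_le_mul a5 (pow_le_pow_left₀ (norm_nonneg _) (η5 z) 2) (by positivity) hN0.le
        · rw [indicator_of_notMem hzb, fderiv_of_notMem_tsupport (𝕜 := ℝ) (fun hh => hzb (hr4 hh))]; simp
      have b2 : ‖((1 - η z) * (deriv v (1 + l * u z) * l)) • gradient u z‖ ^ 2 ≤ 1 / (4 * (1 - γ)) * l * ((1 - η z) * (-(deriv h (1 + l * u z) * l)) * ‖gradient u z‖ ^ 2) := by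
        rw [norm_smul, mul_pow, Real.norm_eq_abs, sq_abs]
        have c1 : (1 - η z) ^ 2 ≤ 1 - η z := by nlinarith [(η4 z).1, (η4 z).2]
        have c2 : 0 ≤ 1 - η z := by linarith [(η4 z).2]
        calc ((1 - η z) * (deriv v (1 + l * u z) * l)) ^ 2 * ‖gradient u z‖ ^ 2 = (1 - η z) ^ 2 * deriv v (1 + l * u z) ^ 2 * (l ^ 2 * ‖gradient u z‖ ^ 2) := by ring
          _ ≤ (1 - η z) * (1 / (4 * (1 - γ)) * (- deriv h (1 + l * u z))) * (l ^ 2 * ‖gradient u z‖ ^ 2) := by gcongr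
          _ = _ := by ring
      have b3 : ‖v (1 + l * u z) • -gradient η z + ((1 - η z) * (deriv v (1 + l * u z) * l)) • gradient u z‖ ^ 2 ≤ 2 * ‖v (1 + l * u z) • -gradient η z‖ ^ 2 + 2 * ‖((1 - η z) * (deriv v (1 + l * u z) * l)) • gradient u z‖ ^ 2 := by
        set p := v (1 + l * u z) • -gradient η z
        set q := ((1 - η z) * (deriv v (1 + l * u z) * l)) • gradient u z
        have := pow_le_pow_left₀ (norm_nonneg _) (norm_add_le p q) 2
        nlinarith [sq_nonneg (‖p‖ - ‖q‖)]
      have b4 : (ball Y (4 * ε)).indicator (fun _ => 2 * N * (K / ε) ^ 2) z = 2 * (ball Y (4 * ε)).indicator (fun _ => N * (K / ε) ^ 2) z := by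
        simp only [indicator]; split_ifs <;> ring
      rw [b4]
      refine b3.trans ?_
      have b5 : 1 / (2 * (1 - γ)) = 2 * (1 / (4 * (1 - γ))) := by field_simp; norm_num
      rw [b5]; linarith
  refine ⟨fun z => 1 - η z, fun z => ⟨by linarith [(η4 z).2], by linarith [(η4 z).1]⟩, fun z hz => ?_, t1, t2, ?_⟩
  · have : η z = 0 := image_eq_zero_of_notMem_tsupport fun hh => hz (ball_subset_ball (by linarith) (hr4 hh))
    simp [this]
  · rw [en_fin S.op t4]
    apply ENNReal.ofReal_le_ofReal
    have ii : IntegrableOn ((ball Y (4 * ε)).indicator (fun _ => 2 * N * (K / ε) ^ 2)) Ω := by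
      refine Integrable.integrableOn ?_
      rw [integrable_indicator_iff measurableSet_ball]
      exact integrableOn_const measure_ball_lt_top.ne
    have hm := setIntegral_mono_on t4 (ii.add (t5.const_mul _)) hOm hpt
    refine hm.trans ?_
    rw [integral_add' ii (t5.const_mul _), integral_const_mul, ← hI1]
    have i1 : ∫ z in Ω, (ball Y (4 * ε)).indicator (fun _ => 2 * N * (K / ε) ^ 2) z ≤ 2 * N * (K / ε) ^ 2 * V := by
      rw [setIntegral_indicator measurableSet_ball, setIntegral_const, smul_eq_mul, mul_comm]
      refine mul_le_mul_of_nonneg_left ?_ (by positivity)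
      exact measureReal_mono inter_subset_right measure_ball_lt_top.ne
    have i2 : 1 / (2 * (1 - γ)) * (l * I1) ≤ 1 / (2 * (1 - γ)) * (l + N * (K / ε ^ 2) * V) := mul_le_mul_of_nonneg_left hI1b (by positivity)
    have i3 : 2 * N * (K / ε) ^ 2 * V + 1 / (2 * (1 - γ)) * (N * (K / ε ^ 2) * V) ≤ l := by
      have : 2 * N * (K / ε) ^ 2 * V + 1 / (2 * (1 - γ)) * (N * (K / ε ^ 2) * V) = (1 / (2 * (1 - γ)) * (N * K) + 2 * N * K ^ 2) * (V / ε ^ 2) := by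
        field_simp; ring
      rw [this]
      have hq : V / ε ^ 2 ≤ ωn n * 4 ^ n * ε := by
        rw [div_le_iff₀ (by positivity)]; linarith
      refine (mul_le_mul_of_nonneg_left hq (by positivity)).trans ?_
      rw [← mul_assoc, ← hE]; linarith
    linarith

end RG

namespace RG

noncomputable def gam (n : ℕ) : ℝ := (2 * (n:ℝ) - 3) / (2 * n - 2)

lemma gam_spec {n : ℕ} (hn : 3 ≤ n) : 0 < gam n ∧ gam n < 1 ∧ 1 < gam n * kap n := by
  have : (3:ℝ) ≤ n := by exact_mod_cast hn
  refine ⟨div_pos (by linarith) (by linarith), ?_, ?_⟩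
  · rw [gam, div_lt_one (by linarith)]; linarith
  · have h1 : (n:ℝ) - 2 ≠ 0 := by linarith
    have h2 : (n:ℝ) - 1 ≠ 0 := by linarith
    have : gam n * kap n = (2 * n - 3) / (2 * (n - 2)) := by
      rw [gam, kap, show 2 * (n:ℝ) - 2 = 2 * (n - 1) by ring]; field_simp
    rw [this, one_lt_div (by linarith)]; linarith

lemma pow_kap2 {n : ℕ} (hn : 3 ≤ n) {s : ℝ} (hs : 0 < s) : s * (s ^ (n - 2)) ^ kap n = s ^ n := by
  have := pow_kap hn hs
  rw [Real.inv_rpow (by positivity)] at this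
  have h : 0 < (s ^ (n - 2)) ^ kap n := by positivity
  field_simp at this
  linarith

lemma add_rpow_le {x y p : ℝ} (hx : 0 ≤ x) (hy : 0 ≤ y) (hp : 1 ≤ p) : (x + y) ^ p ≤ 2 ^ (p - 1) * (x ^ p + y ^ p) := by
  have := NNReal.rpow_add_le_mul_rpow_add_rpow ⟨x, hx⟩ ⟨y, hy⟩ hp
  exact_mod_cast this

lemma Sol.mass {n : ℕ} {Ω : Set (Eu n)} {σ : Measure (Eu n)} {a : ℝ} {Y : Eu n} {u : Eu n → ℝ} (S : Sol Ω σ a Y u) :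
    ∫⁻ z in frontier Ω, ENNReal.ofReal (a * u z) ∂σ ≤ ENNReal.ofReal 1 := by
  obtain ⟨χ, h1, h2, -, h4, -⟩ := cutoff (Ω := (univ : Set (Eu n))) isOpen_univ S.bd.isCompact_closure (subset_univ _)
  have hw := S.wk χ h1 h2
  have e1 : ∫ X in Ω, ⟪gradient u X, gradient χ X⟫ = 0 := by
    rw [setIntegral_congr_fun S.op.measurableSet (g := fun _ => (0:ℝ)) (fun z hz => ?_)]
    · simp
    · have : χ =ᶠ[𝓝 z] fun _ => 1 := by
        filter_upwards [S.op.mem_nhds hz] with y hy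
        exact h4 y (subset_closure hy)
      have : gradient χ z = 0 := by rw [gradient, this.fderiv_eq]; simp
      simp [this]
  have e2 : ∫ P in frontier Ω, u P * χ P ∂σ = ∫ P in frontier Ω, u P ∂σ :=
    setIntegral_congr_fun isClosed_frontier.measurableSet fun z hz => by
      simp only [h4 z (frontier_subset_closure hz), mul_one]
  rw [e1, e2, h4 Y (subset_closure S.hY), zero_add, ← integral_const_mul] at hw
  have hi : IntegrableOn (fun z => a * u z) (frontier Ω) σ := (bint S.bd S.fin (S.co.mono S.front)).const_mul a
  rw [← ofReal_integral_eq_lintegral_ofReal hi ((ae_restrict_iff' isClosed_frontier.measurableSet).2 (Filter.Eventually.of_forall fun z hz => mul_nonneg S.ap.le (S.nn z (S.front hz)))), hw]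

set_option maxHeartbeats 1000000 in
lemma base (n : ℕ) (hn : 3 ≤ n) (C Λ Cσ d cd : ℝ) (hC : 0 < C) (hΛ : 1 ≤ Λ) (hCσ : 0 < Cσ) (hd : (n:ℝ) - 2 < d) (hcd : 0 < cd) :
    ∃ K : ℝ, 0 < K ∧ ∀ (Ω : Set (Eu n)) (σ : Measure (Eu n)) (M θ : ℝ) (ck : Eu n → ℝ → Eu n), IsMixedPair M Cσ d cd Ω σ → Geo Ω θ C Λ ck →
    ∀ (a : ℝ) (Y : Eu n) (u : Eu n → ℝ), Sol Ω σ a Y u → diam Ω ^ (n - 2) ≤ a * (σ (frontier Ω)).toReal → ∀ X ∈ Ω, ∀ (k : ℕ) (s : ℝ),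
    s = diam Ω / 200 * (1/2) ^ k → 200 * s ≤ dist X Y → 
    ∫⁻ z in Ω ∩ ball X (2 * s), ENNReal.ofReal ((1 + s ^ (n - 2) * u z) ^ (gam n * kap n)) ≤ ENNReal.ofReal (K * s ^ n) := by
  obtain ⟨Ka, hKa, hanc⟩ := anchor n hn C Λ Cσ d cd hC hΛ hCσ hd hcd
  obtain ⟨Ks, hKs, hsob⟩ := sobolev n hn C Λ hC hΛ
  obtain ⟨g0, g1, g2⟩ := gam_spec hn
  have hκ := kap_gt hn
  set γ := gam n
  set κ := kap n with hκd
  have hω := ωn_pos n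
  have hg : 0 < 1 - γ := by linarith
  set c := 1 / (2 * (1 - γ)) + 1 with hc
  have hcp : 0 < c := by positivity
  set A := 2 * (Ka * c) + 2 * (1 + Ka) ^ 2 with hA
  have hAp : 0 < A := by positivity
  refine ⟨2 ^ (κ - 1) * (4 ^ κ * (Ks * c ^ κ) + (4 * A) ^ κ * (ωn n * 2 ^ n)), by positivity, ?_⟩
  intro Ω σ M θ ck P G a Y u S hD X hX k s hs hsd
  have hDp := G.Dp
  have hsp : 0 < s := by rw [hs]; positivity
  have hs200 : s ≤ diam Ω / 200 := by
    rw [hs]; exact mul_le_of_le_one_right (by positivity) (pow_le_one₀ (by norm_num) (by norm_num))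
  set l := s ^ (n - 2) with hl
  have hlp : 0 < l := by positivity
  obtain ⟨A0, hA0, hA0u⟩ := S.bdd hsp
  set N := 1 + l * A0 with hN
  have hN1 : 1 ≤ N := by rw [hN]; nlinarith [mul_pos hlp hA0]
  obtain ⟨v, h, hv, hh1⟩ := auxfn g0 g1 hN1
  obtain ⟨ξ, x1, x2, x3, x4, x5⟩ := base_energy S G g1 hlp hN1 hsp hv hh1
  set w := fun z => ξ z * v (1 + l * u z) with hw
  have hmeas : AEMeasurable (fun z => ENNReal.ofReal (a * u z)) (σ.restrict (frontier Ω)) := 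
    (((S.co.mono S.front).aemeasurable isClosed_frontier.measurableSet).const_mul a).ennreal_ofReal
  obtain ⟨Q, hQ, hfQ, hAn⟩ := hanc Ω σ M θ ck P G X hX w x3 x4 (c * l) (by positivity) x5 (fun z => ENNReal.ofReal (a * u z)) hmeas 1 one_pos S.mass
  have huQ := S.nn Q (S.front hQ)
  have hσ : 0 < a * (σ (frontier Ω)).toReal := lt_of_lt_of_le (by positivity) hD
  have hσ0 : 0 < (σ (frontier Ω)).toReal := pos_of_mul_pos_right hσ S.ap.le
  have hUQ : l * u Q ≤ Ka := by
    have h1 := (ENNReal.ofReal_le_ofReal_iff (by positivity)).1 hfQ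
    rw [mul_one, le_div_iff₀ hσ0] at h1
    have h2 : l ≤ a * (σ (frontier Ω)).toReal := by
      refine le_trans ?_ hD
      exact pow_le_pow_left₀ hsp.le (by linarith) _
    calc l * u Q ≤ a * (σ (frontier Ω)).toReal * u Q := by gcongr
      _ = a * u Q * (σ (frontier Ω)).toReal := by ring
      _ ≤ Ka := h1
  have hwQ : w Q ∈ Icc 0 (1 + Ka) := by
    have h1 : 1 ≤ 1 + l * u Q := by nlinarith [mul_nonneg hlp.le huQ]
    obtain ⟨-, -, -, a4, -, a6, -⟩ := hv _ h1
    have := x1 Q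
    refine ⟨mul_nonneg this.1 a4, ?_⟩
    calc w Q ≤ 1 * v (1 + l * u Q) := mul_le_mul_of_nonneg_right this.2 a4
      _ ≤ _ := by linarith
  have hAnb : ∀ z ∈ Ω ∩ ball X (2 * s), (An θ ck w z s) ^ 2 ≤ A := fun z hz => by
    have h1 := hAn k z (subset_closure hz.1) (by rw [← hs]; have := mem_ball'.1 hz.2; linarith)
    rw [← hs, ← hl, mul_assoc, mul_comm c l, inv_mul_cancel_left₀ hlp.ne'] at h1
    have h2 : w Q ^ 2 ≤ (1 + Ka) ^ 2 := pow_le_pow_left₀ hwQ.1 hwQ.2 2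
    rw [hA]
    nlinarith [sq_nonneg (An θ ck w z s - 2 * w Q)]
  have hpt : ∀ z ∈ Ω ∩ ball X (2 * s), ENNReal.ofReal ((1 + l * u z) ^ (γ * κ)) ≤ 
      ENNReal.ofReal (2 ^ (κ - 1) * 4 ^ κ) * ENNReal.ofReal ((w z - An θ ck w z s) ^ 2) ^ κ + ENNReal.ofReal (2 ^ (κ - 1) * (4 * A) ^ κ) := fun z hz => by
    have hzY : z ∉ ball Y s := fun hh => by
      have h1 := mem_ball'.1 hz.2
      have h1 := mem_ball.1 hz.2
      have h2 := mem_ball.1 hh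
      have := dist_triangle_left X Y z
      linarith
    have hu := hA0u z ⟨subset_closure hz.1, hzY⟩
    have hU1 : 1 ≤ 1 + l * u z := by nlinarith [mul_nonneg hlp.le hu.1]
    have hUN : 1 + l * u z ≤ N := by rw [hN]; gcongr; exact hu.2
    obtain ⟨-, -, -, a4, -, -, a7, -⟩ := hv _ hU1
    have h3 := a7 hUN
    have hwz : w z = v (1 + l * u z) := by simp only [hw, x2 z hzY, one_mul]
    rw [← hwz] at h3
    have h4 := hAnb z hz
    set q := An θ ck w z s
    have h5 : (1 + l * u z) ^ γ ≤ 4 * (w z - q) ^ 2 + 4 * A := by nlinarith [sq_nonneg (w z - 2 * q)]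
    have h6 : (1 + l * u z) ^ (γ * κ) ≤ (4 * (w z - q) ^ 2 + 4 * A) ^ κ := by
      rw [Real.rpow_mul (by linarith)]
      exact Real.rpow_le_rpow (Real.rpow_nonneg (by linarith) _) h5 (by linarith)
    have h7 : (4 * (w z - q) ^ 2 + 4 * A) ^ κ ≤ 2 ^ (κ - 1) * ((4 * (w z - q) ^ 2) ^ κ + (4 * A) ^ κ) := 
      add_rpow_le (by positivity) (by positivity) hκ.le
    have h8 : (4 * (w z - q) ^ 2) ^ κ = 4 ^ κ * ((w z - q) ^ 2) ^ κ := Real.mul_rpow (by norm_num) (by positivity)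
    rw [ENNReal.ofReal_rpow_of_nonneg (by positivity) (by linarith), ← ENNReal.ofReal_mul (by positivity), ← ENNReal.ofReal_add (by positivity) (by positivity)]
    apply ENNReal.ofReal_le_ofReal
    rw [h8] at h7
    linarith
  have hms : MeasurableSet (Ω ∩ ball X (2 * s)) := S.op.measurableSet.inter measurableSet_ball
  calc ∫⁻ z in Ω ∩ ball X (2 * s), ENNReal.ofReal ((1 + l * u z) ^ (γ * κ)) ≤ ∫⁻ z in Ω ∩ ball X (2 * s), 
        (ENNReal.ofReal (2 ^ (κ - 1) * 4 ^ κ) * ENNReal.ofReal ((w z - An θ ck w z s) ^ 2) ^ κ + ENNReal.ofReal (2 ^ (κ - 1) * (4 * A) ^ κ)) := setLIntegral_mono' hms hpt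
    _ = ENNReal.ofReal (2 ^ (κ - 1) * 4 ^ κ) * (∫⁻ z in Ω ∩ ball X (2 * s), ENNReal.ofReal ((w z - An θ ck w z s) ^ 2) ^ κ) + ENNReal.ofReal (2 ^ (κ - 1) * (4 * A) ^ κ) * volume (Ω ∩ ball X (2 * s)) := by
        rw [lintegral_add_right _ measurable_const, lintegral_const_mul' _ _ ENNReal.ofReal_ne_top, setLIntegral_const]
    _ ≤ ENNReal.ofReal (2 ^ (κ - 1) * 4 ^ κ) * (ENNReal.ofReal (Ks * s) * ENNReal.ofReal (c * l) ^ κ) + ENNReal.ofReal (2 ^ (κ - 1) * (4 * A) ^ κ) * ENNReal.ofReal (ωn n * (2 * s) ^ n) := by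
        have b1 : ∫⁻ z in Ω ∩ ball X (2 * s), ENNReal.ofReal ((w z - An θ ck w z s) ^ 2) ^ κ ≤ ENNReal.ofReal (Ks * s) * ENNReal.ofReal (c * l) ^ κ :=
          (lintegral_mono_set inter_subset_left).trans ((hsob Ω θ ck G w x3 x4 s hsp hs200).trans (by gcongr))
        have b2 : volume (Ω ∩ ball X (2 * s)) ≤ ENNReal.ofReal (ωn n * (2 * s) ^ n) := by
          rw [← vol_ball X (by positivity)]; exact measure_mono inter_subset_right
        gcongr
    _ = _ := by
        rw [ENNReal.ofReal_rpow_of_nonneg (by positivity) (by linarith), ← ENNReal.ofReal_mul (by positivity), ← ENNReal.ofReal_mul (by positivity), ← ENNReal.ofReal_mul (by positivity), ← ENNReal.ofReal_add (by positivity) (by positivity)]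
        congr 1
        rw [Real.mul_rpow hcp.le hlp.le, mul_pow 2 s n]
        have := pow_kap2 hn hsp
        rw [← hκd, ← hl] at this
        have e : Ks * s * (c ^ κ * l ^ κ) = Ks * c ^ κ * s ^ n := by rw [← this]; ring
        rw [e]; ring

end RG

namespace RG

lemma cut2 : ∃ K : ℝ, 0 < K ∧ ∀ (n : ℕ) (X : Eu n) (r R : ℝ), 0 < r → r < R → ∃ η : Eu n → ℝ, ContDiff ℝ 1 η ∧
    (∀ z, η z ∈ Icc (0:ℝ) 1) ∧ (∀ z ∈ ball X r, η z = 1) ∧ (∀ z ∉ ball X R, η z = 0 ∧ gradient η z = 0) ∧ ∀ z, ‖gradient η z‖ ≤ K / (R - r) := by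
  have hT : ContDiff ℝ 1 Real.smoothTransition := Real.smoothTransition.contDiff
  have hTc : Continuous (deriv Real.smoothTransition) := hT.continuous_deriv (by norm_num)
  obtain ⟨A, hA⟩ := (isCompact_Icc (a := (0:ℝ)) (b := 1)).exists_bound_of_continuousOn hTc.continuousOn
  have hA' : ∀ t, 0 ≤ t → |deriv Real.smoothTransition t| ≤ max A 1 := fun t h0 => by
    rcases le_or_gt t 1 with h1 | h1
    · exact (hA t ⟨h0, h1⟩).trans (le_max_left _ _)
    · have : Real.smoothTransition =ᶠ[𝓝 t] fun _ => 1 := by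
        filter_upwards [isOpen_Ioi.mem_nhds h1] with y hy
        exact Real.smoothTransition.one_of_one_le (le_of_lt hy)
      rw [this.deriv_eq]; simp
  have hAp : 0 < max A 1 := by positivity
  set A' := max A 1
  refine ⟨2 * A', by positivity, fun n X r R hr hR => ?_⟩
  have hq : 0 < R ^ 2 - r ^ 2 := by nlinarith
  set f : Eu n → ℝ := fun z => (R ^ 2 - ‖z - X‖ ^ 2) / (R ^ 2 - r ^ 2) with hf
  have hfc : ContDiff ℝ 1 f := (contDiff_const.sub ((contDiff_id.sub contDiff_const).norm_sq ℝ)).div_const _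
  have hfg : ∀ z, ‖gradient f z‖ ≤ 2 * ‖z - X‖ / (R ^ 2 - r ^ 2) := fun z => by
    have h1 : HasFDerivAt (fun z : Eu n => ‖z - X‖ ^ 2) (2 • (innerSL ℝ (z - X)).comp (ContinuousLinearMap.id ℝ (Eu n))) z :=
      ((hasFDerivAt_id z).sub_const X).norm_sq
    have h2 := (h1.const_sub (R ^ 2)).const_smul (R ^ 2 - r ^ 2)⁻¹
    have e : f = fun z => (R ^ 2 - r ^ 2)⁻¹ • (R ^ 2 - ‖z - X‖ ^ 2) := by
      ext z; simp only [hf, smul_eq_mul]; rw [div_eq_inv_mul]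
    have h2' : HasFDerivAt f ((R ^ 2 - r ^ 2)⁻¹ • (-(2 • (innerSL ℝ (z - X)).comp (ContinuousLinearMap.id ℝ (Eu n))) : Eu n →L[ℝ] ℝ)) z := by rw [e]; exact h2
    rw [ngrad, h2'.fderiv, norm_smul, norm_neg, ContinuousLinearMap.comp_id, Real.norm_eq_abs, abs_of_pos (by positivity), div_eq_inv_mul]
    refine mul_le_mul_of_nonneg_left ?_ (by positivity)
    rw [two_smul, two_mul]
    refine (norm_add_le _ _).trans (by rw [innerSL_apply_norm])
  have hc : ContDiff ℝ 1 (fun z => Real.smoothTransition (f z)) := hT.comp hfc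
  have h0 : ∀ z ∉ ball X R, Real.smoothTransition (f z) = 0 := fun z hz => by
    apply Real.smoothTransition.zero_of_nonpos
    rw [mem_ball, dist_eq_norm, not_lt] at hz
    apply div_nonpos_of_nonpos_of_nonneg _ hq.le
    nlinarith
  have hg0 : ∀ z ∉ ball X R, gradient (fun z => Real.smoothTransition (f z)) z = 0 := fun z hz => by
    have : IsLocalMin (fun z => Real.smoothTransition (f z)) z := Filter.Eventually.of_forall fun y => by
      simp only [h0 z hz]; exact Real.smoothTransition.nonneg _
    rw [gradient, this.fderiv_eq_zero]; simp
  refine ⟨_, hc, fun z => ⟨Real.smoothTransition.nonneg _, Real.smoothTransition.le_one _⟩, fun z hz => ?_, fun z hz => ⟨h0 z hz, hg0 z hz⟩, fun z => ?_⟩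
  · apply Real.smoothTransition.one_of_one_le
    rw [mem_ball, dist_eq_norm] at hz
    rw [hf]; simp only
    rw [one_le_div hq]
    nlinarith [norm_nonneg (z - X)]
  · by_cases hz : z ∈ ball X R
    · have hz' := hz
      rw [mem_ball, dist_eq_norm] at hz'
      rw [grad_comp (hfc.differentiable (by norm_num) z) (hT.differentiable (by norm_num) (f z)).hasDerivAt, norm_smul]
      have hfz : 0 ≤ f z := div_nonneg (by nlinarith [norm_nonneg (z - X)]) hq.le
      calc _ ≤ A' * (2 * ‖z - X‖ / (R ^ 2 - r ^ 2)) := mul_le_mul (hA' _ hfz) (hfg z) (norm_nonneg _) hAp.le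
        _ ≤ A' * (2 * R / (R ^ 2 - r ^ 2)) := by gcongr
        _ ≤ _ := by
          have : R - r > 0 := by linarith
          rw [mul_div_assoc', div_le_div_iff₀ hq this]
          have : A' * (2 * R) * (R - r) ≤ 2 * A' * (R + r) * (R - r) := by
            refine mul_le_mul_of_nonneg_right ?_ (by linarith)
            nlinarith [mul_pos hAp hr]
          linarith
    · rw [hg0 z hz, norm_zero]
      have : R - r > 0 := by linarith
      positivity

set_option maxHeartbeats 1000000 in
lemma moser_energy {n : ℕ} {Ω : Set (Eu n)} {σ : Measure (Eu n)} {a : ℝ} {Y : Eu n} {u : Eu n → ℝ} (S : Sol Ω σ a Y u)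
    {θ C Λ : ℝ} {ck : Eu n → ℝ → Eu n} (G : Geo Ω θ C Λ ck) {l p A R ρ : ℝ} (hl : 0 < l) (hp : 1 < p) (hρ : 0 < ρ) {X : Eu n}
    (hXY : R + ρ ≤ dist X Y) {η : Eu n → ℝ} (η1 : ContDiff ℝ 1 η) (η2 : ∀ z, η z ∈ Icc (0:ℝ) 1)
    (η3 : ∀ z ∉ ball X R, η z = 0 ∧ gradient η z = 0) (η4 : ∀ z, ‖gradient η z‖ ≤ A) {J : ℝ} (hJ0 : 0 ≤ J)
    (hJ : ∫⁻ z in Ω ∩ ball X R, ENNReal.ofReal ((1 + l * u z) ^ p) ≤ ENNReal.ofReal J) :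
    ContDiffOn ℝ 1 (fun z => η z * (1 + l * u z) ^ (p / 2)) Ω ∧ ContinuousOn (fun z => η z * (1 + l * u z) ^ (p / 2)) (closure Ω) ∧ 
      ∫⁻ z, gr2 Ω (fun z => η z * (1 + l * u z) ^ (p / 2)) z ≤ ENNReal.ofReal ((2 + 2 * p ^ 2 / (p - 1) ^ 2) * (A ^ 2 * J)) := by
  have hOm := S.op.measurableSet
  have hp1 : 0 < p - 1 := by linarith
  have hYX : ∀ z ∈ ball Y ρ, z ∉ ball X R := fun z hz hh => by
    have h1 := mem_ball.1 hz
    have h2 := mem_ball.1 hh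
    have := dist_triangle_left X Y z
    linarith
  have hη0 : ∀ z ∈ ball Y ρ, η z = 0 := fun z hz => (η3 z (hYX z hz)).1
  have hU : ∀ t, 0 ≤ t → 1 ≤ 1 + l * t := fun t ht => by nlinarith [mul_nonneg hl.le ht]
  have hUd : ∀ t, HasDerivAt (fun t => 1 + l * t) l t := fun t => by
    simpa using ((hasDerivAt_id t).const_mul l).const_add 1
  have hUc : ∀ t, ContDiffAt ℝ 1 (fun t : ℝ => 1 + l * t) t := fun t => contDiffAt_const.add (contDiffAt_const.mul contDiffAt_id)
  have hPc : ∀ q : ℝ, ∀ t, 0 ≤ t → ContDiffAt ℝ 1 (fun t => (1 + l * t) ^ q) t := fun q t ht =>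
    (hUc t).rpow_const_of_ne (by linarith [hU t ht])
  have hPd : ∀ q : ℝ, ∀ t, 0 ≤ t → deriv (fun t => (1 + l * t) ^ q) t = l * q * (1 + l * t) ^ (q - 1) := fun q t ht =>
    ((hUd t).rpow_const (Or.inl (by linarith [hU t ht]))).deriv
  obtain ⟨t1, t2, t3, t4, -, -⟩ := S.test η1 hρ hη0 (hPc (p / 2))
  have hξ0 : ∀ z ∈ ball Y ρ, (fun z => η z ^ 2) z = 0 := fun z hz => by simp [hη0 z hz]
  obtain ⟨-, -, -, -, t5, t6⟩ := S.test (η1.pow 2) hρ hξ0 (hPc (p - 1))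
  have hsub := S.sub G (η1.pow 2) hρ hξ0 (fun z => by positivity) (hPc (p - 1)) (fun t ht => by have := hU t ht; positivity)
  have hgξ : ∀ z, gradient (fun z => η z ^ 2) z = (2 * η z) • gradient η z := fun z => by
    have hd := η1.differentiable (by norm_num) z
    have : HasDerivAt (fun t : ℝ => t ^ 2) (2 * η z) (η z) := by simpa using hasDerivAt_pow 2 (η z)
    exact grad_comp hd this
  -- integrability of the power
  have hms : MeasurableSet (Ω ∩ ball X R) := hOm.inter measurableSet_ball
  have hun : ∀ z ∈ Ω ∩ ball X R, z ≠ Y := fun z hz hh => hYX z (by rw [hh]; exact mem_ball_self hρ) hz.2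
  have hu0 : ∀ z ∈ Ω ∩ ball X R, 0 ≤ u z := fun z hz => S.nn z ⟨subset_closure hz.1, hun z hz⟩
  have hpm : AEStronglyMeasurable (fun z => (1 + l * u z) ^ p) (volume.restrict (Ω ∩ ball X R)) := by
    refine ContinuousOn.aestronglyMeasurable (fun z hz => ?_) hms
    have h1 := (S.u1 hz.1 (hun z hz)).continuousAt
    have h2 := (hPc p _ (hu0 z hz)).continuousAt
    exact (ContinuousAt.comp (f := u) (x := z) h2 h1).continuousWithinAt
  have hnn : 0 ≤ᵐ[volume.restrict (Ω ∩ ball X R)] fun z => (1 + l * u z) ^ p :=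
    (ae_restrict_iff' hms).2 (Filter.Eventually.of_forall fun z hz => by have := hU _ (hu0 z hz); simp only [Pi.zero_apply]; positivity)
  have hpi : IntegrableOn (fun z => (1 + l * u z) ^ p) (Ω ∩ ball X R) :=
    ⟨hpm, by rw [hasFiniteIntegral_iff_ofReal hnn]; exact hJ.trans_lt ENNReal.ofReal_lt_top⟩
  have hpJ : ∫ z in Ω ∩ ball X R, (1 + l * u z) ^ p ≤ J := by
    rw [integral_eq_lintegral_of_nonneg_ae hnn hpm]
    exact ENNReal.toReal_le_of_le_ofReal hJ0 hJ
  have hii : IntegrableOn ((ball X R).indicator fun z => (1 + l * u z) ^ p) Ω := by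
    rw [IntegrableOn, integrable_indicator_iff measurableSet_ball, IntegrableOn, Measure.restrict_restrict measurableSet_ball, inter_comm]
    exact hpi
  have hiJ : ∫ z in Ω, (ball X R).indicator (fun z => (1 + l * u z) ^ p) z ≤ J := by
    rw [setIntegral_indicator measurableSet_ball]; exact hpJ
  set I := ∫ z in Ω, (ball X R).indicator (fun z => (1 + l * u z) ^ p) z with hI
  set E := ∫ z in Ω, η z ^ 2 * deriv (fun t => (1 + l * t) ^ (p - 1)) (u z) * ‖gradient u z‖ ^ 2 with hE
  have hA0 : 0 ≤ A := (norm_nonneg _).trans (η4 X)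
  have key1 : l * E ≤ l / 2 * E + 2 / (p - 1) * A ^ 2 * I := by
    have h1 : l * E ≤ ∫ z in Ω, - l * ((1 + l * u z) ^ (p - 1) * ⟪gradient u z, gradient (fun z => η z ^ 2) z⟫) := by
      rw [integral_const_mul]; nlinarith
    refine h1.trans ?_
    rw [hE, hI, ← integral_const_mul, ← integral_const_mul, ← integral_add (t5.const_mul _) (hii.const_mul _)]
    refine setIntegral_mono_on (t6.const_mul _) ((t5.const_mul _).add (hii.const_mul _)) hOm fun z hz => ?_
    by_cases hzb : z ∈ ball X R
    · have huz := hu0 z ⟨hz, hzb⟩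
      have hU1 := hU _ huz
      rw [indicator_of_mem hzb, hPd _ _ huz, hgξ, inner_smul_right]
      set W := 1 + l * u z
      have hW : 0 < W := by linarith
      have hin := neg_le_of_abs_le (abs_real_inner_le_norm (gradient u z) (gradient η z))
      set i := ⟪gradient u z, gradient η z⟫
      set g := ‖gradient u z‖
      set e := ‖gradient η z‖
      have he : e ≤ A := η4 z
      have he0 : 0 ≤ e := norm_nonneg _
      have hg0 : 0 ≤ g := norm_nonneg _
      have w1 : W ^ (p - 1) = W ^ (p / 2 - 1) * W ^ (p / 2) := by rw [← Real.rpow_add hW]; congr 1; ring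
      have w2 : W ^ (p - 1 - 1) = (W ^ (p / 2 - 1)) ^ 2 := by rw [← Real.rpow_natCast, ← Real.rpow_mul hW.le]; congr 1; push_cast; ring
      have w3 : W ^ p = (W ^ (p / 2)) ^ 2 := by rw [← Real.rpow_natCast, ← Real.rpow_mul hW.le]; congr 1; push_cast; ring
      rw [w1, w2, w3]
      have p1 : 0 < W ^ (p / 2 - 1) := by positivity
      have p2 : 0 < W ^ (p / 2) := by positivity
      set α := W ^ (p / 2 - 1)
      set β := W ^ (p / 2)
      have hz1 := (η2 z).1
      set y := η z
      calc -l * (α * β * (2 * y * i)) = 2 * (l * y * α * β) * (- i) := by ring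
        _ ≤ 2 * (l * y * α * β) * (g * A) := by
            refine mul_le_mul_of_nonneg_left ?_ (by positivity)
            nlinarith [mul_le_mul_of_nonneg_left he hg0]
        _ ≤ (p - 1) / 2 * (l * y * α * g) ^ 2 + 2 / (p - 1) * (A * β) ^ 2 := by
            have : (p - 1) / 2 * (l * y * α * g) ^ 2 + 2 / (p - 1) * (A * β) ^ 2 - 2 * (l * y * α * β) * (g * A) = 2 / (p - 1) * ((p - 1) / 2 * (l * y * α * g) - A * β) ^ 2 := by
              field_simp; ring
            have h0 : 0 ≤ 2 / (p - 1) * ((p - 1) / 2 * (l * y * α * g) - A * β) ^ 2 := by positivity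
            linarith
        _ = _ := by ring
    · rw [indicator_of_notMem hzb, hgξ, (η3 z hzb).1]; simp
  have key2 : ∫ z in Ω, ‖gradient (fun z => η z * (1 + l * u z) ^ (p / 2)) z‖ ^ 2 ≤ 2 * A ^ 2 * I + p ^ 2 / (2 * (p - 1)) * l * E := by
    rw [hE, hI, ← integral_const_mul, ← integral_const_mul, ← integral_add (hii.const_mul _) (t5.const_mul _)]
    refine setIntegral_mono_on t4 ((hii.const_mul _).add (t5.const_mul _)) hOm fun z hz => ?_
    rw [t3 z hz]
    by_cases hzb : z ∈ ball X R
    · have huz := hu0 z ⟨hz, hzb⟩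
      have hU1 := hU _ huz
      rw [indicator_of_mem hzb, hPd _ _ huz, hPd _ _ huz]
      set W := 1 + l * u z
      have hW : 0 < W := by linarith
      have w2 : W ^ (p - 1 - 1) = (W ^ (p / 2 - 1)) ^ 2 := by rw [← Real.rpow_natCast, ← Real.rpow_mul hW.le]; congr 1; push_cast; ring
      have w3 : W ^ p = (W ^ (p / 2)) ^ 2 := by rw [← Real.rpow_natCast, ← Real.rpow_mul hW.le]; congr 1; push_cast; ring
      rw [w2, w3]
      set P := W ^ (p / 2) • gradient η z with hP
      set Q := (η z * (l * (p / 2) * W ^ (p / 2 - 1))) • gradient u z with hQ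
      have b1 : ‖P‖ ^ 2 ≤ A ^ 2 * (W ^ (p / 2)) ^ 2 := by
        rw [hP, norm_smul, mul_pow, Real.norm_eq_abs, sq_abs, mul_comm]
        exact mul_le_mul_of_nonneg_right (pow_le_pow_left₀ (norm_nonneg _) (η4 z) 2) (by positivity)
      have b2 : ‖Q‖ ^ 2 = (η z * (l * (p / 2) * W ^ (p / 2 - 1))) ^ 2 * ‖gradient u z‖ ^ 2 := by
        rw [hQ, norm_smul, mul_pow, Real.norm_eq_abs, sq_abs]
      have b3 : ‖P + Q‖ ^ 2 ≤ 2 * ‖P‖ ^ 2 + 2 * ‖Q‖ ^ 2 := by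
        have := pow_le_pow_left₀ (norm_nonneg _) (norm_add_le P Q) 2
        nlinarith [sq_nonneg (‖P‖ - ‖Q‖)]
      have b4 : p ^ 2 / (2 * (p - 1)) * l * (η z ^ 2 * (l * (p - 1) * (W ^ (p / 2 - 1)) ^ 2) * ‖gradient u z‖ ^ 2) = 2 * ‖Q‖ ^ 2 := by
        rw [b2]; field_simp
      rw [b4]; linarith
    · rw [indicator_of_notMem hzb, (η3 z hzb).1, (η3 z hzb).2]; simp
  refine ⟨t1, t2, ?_⟩
  rw [en_fin S.op t4]
  apply ENNReal.ofReal_le_ofReal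
  refine key2.trans ?_
  have k3 : l * E ≤ 4 / (p - 1) * A ^ 2 * I := by
    have : 4 / (p - 1) * A ^ 2 * I = 2 * (2 / (p - 1) * A ^ 2 * I) := by ring
    rw [this]; linarith
  calc 2 * A ^ 2 * I + p ^ 2 / (2 * (p - 1)) * l * E = 2 * A ^ 2 * I + p ^ 2 / (2 * (p - 1)) * (l * E) := by ring
    _ ≤ 2 * A ^ 2 * I + p ^ 2 / (2 * (p - 1)) * (4 / (p - 1) * A ^ 2 * I) := by gcongr
    _ = (2 + 2 * p ^ 2 / (p - 1) ^ 2) * (A ^ 2 * I) := by field_simp; ring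
    _ ≤ _ := by gcongr

end RG

namespace RG

set_option maxHeartbeats 1000000 in
lemma moser_step (n : ℕ) (hn : 3 ≤ n) (θ C Λ : ℝ) (hθ : 0 < θ) (hC : 0 < C) (hΛ : 1 ≤ Λ) :
    ∃ Cst : ℝ, 0 < Cst ∧ ∀ (Ω : Set (Eu n)) (σ : Measure (Eu n)) (ck : Eu n → ℝ → Eu n), Geo Ω θ C Λ ck →
    ∀ (a : ℝ) (Y : Eu n) (u : Eu n → ℝ), Sol Ω σ a Y u → ∀ X ∈ Ω, ∀ s : ℝ, 0 < s → s ≤ diam Ω / 200 → 200 * s ≤ dist X Y →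
    ∀ (j : ℕ) (p x : ℝ), gam n * kap n ≤ p → 0 ≤ x →
    ∫⁻ z in Ω ∩ ball X (s * (1 + (1/2) ^ j)), ENNReal.ofReal ((1 + s ^ (n - 2) * u z) ^ p) ≤ ENNReal.ofReal (s ^ n * x) →
    ∫⁻ z in Ω ∩ ball X (s * (1 + (1/2) ^ (j + 1))), ENNReal.ofReal ((1 + s ^ (n - 2) * u z) ^ (p * kap n)) ≤
      ENNReal.ofReal (s ^ n * (Cst * (4 ^ kap n) ^ j * x ^ kap n)) := by
  obtain ⟨Ks, hKs, hsob⟩ := sobolev n hn C Λ hC hΛ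
  obtain ⟨K, hK, hcut⟩ := cut2
  obtain ⟨g0, g1, g2⟩ := gam_spec hn
  have hκ := kap_gt hn
  set p0 := gam n * kap n
  set κ := kap n with hκd
  have hω := ωn_pos n
  have hp0 : 0 < p0 - 1 := by linarith
  set B := (2 + 2 * p0 ^ 2 / (p0 - 1) ^ 2) * (K ^ 2 * 4) with hB
  have hBp : 0 < B := by positivity
  set ca := (ωn n)⁻¹ * (θ ^ n)⁻¹ with hca
  have hcap : 0 < ca := by positivity
  set D1 := 2 ^ (κ - 1) * 2 ^ κ * (Ks * B ^ κ) with hD1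
  set D2 := 2 ^ (κ - 1) * (2 * ca) ^ κ * (ωn n * 2 ^ n) with hD2
  have hD1p : 0 < D1 := by positivity
  have hD2p : 0 < D2 := by positivity
  refine ⟨D1 + D2, by positivity, ?_⟩
  intro Ω σ ck G a Y u S X hX s hsp hs200 hsd j p x hp hx hJ
  set l := s ^ (n - 2) with hl
  have hlp : 0 < l := by positivity
  have hq1 : (0:ℝ) < (1/2) ^ j := by positivity
  have hq2 : ((1:ℝ)/2) ^ j ≤ 1 := pow_le_one₀ (by norm_num) (by norm_num)
  have hq3 : ((1:ℝ)/2) ^ (j+1) = (1/2) ^ j / 2 := by rw [pow_succ]; ring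
  set R := s * (1 + (1/2) ^ j) with hR
  set r := s * (1 + (1/2) ^ (j+1)) with hr
  have hRr : R - r = s * ((1/2) ^ j / 2) := by rw [hR, hr, hq3]; ring
  have hrR : r < R := by have : 0 < s * ((1/2) ^ j / 2) := by positivity
                         linarith
  have hrp : 0 < r := by positivity
  have hR2 : R ≤ 2 * s := by rw [hR]; nlinarith
  obtain ⟨η, η1, η2, ηr, η3, η4⟩ := hcut n X r R hrp hrR
  have hp1 : 1 < p := by linarith
  have hJ0 : 0 ≤ s ^ n * x := by positivity
  obtain ⟨t1, t2, t3⟩ := moser_energy S G hlp hp1 hsp (by linarith) η1 η2 η3 η4 hJ0 hJ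
  set w := fun z => η z * (1 + l * u z) ^ (p / 2) with hw
  have hE : ∫⁻ z, gr2 Ω w z ≤ ENNReal.ofReal (B * 4 ^ j * x * l) := by
    refine t3.trans (ENNReal.ofReal_le_ofReal ?_)
    have e1 : (K / (R - r)) ^ 2 * (s ^ n * x) = (K ^ 2 * 4) * 4 ^ j * x * l := by
      obtain ⟨m, rfl⟩ : ∃ m, n = m + 2 := ⟨n - 2, by omega⟩
      rw [hRr, hl, Nat.add_sub_cancel, pow_add, show (4:ℝ) ^ j = ((2:ℝ) ^ j) ^ 2 by rw [← pow_mul, mul_comm, pow_mul]; norm_num, one_div, inv_pow]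
      field_simp
      ring
    have e2 : p ^ 2 / (p - 1) ^ 2 ≤ p0 ^ 2 / (p0 - 1) ^ 2 := by
      rw [← div_pow, ← div_pow]
      have : p / (p - 1) ≤ p0 / (p0 - 1) := by
        rw [div_le_div_iff₀ (by linarith) hp0]; nlinarith
      exact pow_le_pow_left₀ (div_nonneg (by linarith) (by linarith)) this 2
    rw [e1, hB]
    have e3 : (2 + 2 * p ^ 2 / (p - 1) ^ 2) ≤ (2 + 2 * p0 ^ 2 / (p0 - 1) ^ 2) := by
      rw [mul_div_assoc, mul_div_assoc]; linarith
    calc _ ≤ (2 + 2 * p0 ^ 2 / (p0 - 1) ^ 2) * (K ^ 2 * 4 * 4 ^ j * x * l) := mul_le_mul_of_nonneg_right e3 (by positivity)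
      _ = _ := by ring
  have hUz : ∀ z ∈ Ω ∩ ball X R, 1 ≤ 1 + l * u z := fun z hz => by
    have hzY : z ≠ Y := fun hh => by
      have h1 := mem_ball'.1 hz.2
      rw [hh] at h1; linarith
    have := S.nn z ⟨subset_closure hz.1, hzY⟩
    nlinarith [mul_nonneg hlp.le this]
  have hw2 : ∫⁻ z in Ω, ENNReal.ofReal (w z ^ 2) ≤ ENNReal.ofReal (s ^ n * x) := by
    refine le_trans ?_ hJ
    rw [← lintegral_indicator S.op.measurableSet, ← lintegral_indicator (S.op.measurableSet.inter measurableSet_ball)]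
    refine lintegral_mono fun z => ?_
    by_cases hz : z ∈ Ω
    · rw [indicator_of_mem hz]
      by_cases hb : z ∈ ball X R
      · rw [indicator_of_mem (show z ∈ Ω ∩ ball X R from ⟨hz, hb⟩)]
        apply ENNReal.ofReal_le_ofReal
        have h1 := hUz z ⟨hz, hb⟩
        have h2 : ((1 + l * u z) ^ (p / 2)) ^ 2 = (1 + l * u z) ^ p := by
          rw [← Real.rpow_natCast, ← Real.rpow_mul (by linarith)]; norm_num
        simp only [hw]
        rw [mul_pow, h2]
        have h3 := η2 z
        exact mul_le_of_le_one_left (Real.rpow_nonneg (by linarith) _) (pow_le_one₀ h3.1 h3.2)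
      · simp only [hw, (η3 z hb).1]; simp
    · rw [indicator_of_notMem hz]; exact zero_le
  have hAnb : ∀ z ∈ Ω, (An θ ck w z s) ^ 2 ≤ ca * x := fun z hz => by
    have h1 := (G.An_L2 (t2.mono subset_closure) (subset_closure hz) hsp hs200).trans (mul_le_mul_right hw2 _)
    rw [← ENNReal.ofReal_mul (by positivity), ENNReal.ofReal_le_ofReal_iff (by positivity)] at h1
    refine h1.trans (le_of_eq ?_)
    rw [hca]; field_simp
  have hpt : ∀ z ∈ Ω ∩ ball X r, ENNReal.ofReal ((1 + l * u z) ^ (p * κ)) ≤ 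
      ENNReal.ofReal (2 ^ (κ - 1) * 2 ^ κ) * ENNReal.ofReal ((w z - An θ ck w z s) ^ 2) ^ κ + ENNReal.ofReal (2 ^ (κ - 1) * (2 * (ca * x)) ^ κ) := fun z hz => by
    have hU1 := hUz z ⟨hz.1, ball_subset_ball hrR.le hz.2⟩
    have hwz : w z = (1 + l * u z) ^ (p / 2) := by simp only [hw, ηr z hz.2, one_mul]
    have h2 : w z ^ 2 = (1 + l * u z) ^ p := by
      rw [hwz, ← Real.rpow_natCast, ← Real.rpow_mul (by linarith)]; norm_num
    have h4 := hAnb z hz.1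
    set q := An θ ck w z s
    have h5 : (1 + l * u z) ^ p ≤ 2 * (w z - q) ^ 2 + 2 * (ca * x) := by rw [← h2]; nlinarith [sq_nonneg (w z - 2 * q)]
    have h6 : (1 + l * u z) ^ (p * κ) ≤ (2 * (w z - q) ^ 2 + 2 * (ca * x)) ^ κ := by
      rw [Real.rpow_mul (by linarith)]
      exact Real.rpow_le_rpow (Real.rpow_nonneg (by linarith) _) h5 (by linarith)
    have h7 : (2 * (w z - q) ^ 2 + 2 * (ca * x)) ^ κ ≤ 2 ^ (κ - 1) * ((2 * (w z - q) ^ 2) ^ κ + (2 * (ca * x)) ^ κ) := 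
      add_rpow_le (by positivity) (by positivity) hκ.le
    have h8 : (2 * (w z - q) ^ 2) ^ κ = 2 ^ κ * ((w z - q) ^ 2) ^ κ := Real.mul_rpow (by norm_num) (by positivity)
    rw [ENNReal.ofReal_rpow_of_nonneg (by positivity) (by linarith), ← ENNReal.ofReal_mul (by positivity), ← ENNReal.ofReal_add (by positivity) (by positivity)]
    apply ENNReal.ofReal_le_ofReal
    rw [h8] at h7
    linarith
  have hms : MeasurableSet (Ω ∩ ball X r) := S.op.measurableSet.inter measurableSet_ball
  calc ∫⁻ z in Ω ∩ ball X r, ENNReal.ofReal ((1 + l * u z) ^ (p * κ)) ≤ ∫⁻ z in Ω ∩ ball X r, 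
        (ENNReal.ofReal (2 ^ (κ - 1) * 2 ^ κ) * ENNReal.ofReal ((w z - An θ ck w z s) ^ 2) ^ κ + ENNReal.ofReal (2 ^ (κ - 1) * (2 * (ca * x)) ^ κ)) := setLIntegral_mono' hms hpt
    _ = ENNReal.ofReal (2 ^ (κ - 1) * 2 ^ κ) * (∫⁻ z in Ω ∩ ball X r, ENNReal.ofReal ((w z - An θ ck w z s) ^ 2) ^ κ) + ENNReal.ofReal (2 ^ (κ - 1) * (2 * (ca * x)) ^ κ) * volume (Ω ∩ ball X r) := by
        rw [lintegral_add_right _ measurable_const, lintegral_const_mul' _ _ ENNReal.ofReal_ne_top, setLIntegral_const]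
    _ ≤ ENNReal.ofReal (2 ^ (κ - 1) * 2 ^ κ) * (ENNReal.ofReal (Ks * s) * ENNReal.ofReal (B * 4 ^ j * x * l) ^ κ) + ENNReal.ofReal (2 ^ (κ - 1) * (2 * (ca * x)) ^ κ) * ENNReal.ofReal (ωn n * (2 * s) ^ n) := by
        have b1 : ∫⁻ z in Ω ∩ ball X r, ENNReal.ofReal ((w z - An θ ck w z s) ^ 2) ^ κ ≤ ENNReal.ofReal (Ks * s) * ENNReal.ofReal (B * 4 ^ j * x * l) ^ κ :=
          (lintegral_mono_set inter_subset_left).trans ((hsob Ω θ ck G w t1 t2 s hsp hs200).trans (by gcongr))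
        have b2 : volume (Ω ∩ ball X r) ≤ ENNReal.ofReal (ωn n * (2 * s) ^ n) := by
          rw [← vol_ball X (by positivity)]; exact measure_mono (inter_subset_right.trans (ball_subset_ball (by linarith)))
        gcongr
    _ = ENNReal.ofReal (s ^ n * ((D1 * (4 ^ κ) ^ j + D2) * x ^ κ)) := by
        rw [ENNReal.ofReal_rpow_of_nonneg (by positivity) (by linarith), ← ENNReal.ofReal_mul (by positivity), ← ENNReal.ofReal_mul (by positivity), ← ENNReal.ofReal_mul (by positivity), ← ENNReal.ofReal_add (by positivity) (by positivity)]
        congr 1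
        rw [Real.mul_rpow (by positivity) hlp.le, Real.mul_rpow (by positivity) hx, Real.mul_rpow hBp.le (by positivity), mul_pow 2 s n, ← mul_assoc 2 ca x, Real.mul_rpow (by positivity) hx]
        have := pow_kap2 hn hsp
        rw [← hκd, ← hl] at this
        have e4 : ((4:ℝ) ^ j) ^ κ = (4 ^ κ) ^ j := by
          rw [← Real.rpow_natCast, ← Real.rpow_natCast, ← Real.rpow_mul (by norm_num), ← Real.rpow_mul (by norm_num), mul_comm]
        rw [e4, hD1, hD2]
        have e : Ks * s * (B ^ κ * (4 ^ κ) ^ j * x ^ κ * l ^ κ) = Ks * B ^ κ * (4 ^ κ) ^ j * x ^ κ * s ^ n := by rw [← this]; ring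
        rw [e]; ring
    _ ≤ _ := by
        apply ENNReal.ofReal_le_ofReal
        have h1 : (1:ℝ) ≤ (4 ^ κ) ^ j := one_le_pow₀ (Real.one_le_rpow (by norm_num) (by linarith))
        have h2 : D1 * (4 ^ κ) ^ j + D2 ≤ (D1 + D2) * (4 ^ κ) ^ j := by nlinarith
        gcongr

end RG

namespace RG

lemma iter_seq {Cst b κ K0 : ℝ} (hC : 0 < Cst) (hb : 1 ≤ b) (hκ : 1 < κ) (hK : 0 < K0) :
    ∃ c1 b1 T : ℝ, 0 < c1 ∧ 1 ≤ b1 ∧ 0 < T ∧ (c1 * b1 ^ 0)⁻¹ * T ^ (κ ^ 0 : ℝ) = K0 ∧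
      ∀ j : ℕ, Cst * b ^ j * ((c1 * b1 ^ j)⁻¹ * T ^ (κ ^ j : ℝ)) ^ κ = (c1 * b1 ^ (j + 1))⁻¹ * T ^ (κ ^ (j + 1) : ℝ) := by
  have hk : 0 < κ - 1 := by linarith
  have hb0 : 0 < b := by linarith
  set b1 := b ^ (1 / (κ - 1)) with hb1
  have hb1p : 0 < b1 := by positivity
  have hb1e : b1 ^ κ = b * b1 := by
    have : b1 ^ (κ - 1) = b := by
      rw [hb1, ← Real.rpow_mul hb0.le, one_div, inv_mul_cancel₀ hk.ne', Real.rpow_one]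
    rw [show κ = (κ - 1) + 1 by ring, Real.rpow_add hb1p, Real.rpow_one, this]
  set c1 := (Cst * b1) ^ (1 / (κ - 1)) with hc1
  have hc1p : 0 < c1 := by positivity
  have hc1e : c1 ^ κ = Cst * b1 * c1 := by
    have : c1 ^ (κ - 1) = Cst * b1 := by
      rw [hc1, ← Real.rpow_mul (by positivity), one_div, inv_mul_cancel₀ hk.ne', Real.rpow_one]
    rw [show κ = (κ - 1) + 1 by ring, Real.rpow_add hc1p, Real.rpow_one, this]
  refine ⟨c1, b1, c1 * K0, hc1p, Real.one_le_rpow hb (by positivity), by positivity, ?_, fun j => ?_⟩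
  · rw [pow_zero, pow_zero, Real.rpow_one]; field_simp
  · have e : (b1 ^ j) ^ κ = b ^ j * b1 ^ j := by
      rw [← Real.rpow_natCast, ← Real.rpow_mul hb1p.le, mul_comm, Real.rpow_mul hb1p.le, hb1e, Real.rpow_natCast, mul_pow, Real.rpow_natCast]
    rw [Real.mul_rpow (by positivity) (by positivity), Real.inv_rpow (by positivity), Real.mul_rpow hc1p.le (by positivity), e, hc1e, ← Real.rpow_mul (by positivity), ← pow_succ, pow_succ b1]
    field_simp

lemma rpow_contra {T T' κ Q : ℝ} (hT : 0 < T) (hTT : T < T') (hκ : 1 < κ) (h : ∀ j : ℕ, T' ^ (κ ^ j : ℝ) ≤ Q * T ^ (κ ^ j : ℝ)) : False := by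
  have h1 : 1 < T' / T := by rwa [one_lt_div hT]
  have t := (tendsto_rpow_atTop_of_base_gt_one _ h1).comp (tendsto_pow_atTop_atTop_of_one_lt hκ)
  obtain ⟨j, hj⟩ := (t.eventually_gt_atTop Q).exists
  have := h j
  simp only [Function.comp] at hj
  rw [Real.div_rpow (by linarith) hT.le, lt_div_iff₀ (by positivity)] at hj
  linarith

set_option maxHeartbeats 1000000 in
lemma sup_bound (n : ℕ) (hn : 3 ≤ n) (θ C Λ Cσ d cd : ℝ) (hθ : 0 < θ) (hC : 0 < C) (hΛ : 1 ≤ Λ) (hCσ : 0 < Cσ) (hd : (n:ℝ) - 2 < d) (hcd : 0 < cd) :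
    ∃ T : ℝ, 0 < T ∧ ∀ (Ω : Set (Eu n)) (σ : Measure (Eu n)) (M : ℝ) (ck : Eu n → ℝ → Eu n), IsMixedPair M Cσ d cd Ω σ → Geo Ω θ C Λ ck →
    ∀ (a : ℝ) (Y : Eu n) (u : Eu n → ℝ), Sol Ω σ a Y u → diam Ω ^ (n - 2) ≤ a * (σ (frontier Ω)).toReal → ∀ X ∈ Ω, ∀ (k : ℕ) (s : ℝ),
    s = diam Ω / 200 * (1/2) ^ k → 200 * s ≤ dist X Y → s ^ (n - 2) * u X ≤ T := by
  obtain ⟨K0, hK0, hbase⟩ := base n hn C Λ Cσ d cd hC hΛ hCσ hd hcd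
  obtain ⟨Cst, hCst, hstep⟩ := moser_step n hn θ C Λ hθ hC hΛ
  obtain ⟨g0, g1, g2⟩ := gam_spec hn
  have hκ := kap_gt hn
  have hω := ωn_pos n
  obtain ⟨c1, b1, T, hc1, hb1, hT, e0, eS⟩ := iter_seq hCst (Real.one_le_rpow (by norm_num : (1:ℝ) ≤ 4) (by linarith : 0 ≤ kap n)) hκ hK0
  refine ⟨T, hT, ?_⟩
  intro Ω σ M ck P G a Y u S hD X hX k s hs hsd
  have hDp := G.Dp
  have hsp : 0 < s := by rw [hs]; positivity
  have hs200 : s ≤ diam Ω / 200 := by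
    rw [hs]; exact mul_le_of_le_one_right (by positivity) (pow_le_one₀ (by norm_num) (by norm_num))
  have hb := hbase Ω σ M θ ck P G a Y u S hD X hX k s hs hsd
  have hst := hstep Ω σ ck G a Y u S X hX s hsp hs200 hsd
  set p0 := gam n * kap n
  set κ := kap n
  set l := s ^ (n - 2) with hl
  have hlp : 0 < l := by positivity
  have key : ∀ j : ℕ, ∫⁻ z in Ω ∩ ball X (s * (1 + (1/2) ^ j)), ENNReal.ofReal ((1 + l * u z) ^ (p0 * κ ^ j)) ≤
      ENNReal.ofReal (s ^ n * ((c1 * b1 ^ j)⁻¹ * T ^ (κ ^ j : ℝ))) := fun j => by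
    induction j with
    | zero =>
      rw [e0, pow_zero, pow_zero, mul_one, mul_comm _ K0, show s * (1 + 1) = 2 * s by ring]; exact hb
    | succ j ih =>
      have h1 : p0 ≤ p0 * κ ^ j := le_mul_of_one_le_right (by linarith) (one_le_pow₀ hκ.le)
      have := hst j _ _ h1 (by positivity) ih
      rw [eS j, mul_assoc p0, ← pow_succ] at this
      exact this
  have hXY : X ≠ Y := fun h => by rw [h, dist_self] at hsd; linarith
  have huX := S.nn X ⟨subset_closure hX, hXY⟩
  have hU : 1 ≤ 1 + l * u X := by nlinarith [mul_nonneg hlp.le huX]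
  have fin : (1 + l * u X) ^ p0 ≤ T := by
    by_contra! hlt
    obtain ⟨T', hT1, hT2⟩ := exists_between hlt
    have hopen : IsOpen (Ω \ {Y}) := S.op.sdiff isClosed_singleton
    have hnb : Ω \ {Y} ∈ 𝓝 X := hopen.mem_nhds ⟨hX, hXY⟩
    have hcu : ContinuousAt u X := S.co.continuousAt (Filter.mem_of_superset hnb (sdiff_subset_sdiff_left subset_closure))
    have hcg : ContinuousAt (fun z => (1 + l * u z) ^ p0) X :=
      (continuousAt_const.add (continuousAt_const.mul hcu)).rpow_const (Or.inr (by linarith))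
    obtain ⟨r1, hr1, hr1s⟩ := Metric.mem_nhds_iff.1 (Filter.inter_mem hnb (hcg.eventually_const_lt hT2))
    set r0 := min r1 s with hr0
    have hr0p : 0 < r0 := lt_min hr1 hsp
    refine rpow_contra (Q := s ^ n * c1⁻¹ * (ωn n * r0 ^ n)⁻¹) hT hT1 hκ fun j => ?_
    have sub : ball X r0 ⊆ Ω ∩ ball X (s * (1 + (1/2) ^ j)) := fun z hz => by
      refine ⟨(hr1s (ball_subset_ball (min_le_left _ _) hz)).1.1, ball_subset_ball ?_ hz⟩
      have : 0 < s * (1/2) ^ j := by positivity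
      rw [mul_add, mul_one]
      exact (min_le_right _ _).trans (by linarith)
    have hkj : (0:ℝ) < κ ^ j := by positivity
    have lb : ENNReal.ofReal (T' ^ (κ ^ j : ℝ)) * volume (ball X r0) ≤ ENNReal.ofReal (s ^ n * ((c1 * b1 ^ j)⁻¹ * T ^ (κ ^ j : ℝ))) := by
      refine le_trans ?_ ((lintegral_mono_set sub).trans (key j))
      rw [← setLIntegral_const]
      refine setLIntegral_mono' measurableSet_ball fun z hz => ?_
      apply ENNReal.ofReal_le_ofReal
      have hz' := hr1s (ball_subset_ball (min_le_left _ _) hz)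
      have hu := S.nn z ⟨subset_closure hz'.1.1, hz'.1.2⟩
      have hz2 : T' < (1 + l * u z) ^ p0 := hz'.2
      rw [Real.rpow_mul (by nlinarith [mul_nonneg hlp.le hu])]
      exact Real.rpow_le_rpow (by linarith) hz2.le hkj.le
    rw [vol_ball X hr0p, ← ENNReal.ofReal_mul (Real.rpow_nonneg (by linarith) _), ENNReal.ofReal_le_ofReal_iff (by positivity)] at lb
    have hbj : (c1 * b1 ^ j)⁻¹ ≤ c1⁻¹ := inv_anti₀ hc1 (le_mul_of_one_le_right hc1.le (one_le_pow₀ hb1))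
    have hv : 0 < ωn n * r0 ^ n := by positivity
    rw [← le_div_iff₀ hv] at lb
    refine lb.trans ?_
    rw [div_eq_mul_inv]
    calc _ ≤ s ^ n * (c1⁻¹ * T ^ (κ ^ j : ℝ)) * (ωn n * r0 ^ n)⁻¹ := by gcongr
      _ = _ := by ring
  have : (1 + l * u X) ^ (1:ℝ) ≤ (1 + l * u X) ^ p0 := Real.rpow_le_rpow_of_exponent_le hU (by linarith)
  rw [Real.rpow_one] at this
  linarith

end RG

/-- Dirichlet-regime upper bound: if `a·σ(∂Ω) ≥ diam(Ω)^{n-2}`, then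
`G_R(X,Y) ≤ C·|X-Y|^{2-n}` with `C` depending only on the geometric constants. -/
theorem stmt_1 (n : ℕ) (hn : 3 ≤ n) (M Cσ d cd : ℝ) :
    ∃ C : ℝ, 0 < C ∧
      ∀ (Ω : Set (EuclideanSpace ℝ (Fin n))) (σ : MeasureTheory.Measure (EuclideanSpace ℝ (Fin n))),
        IsMixedPair M Cσ d cd Ω σ →
        ∀ a : ℝ, 0 < a →
          Metric.diam Ω ^ ((n : ℝ) - 2) ≤ a * (σ (frontier Ω)).toReal →
          ∀ G : EuclideanSpace ℝ (Fin n) → EuclideanSpace ℝ (Fin n) → ℝ,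
            IsRobinGreen Ω σ a G →
            ∀ X ∈ Ω, ∀ Y ∈ Ω, X ≠ Y →
              G X Y ≤ C * dist X Y ^ ((2 : ℝ) - n) := by
  by_cases H : ∃ (Ω : Set (EuclideanSpace ℝ (Fin n))) (σ : Measure (EuclideanSpace ℝ (Fin n))), IsMixedPair M Cσ d cd Ω σ
  swap
  · exact ⟨1, one_pos, fun Ω σ h => (H ⟨Ω, σ, h⟩).elim⟩
  obtain ⟨Ω0, σ0, P0⟩ := H
  obtain ⟨θ, C, Λ, hgeo⟩ := RG.exists_geo hn M P0.nta.M_gt_one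
  obtain ⟨ck0, G0⟩ := hgeo Ω0 P0.nta P0.bounded P0.nonempty
  obtain ⟨T, hT, hsup⟩ := RG.sup_bound n hn θ C Λ Cσ d cd G0.θp G0.Cp G0.Λp P0.Cσ_pos P0.d_gt P0.cd_pos
  refine ⟨T * 400 ^ (n - 2), by positivity, ?_⟩
  intro Ω σ P a ha hD G hG X hX Y hY hXY
  obtain ⟨ck, Ge⟩ := hgeo Ω P.nta P.bounded P.nonempty
  have S : RG.Sol Ω σ a Y (fun Z => G Z Y) :=
    { op := P.nta.isOpen
      bd := P.bounded
      hY := hY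
      ap := ha
      fin := P.finite
      nn := hG.nonneg Y hY
      co := hG.contOn Y hY
      ha := hG.harmonic Y hY
      l2 := hG.grad_L2 Y hY
      l1 := hG.grad_L1 Y hY
      wk := hG.weak Y hY }
  have hcast : ((n - 2 : ℕ) : ℝ) = (n:ℝ) - 2 := by
    rw [Nat.cast_sub (by omega)]; norm_num
  rw [← hcast, Real.rpow_natCast] at hD
  have hDp := Ge.Dp
  have hr : 0 < dist X Y := dist_pos.2 hXY
  have hrD : dist X Y ≤ diam Ω := dist_le_diam_of_mem P.bounded hX hY
  obtain ⟨k, hk1, hk2⟩ := exists_nat_pow_near_of_lt_one (div_pos hr hDp) ((div_le_one hDp).2 hrD) (by norm_num : (0:ℝ) < 1/2) (by norm_num)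
  rw [lt_div_iff₀ hDp] at hk1
  rw [div_le_iff₀ hDp] at hk2
  set s := diam Ω / 200 * (1/2) ^ (k + 1) with hs
  have hsp : 0 < s := by positivity
  have h1 : 200 * s ≤ dist X Y := by rw [hs]; linarith
  have h2 : dist X Y ≤ 400 * s := by rw [hs, pow_succ]; linarith
  have h3 := hsup Ω σ M ck P Ge a Y _ S hD X hX (k + 1) s hs h1
  have h4 : dist X Y ^ ((2:ℝ) - n) = (dist X Y ^ (n - 2))⁻¹ := by
    rw [← Real.rpow_natCast, ← Real.rpow_neg hr.le, hcast]; congr 1; ring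
  rw [h4, ← div_eq_mul_inv, le_div_iff₀ (by positivity)]
  have h5 : dist X Y ^ (n - 2) ≤ 400 ^ (n - 2) * s ^ (n - 2) := by
    rw [← mul_pow]; exact pow_le_pow_left₀ hr.le h2 _
  have h0 : 0 ≤ G X Y := hG.nonneg Y hY X ⟨subset_closure hX, hXY⟩
  calc G X Y * dist X Y ^ (n - 2) ≤ G X Y * (400 ^ (n - 2) * s ^ (n - 2)) := by gcongr
    _ = (s ^ (n - 2) * G X Y) * 400 ^ (n - 2) := by ring
    _ ≤ T * 400 ^ (n - 2) := by gcongr
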